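/- Entropic repulsion bounds for the bridge: there exist constants c, C > 0, c_− > 0 and c_+ > 1 such that for every integer N ≥ 2, c/N^{c_−} ≤ R_N ≤ C/(log N)^{c_+}, where R_N := [∫_{[0,∞)^N} e^{−H_{[−1,N+2]}(0,0,z_1,…,z_N,0,0)} dz_1⋯dz_N] / [∫_{ℝ^N} e^{−H_{[−1,N+2]}(0,0,z_1,…,z_N,0,0)} dz_1⋯dz_N]; R_N equals the conditional probability P(Ω_N^+ | Z_{N+1} = 0, Z_{N+2} = 0) computed from the joint density of (Z_1,…,Z_{N+2}). -/

import Mathlib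

open MeasureTheory Filter Topology Set
open scoped ENNReal NNReal BigOperators

noncomputable section

/-- The bridge configuration `z_{-1} = z_0 = 0, (z_1,…,z_N) = z, z_{N+1} = z_{N+2} = 0`
extended to `ℤ`. -/
def bridgeExt (N : ℕ) (z : Fin N → ℝ) (i : ℤ) : ℝ :=
  if h : 0 < i ∧ i ≤ (N : ℤ) then z ⟨i.toNat - 1, by omega⟩ else 0

/-- `exp(−H_{[−1,N+2]}(0, 0, z_1, …, z_N, 0, 0))` -/
def bridgeWeight (E : ℝ → ℝ) (N : ℕ) (z : Fin N → ℝ) : ℝ :=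
  ∏ n ∈ Finset.Icc (0 : ℤ) ((N : ℤ) + 1),
    E (bridgeExt N z (n + 1) + bridgeExt N z (n - 1) - 2 * bridgeExt N z n)

/-- the bridge probability `R_N = P(Ω_N^+ | Z_{N+1} = 0, Z_{N+2} = 0)` -/
def bridgeRatio (E : ℝ → ℝ) (N : ℕ) : ℝ :=
  (∫ z in {z : Fin N → ℝ | ∀ i, 0 ≤ z i}, bridgeWeight E N z) /
    ∫ z : Fin N → ℝ, bridgeWeight E N z

/-- The partial sums `x_0 + ⋯ + x_{n-1}` of a sequence. -/
def partialSum (x : ℕ → ℝ) (n : ℕ) : ℝ := ∑ i ∈ Finset.range n, x i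

/-- The sums `∑_{k=1}^n (x_0 + ⋯ + x_{k-1})` of the partial sums of a sequence. -/
def areaSum (x : ℕ → ℝ) (n : ℕ) : ℝ := ∑ k ∈ Finset.range n, partialSum x (k + 1)

lemma partialSum_zero (x : ℕ → ℝ) : partialSum x 0 = 0 := by simp [partialSum]

lemma partialSum_succ (x : ℕ → ℝ) (n : ℕ) : partialSum x (n + 1) = partialSum x n + x n := by
  simp [partialSum, Finset.sum_range_succ]

lemma areaSum_zero (x : ℕ → ℝ) : areaSum x 0 = 0 := by simp [areaSum]

lemma areaSum_succ (x : ℕ → ℝ) (n : ℕ) :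
    areaSum x (n + 1) = areaSum x n + partialSum x (n + 1) := by
  simp [areaSum, Finset.sum_range_succ]

lemma areaSum_eq_sum (x : ℕ → ℝ) (n : ℕ) :
    areaSum x n = ∑ i ∈ Finset.range n, ((n : ℝ) - i) * x i := by
  induction n with
  | zero => simp [areaSum]
  | succ n ih =>
    rw [areaSum_succ, ih, partialSum, Finset.sum_range_succ, Finset.sum_range_succ, ← add_assoc,
      ← Finset.sum_add_distrib]
    push_cast
    congr 1
    · exact Finset.sum_congr rfl fun i _ => by ring
    · ring

@[fun_prop]
lemma measurable_partialSum (n : ℕ) : Measurable fun x : ℕ → ℝ => partialSum x n := by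
  unfold partialSum
  fun_prop

@[fun_prop]
lemma measurable_areaSum (n : ℕ) : Measurable fun x : ℕ → ℝ => areaSum x n := by
  unfold areaSum
  fun_prop

lemma partialSum_congr {x y : ℕ → ℝ} {n : ℕ} (h : ∀ i < n, x i = y i) :
    partialSum x n = partialSum y n :=
  Finset.sum_congr rfl fun i hi => h i (Finset.mem_range.1 hi)

lemma areaSum_congr {x y : ℕ → ℝ} {n : ℕ} (h : ∀ i < n, x i = y i) :
    areaSum x n = areaSum y n :=
  Finset.sum_congr rfl fun k hk => partialSum_congr fun i hi => h i (by
    have := Finset.mem_range.1 hk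
    omega)

/-- The sequence whose first `n` terms are those of `a` and which continues with `b`. -/
def glue (n : ℕ) (a b : ℕ → ℝ) (i : ℕ) : ℝ := if i < n then a i else b (i - n)

lemma glue_of_lt {n i : ℕ} (a b : ℕ → ℝ) (h : i < n) : glue n a b i = a i := if_pos h

lemma glue_add (n i : ℕ) (a b : ℕ → ℝ) : glue n a b (n + i) = b i := by simp [glue]

lemma partialSum_glue_of_le {n k : ℕ} (a b : ℕ → ℝ) (h : k ≤ n) :
    partialSum (glue n a b) k = partialSum a k :=
  partialSum_congr fun _ hi => glue_of_lt a b (hi.trans_le h)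

lemma areaSum_glue_of_le {n k : ℕ} (a b : ℕ → ℝ) (h : k ≤ n) :
    areaSum (glue n a b) k = areaSum a k :=
  areaSum_congr fun _ hi => glue_of_lt a b (hi.trans_le h)

lemma partialSum_glue_add (n m : ℕ) (a b : ℕ → ℝ) :
    partialSum (glue n a b) (n + m) = partialSum a n + partialSum b m := by
  induction m with
  | zero => simp [partialSum_zero, partialSum_glue_of_le]
  | succ m ih => rw [← add_assoc, partialSum_succ, ih, partialSum_succ, glue_add, add_assoc]

lemma areaSum_glue_add (n m : ℕ) (a b : ℕ → ℝ) :
    areaSum (glue n a b) (n + m) = areaSum a n + m * partialSum a n + areaSum b m := by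
  induction m with
  | zero => simp [areaSum_zero, areaSum_glue_of_le]
  | succ m ih =>
    rw [← add_assoc, areaSum_succ, ih, add_assoc n m 1, partialSum_glue_add, areaSum_succ]
    push_cast
    ring

@[fun_prop]
lemma measurable_glue (n : ℕ) :
    Measurable fun p : (ℕ → ℝ) × (ℕ → ℝ) => glue n p.1 p.2 := by
  refine measurable_pi_lambda _ fun i => ?_
  unfold glue
  split_ifs <;> fun_prop

/-- The law of an i.i.d. sequence with marginal `μ`. -/
def walkLaw (μ : Measure ℝ) [IsProbabilityMeasure μ] : Measure (ℕ → ℝ) :=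
  Measure.infinitePi fun _ => μ

section walkLaw

variable (μ : Measure ℝ) [IsProbabilityMeasure μ]

instance : IsProbabilityMeasure (walkLaw μ) := by
  unfold walkLaw
  infer_instance

lemma measurePreserving_glue (n : ℕ) :
    MeasurePreserving (fun p : (ℕ → ℝ) × (ℕ → ℝ) => glue n p.1 p.2)
      ((walkLaw μ).prod (walkLaw μ)) (walkLaw μ) := by
  refine ⟨measurable_glue n, Measure.eq_infinitePi _ fun s t ht => ?_⟩
  rw [Measure.map_apply (measurable_glue n)
    (MeasurableSet.pi s.countable_toSet fun i _ => ht i)]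
  set s₁ := s.filter (· < n)
  set s₂ := (s.filter (fun i => ¬ i < n)).image (· - n)
  have hpre : (fun p : (ℕ → ℝ) × (ℕ → ℝ) => glue n p.1 p.2) ⁻¹' (Set.pi s t)
      = (Set.pi s₁ t) ×ˢ (Set.pi s₂ fun i => t (n + i)) := by
    ext p
    simp only [mem_preimage, Set.mem_pi, Finset.mem_coe, mem_prod, s₁, s₂, Finset.mem_filter,
      Finset.mem_image]
    constructor
    · intro h
      refine ⟨fun i hi => ?_, ?_⟩
      · have := h i hi.1
        rwa [glue_of_lt _ _ hi.2] at this
      · rintro _ ⟨i, ⟨hi, hin⟩, rfl⟩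
        have := h i hi
        have hi' : n + (i - n) = i := by omega
        rw [← hi', glue_add] at this
        simpa [hi'] using this
    · rintro ⟨h₁, h₂⟩ i hi
      by_cases hin : i < n
      · rw [glue_of_lt _ _ hin]
        exact h₁ i ⟨hi, hin⟩
      · have := h₂ (i - n) ⟨i, ⟨hi, hin⟩, rfl⟩
        have hi' : n + (i - n) = i := by omega
        rw [hi'] at this
        rw [← hi', glue_add, hi']
        exact this
  rw [hpre, Measure.prod_prod, walkLaw, Measure.infinitePi_pi _ fun i _ => ht i,
    Measure.infinitePi_pi _ fun i _ => ht _, Finset.prod_image,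
    ← Finset.prod_filter_mul_prod_filter_not s (· < n)]
  · congr 1
    refine Finset.prod_congr rfl fun i hi => ?_
    have := (Finset.mem_filter.1 hi).2
    rw [show n + (i - n) = i by omega]
  · intro i hi j hj hij
    have h1 := (Finset.mem_filter.1 hi).2
    have h2 := (Finset.mem_filter.1 hj).2
    simp only at hij
    omega

lemma lintegral_walkLaw_glue (n : ℕ) {F : (ℕ → ℝ) → ℝ≥0∞} (hF : Measurable F) :
    ∫⁻ x, F x ∂walkLaw μ = ∫⁻ a, ∫⁻ b, F (glue n a b) ∂walkLaw μ ∂walkLaw μ := by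
  rw [← (measurePreserving_glue μ n).lintegral_comp hF, lintegral_prod]
  fun_prop

lemma measurePreserving_walkLaw_comp {f : ℕ → ℕ} (hf : Function.Injective f) :
    MeasurePreserving (fun x : ℕ → ℝ => x ∘ f) (walkLaw μ) (walkLaw μ) :=
  ⟨by fun_prop, Measure.map_infinitePi_infinitePi_of_inj (P := fun _ : ℕ => μ) hf⟩

lemma measurePreserving_walkLaw_fin (n : ℕ) :
    MeasurePreserving (fun (x : ℕ → ℝ) (i : Fin n) => x i) (walkLaw μ)
      (Measure.pi fun _ => μ) := by
  refine ⟨by fun_prop, ?_⟩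
  rw [← Measure.infinitePi_eq_pi]
  exact Measure.map_infinitePi_infinitePi_of_inj (P := fun _ : ℕ => μ) Fin.val_injective

lemma measurePreserving_walkLaw_eval (i : ℕ) :
    MeasurePreserving (fun x : ℕ → ℝ => x i) (walkLaw μ) μ :=
  ⟨by fun_prop, Measure.infinitePi_map_eval _ i⟩

lemma measurePreserving_walkLaw_pair {i j : ℕ} (h : i ≠ j) :
    MeasurePreserving (fun x : ℕ → ℝ => (x i, x j)) (walkLaw μ) (μ.prod μ) :=
  ⟨by fun_prop, Measure.infinitePi_map_eval_prod (P := fun _ : ℕ => μ) h⟩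

lemma iIndepFun_walkLaw : ProbabilityTheory.iIndepFun (fun (i : ℕ) (x : ℕ → ℝ) => x i)
    (walkLaw μ) :=
  ProbabilityTheory.iIndepFun_infinitePi (P := fun _ : ℕ => μ) (X := fun _ x => x)
    (fun _ => measurable_id)

variable {μ}

lemma memLp_sum_mul_walkLaw (h2 : MemLp id 2 μ) (n : ℕ) (c : ℕ → ℝ) :
    MemLp (fun x : ℕ → ℝ => ∑ i ∈ Finset.range n, c i * x i) 2 (walkLaw μ) :=
  memLp_finsetSum _ fun i _ =>
    (h2.comp_measurePreserving (measurePreserving_walkLaw_eval μ i)).const_mul (c i)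

lemma integral_sum_mul_walkLaw (h2 : MemLp id 2 μ) (h1 : ∫ x, x ∂μ = 0) (n : ℕ) (c : ℕ → ℝ) :
    ∫ x, ∑ i ∈ Finset.range n, c i * x i ∂walkLaw μ = 0 := by
  have hi : ∀ i, Integrable (fun x : ℕ → ℝ => x i) (walkLaw μ) := fun i =>
    (h2.comp_measurePreserving (measurePreserving_walkLaw_eval μ i)).integrable (by norm_num)
  rw [integral_finsetSum _ fun i _ => (hi i).const_mul _]
  refine Finset.sum_eq_zero fun i _ => ?_
  rw [integral_const_mul]
  have := (measurePreserving_walkLaw_eval μ i).map_eq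
  rw [← this, integral_map (measurable_pi_apply i).aemeasurable (by fun_prop)] at h1
  simp [h1]

lemma integral_sq_sum_mul_walkLaw (h2 : MemLp id 2 μ) (h1 : ∫ x, x ∂μ = 0) (n : ℕ)
    (c : ℕ → ℝ) :
    ∫ x, (∑ i ∈ Finset.range n, c i * x i) ^ 2 ∂walkLaw μ
      = (∑ i ∈ Finset.range n, c i ^ 2) * ∫ x, x ^ 2 ∂μ := by
  have hL := memLp_sum_mul_walkLaw h2 n c
  have hv := ProbabilityTheory.variance_of_integral_eq_zero hL.1.aemeasurable
    (integral_sum_mul_walkLaw h2 h1 n c)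
  rw [← hv]
  have e : (fun x : ℕ → ℝ => ∑ i ∈ Finset.range n, c i * x i)
      = ∑ i ∈ Finset.range n, fun x : ℕ → ℝ => c i * x i := by
    ext x
    simp
  rw [e, ProbabilityTheory.IndepFun.variance_sum
    (X := fun (i : ℕ) (x : ℕ → ℝ) => c i * x i)
    (fun i _ =>
      (h2.comp_measurePreserving (measurePreserving_walkLaw_eval μ i)).const_mul (c i))
    (fun i _ j _ hij => ?_), Finset.sum_mul]
  · refine Finset.sum_congr rfl fun i _ => ?_
    rw [ProbabilityTheory.variance_const_mul]
    congr 1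
    have h0 := (measurePreserving_walkLaw_eval μ i).map_eq
    have h1' : ∫ x, x i ∂walkLaw μ = 0 := by
      rw [← h0, integral_map (measurable_pi_apply i).aemeasurable (by fun_prop)] at h1
      exact h1
    rw [ProbabilityTheory.variance_of_integral_eq_zero
      (measurable_pi_apply i).aemeasurable h1']
    conv_rhs => rw [← h0]
    rw [integral_map (measurable_pi_apply i).aemeasurable (by fun_prop)]
  · exact ((iIndepFun_walkLaw μ).indepFun hij).comp (φ := fun y => c i * y)
      (ψ := fun y => c j * y) (by fun_prop) (by fun_prop)

lemma measure_abs_sum_mul_ge_le (h2 : MemLp id 2 μ) (h1 : ∫ x, x ∂μ = 0) (n : ℕ)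
    (c : ℕ → ℝ) {t : ℝ} (ht : 0 < t) :
    (walkLaw μ).real {x | t ≤ |∑ i ∈ Finset.range n, c i * x i|}
      ≤ (∑ i ∈ Finset.range n, c i ^ 2) * (∫ x, x ^ 2 ∂μ) / t ^ 2 := by
  have hL := memLp_sum_mul_walkLaw h2 n c
  have h0 := integral_sum_mul_walkLaw h2 h1 n c
  have := ProbabilityTheory.meas_ge_le_variance_div_sq hL ht
  rw [h0, ProbabilityTheory.variance_of_integral_eq_zero hL.1.aemeasurable h0,
    integral_sq_sum_mul_walkLaw h2 h1] at this
  simp only [sub_zero] at this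
  exact ENNReal.toReal_le_of_le_ofReal (div_nonneg (mul_nonneg (Finset.sum_nonneg fun _ _ =>
    sq_nonneg _) (integral_nonneg fun _ => sq_nonneg _)) (sq_nonneg _)) this

lemma measure_abs_partialSum_ge_le (h2 : MemLp id 2 μ) (h1 : ∫ x, x ∂μ = 0) (n : ℕ)
    {t : ℝ} (ht : 0 < t) :
    (walkLaw μ).real {x | t ≤ |partialSum x n|} ≤ n * (∫ x, x ^ 2 ∂μ) / t ^ 2 := by
  simpa [partialSum] using measure_abs_sum_mul_ge_le h2 h1 n (fun _ => 1) ht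

lemma sum_range_sub_sq_le (n : ℕ) :
    ∑ i ∈ Finset.range n, ((n : ℝ) - i) ^ 2 ≤ (n : ℝ) ^ 3 := by
  calc ∑ i ∈ Finset.range n, ((n : ℝ) - i) ^ 2 ≤ ∑ i ∈ Finset.range n, (n : ℝ) ^ 2 := by
        refine Finset.sum_le_sum fun i hi => ?_
        have : (i : ℝ) ≤ n := by exact_mod_cast (Finset.mem_range.1 hi).le
        exact pow_le_pow_left₀ (by linarith) (by linarith [Nat.cast_nonneg (α := ℝ) i]) 2
    _ = (n : ℝ) ^ 3 := by
        rw [Finset.sum_const, Finset.card_range, nsmul_eq_mul]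
        ring

lemma integral_sq_areaSum_le (h2 : MemLp id 2 μ) (h1 : ∫ x, x ∂μ = 0) (n : ℕ) :
    ∫ x, areaSum x n ^ 2 ∂walkLaw μ ≤ (n : ℝ) ^ 3 * ∫ x, x ^ 2 ∂μ := by
  simp only [areaSum_eq_sum]
  rw [integral_sq_sum_mul_walkLaw h2 h1]
  exact mul_le_mul_of_nonneg_right (sum_range_sub_sq_le n) (integral_nonneg fun _ => sq_nonneg _)

lemma integral_areaSum (h2 : MemLp id 2 μ) (h1 : ∫ x, x ∂μ = 0) (n : ℕ) :
    ∫ x, areaSum x n ∂walkLaw μ = 0 := by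
  simp only [areaSum_eq_sum]
  exact integral_sum_mul_walkLaw h2 h1 n _

lemma memLp_areaSum (h2 : MemLp id 2 μ) (n : ℕ) :
    MemLp (fun x => areaSum x n) 2 (walkLaw μ) := by
  simp only [areaSum_eq_sum]
  exact memLp_sum_mul_walkLaw h2 n _

lemma measure_abs_areaSum_ge_le (h2 : MemLp id 2 μ) (h1 : ∫ x, x ∂μ = 0) (n : ℕ)
    {t : ℝ} (ht : 0 < t) :
    (walkLaw μ).real {x | t ≤ |areaSum x n|} ≤ (n : ℝ) ^ 3 * (∫ x, x ^ 2 ∂μ) / t ^ 2 := by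
  simp only [areaSum_eq_sum]
  refine (measure_abs_sum_mul_ge_le h2 h1 n _ ht).trans ?_
  gcongr
  exact sum_range_sub_sq_le n

end walkLaw

/-- Continuous bounded centred probability densities with variance `σ²`, positive at the origin. -/
structure IsStepDensity (E : ℝ → ℝ) (σ : ℝ) : Prop where
  nonneg : ∀ x, 0 ≤ E x
  cont : Continuous E
  bdd : ∃ M, ∀ x, E x ≤ M
  pos : 0 < E 0
  int : Integrable E
  mass : ∫ x, E x = 1
  mom1 : Integrable fun x => x * E x
  mean : ∫ x, x * E x = 0
  mom2 : Integrable fun x => x ^ 2 * E x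
  var : ∫ x, x ^ 2 * E x = σ ^ 2
  sigma_pos : 0 < σ

/-- The law with density `E`. -/
def stepLaw (E : ℝ → ℝ) : Measure ℝ := volume.withDensity fun x => ENNReal.ofReal (E x)

namespace IsStepDensity

variable {E : ℝ → ℝ} {σ : ℝ}

lemma isProbabilityMeasure (h : IsStepDensity E σ) : IsProbabilityMeasure (stepLaw E) := by
  constructor
  rw [stepLaw, withDensity_apply _ MeasurableSet.univ, Measure.restrict_univ,
    ← ofReal_integral_eq_lintegral_ofReal h.int (Eventually.of_forall h.nonneg), h.mass]
  simp

lemma exists_bound (h : IsStepDensity E σ) : ∃ M, 0 < M ∧ ∀ x, E x ≤ M := by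
  obtain ⟨M, hM⟩ := h.bdd
  exact ⟨M, h.pos.trans_le (hM 0), hM⟩

/-- The density is bounded below on a neighbourhood of the origin. -/
lemma exists_lower_bound (h : IsStepDensity E σ) :
    ∃ r e : ℝ, 0 < r ∧ 0 < e ∧ ∀ x, |x| ≤ r → e ≤ E x := by
  have := h.cont.continuousAt.eventually (lt_mem_nhds (show E 0 / 2 < E 0 by linarith [h.pos]))
  obtain ⟨δ, hδ, hb⟩ := Metric.eventually_nhds_iff.1 this
  refine ⟨δ / 2, E 0 / 2, by positivity, by linarith [h.pos], fun x hx => (hb ?_).le⟩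
  rw [Real.dist_eq, sub_zero]
  linarith

lemma integral_stepLaw (h : IsStepDensity E σ) {F : Type*} [NormedAddCommGroup F]
    [NormedSpace ℝ F] (g : ℝ → F) :
    ∫ x, g x ∂stepLaw E = ∫ x, E x • g x := by
  rw [stepLaw, integral_withDensity_eq_integral_toReal_smul
    (h.cont.measurable.ennreal_ofReal) (Eventually.of_forall fun _ => ENNReal.ofReal_lt_top)]
  simp [ENNReal.toReal_ofReal (h.nonneg _)]

lemma integrable_stepLaw_iff (h : IsStepDensity E σ) {F : Type*} [NormedAddCommGroup F]
    [NormedSpace ℝ F] (g : ℝ → F) :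
    Integrable g (stepLaw E) ↔ Integrable fun x => E x • g x := by
  rw [stepLaw, integrable_withDensity_iff_integrable_smul'
    (h.cont.measurable.ennreal_ofReal) (Eventually.of_forall fun _ => ENNReal.ofReal_lt_top)]
  simp [ENNReal.toReal_ofReal (h.nonneg _)]

lemma memLp_id (h : IsStepDensity E σ) : MemLp id 2 (stepLaw E) := by
  rw [memLp_two_iff_integrable_sq (by fun_prop), h.integrable_stepLaw_iff]
  simpa [mul_comm] using h.mom2

lemma integral_id_stepLaw (h : IsStepDensity E σ) : ∫ x, x ∂stepLaw E = 0 := by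
  rw [h.integral_stepLaw]
  simpa [mul_comm] using h.mean

lemma integral_sq_stepLaw (h : IsStepDensity E σ) : ∫ x, x ^ 2 ∂stepLaw E = σ ^ 2 := by
  rw [h.integral_stepLaw]
  simpa [mul_comm] using h.var

end IsStepDensity

lemma abs_sin_le_mul_one_sub (u : ℝ) : |Real.sin u| ≤ |u| * (1 - min 1 (u ^ 2) / 40) := by
  have small : ∀ u : ℝ, |u| ≤ 1 → |Real.sin u| ≤ |u| * (1 - u ^ 2 / 10) := by
    intro u hu
    have hb := Real.sin_bound hu
    have h1 : |Real.sin u| ≤ |u - u ^ 3 / 6| + |u| ^ 5 / 100 := by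
      calc |Real.sin u| = |(u - u ^ 3 / 6) + (Real.sin u - (u - u ^ 3 / 6))| := by ring_nf
        _ ≤ _ := (abs_add_le _ _).trans (by gcongr)
    have hsq : u ^ 2 = |u| ^ 2 := (sq_abs u).symm
    have h2 : |u - u ^ 3 / 6| = |u| * (1 - |u| ^ 2 / 6) := by
      rw [show u - u ^ 3 / 6 = u * (1 - u ^ 2 / 6) by ring, abs_mul, hsq, abs_of_nonneg
        (a := 1 - |u| ^ 2 / 6) (by nlinarith [abs_nonneg u])]
    rw [h2] at h1
    rw [hsq]
    have h3 : |u| ^ 5 ≤ |u| ^ 3 := pow_le_pow_of_le_one (abs_nonneg u) hu (by norm_num)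
    nlinarith [pow_nonneg (abs_nonneg u) 3]
  rcases le_total |u| 1 with hu | hu
  · have hu2 : u ^ 2 ≤ 1 := by
      rw [← sq_abs]
      nlinarith [abs_nonneg u]
    rw [min_eq_right hu2]
    refine (small u hu).trans ?_
    gcongr
    linarith [sq_nonneg u]
  · have hu2 : 1 ≤ u ^ 2 := by
      rw [← sq_abs]
      nlinarith [abs_nonneg u]
    rw [min_eq_left hu2]
    rcases le_total |u| 2 with hu' | hu'
    · have hhalf : |u / 2| = |u| / 2 := by rw [abs_div]; norm_num
      have hs := small (u / 2) (by rw [hhalf]; linarith)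
      have h2 : Real.sin u = 2 * Real.sin (u / 2) * Real.cos (u / 2) := by
        rw [← Real.sin_two_mul]
        congr 1
        ring
      rw [h2, abs_mul, abs_mul, abs_two]
      have hc := Real.abs_cos_le_one (u / 2)
      calc 2 * |Real.sin (u / 2)| * |Real.cos (u / 2)| ≤ 2 * |Real.sin (u / 2)| * 1 := by gcongr
        _ ≤ 2 * (|u / 2| * (1 - (u / 2) ^ 2 / 10)) * 1 := by gcongr
        _ ≤ _ := by
          rw [hhalf]
          nlinarith [abs_nonneg u]
    · have := Real.abs_sin_le_one u
      nlinarith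

lemma norm_integral_exp_mul_I_le {r : ℝ} (hr : 0 < r) (t : ℝ) :
    ‖∫ x in (-r)..r, Complex.exp (t * x * Complex.I)‖
      ≤ 2 * r * (1 - min 1 ((r * t) ^ 2) / 40) := by
  rcases eq_or_ne t 0 with rfl | ht
  · simp only [Complex.ofReal_zero, zero_mul, Complex.exp_zero]
    rw [intervalIntegral.integral_const]
    simp only [sub_neg_eq_add, norm_smul, norm_one, Real.norm_eq_abs, mul_zero]
    rw [abs_of_pos (by linarith)]
    norm_num
    linarith
  · have hc : (t : ℂ) * Complex.I ≠ 0 := mul_ne_zero (by exact_mod_cast ht) Complex.I_ne_zero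
    have e : ∀ x : ℝ, Complex.exp (t * x * Complex.I) = Complex.exp (t * Complex.I * x) :=
      fun x => by ring_nf
    simp only [e]
    rw [integral_exp_mul_complex hc]
    have h2 : Complex.exp (t * Complex.I * r) - Complex.exp (t * Complex.I * ((-r : ℝ) : ℂ))
        = 2 * Complex.I * (Real.sin (r * t) : ℝ) := by
      have e1 : (t * Complex.I * r : ℂ) = ((r * t : ℝ) : ℂ) * Complex.I := by push_cast; ring
      have e2 : (t * Complex.I * ((-r : ℝ) : ℂ) : ℂ) = ((-(r * t) : ℝ) : ℂ) * Complex.I := by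
        push_cast
        ring
      rw [e1, e2, Complex.exp_mul_I, Complex.exp_mul_I]
      push_cast
      rw [Complex.cos_neg, Complex.sin_neg]
      ring
    rw [h2]
    simp only [norm_div, norm_mul, Complex.norm_I, mul_one, Complex.norm_real, Real.norm_eq_abs]
    rw [div_le_iff₀ (abs_pos.2 ht)]
    have := abs_sin_le_mul_one_sub (r * t)
    rw [abs_mul r t, abs_of_pos hr] at this
    norm_num
    linarith

namespace IsStepDensity

variable {E : ℝ → ℝ} {σ : ℝ}

lemma charFun_eq (h : IsStepDensity E σ) (t : ℝ) :
    charFun (stepLaw E) t = ∫ x : ℝ, (E x : ℂ) * Complex.exp (t * x * Complex.I) := by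
  rw [charFun_apply_real, h.integral_stepLaw]
  simp

/-- Quadratic decay of the characteristic function near the origin, and a uniform gap elsewhere. -/
lemma exists_norm_charFun_le (h : IsStepDensity E σ) :
    ∃ c, 0 < c ∧ ∀ t, ‖charFun (stepLaw E) t‖ ≤ Real.exp (-(c * min 1 (t ^ 2))) := by
  obtain ⟨r, e, hr, he, hb⟩ := h.exists_lower_bound
  refine ⟨r * e / 20 * min 1 (r ^ 2), by positivity, fun t => ?_⟩
  have hnorm : ∀ x : ℝ, ‖Complex.exp (t * x * Complex.I)‖ = 1 := fun x => by
    rw [← Complex.ofReal_mul, Complex.norm_exp_ofReal_mul_I]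
  set ind : ℝ → ℝ := (Ioc (-r) r).indicator fun _ => e with hind
  have hind_int : Integrable ind :=
    (integrable_indicator_iff measurableSet_Ioc).2 (integrableOn_const (by simp))
  have hind_le : ∀ x, ind x ≤ E x := fun x => by
    by_cases hx : x ∈ Ioc (-r) r
    · rw [hind, indicator_of_mem hx]
      exact hb x (abs_le.2 ⟨hx.1.le, hx.2⟩)
    · rw [hind, indicator_of_notMem hx]
      exact h.nonneg x
  have hcont : Continuous fun x : ℝ => Complex.exp (t * x * Complex.I) := by fun_prop
  have hmul : ∀ g : ℝ → ℝ, Integrable g →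
      Integrable fun x : ℝ => (g x : ℂ) * Complex.exp (t * x * Complex.I) := fun g hg => by
    refine (hg.ofReal (𝕜 := ℂ)).mul_bdd (c := 1) hcont.aestronglyMeasurable ?_
    exact Eventually.of_forall fun x => (hnorm x).le
  have hsplit : charFun (stepLaw E) t
      = (∫ x : ℝ, ((E x - ind x : ℝ) : ℂ) * Complex.exp (t * x * Complex.I))
        + ∫ x : ℝ, (ind x : ℂ) * Complex.exp (t * x * Complex.I) := by
    rw [h.charFun_eq, ← integral_add (hmul (fun x => E x - ind x) (h.int.sub hind_int))
      (hmul _ hind_int)]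
    congr 1
    ext x
    push_cast
    ring
  have h1 : ‖∫ x : ℝ, ((E x - ind x : ℝ) : ℂ) * Complex.exp (t * x * Complex.I)‖
      ≤ 1 - 2 * r * e := by
    refine (norm_integral_le_integral_norm _).trans (le_of_eq ?_)
    have : ∀ x : ℝ, ‖((E x - ind x : ℝ) : ℂ) * Complex.exp (t * x * Complex.I)‖
        = E x - ind x := fun x => by
      rw [norm_mul, hnorm, mul_one, Complex.norm_real, Real.norm_eq_abs,
        abs_of_nonneg (sub_nonneg.2 (hind_le x))]
    simp only [this]
    rw [integral_sub h.int hind_int, h.mass, hind, integral_indicator measurableSet_Ioc,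
      setIntegral_const, Measure.real, Real.volume_Ioc, ENNReal.toReal_ofReal (by linarith)]
    simp only [smul_eq_mul]
    ring
  have h2 : ‖∫ x : ℝ, (ind x : ℂ) * Complex.exp (t * x * Complex.I)‖
      ≤ e * (2 * r * (1 - min 1 ((r * t) ^ 2) / 40)) := by
    have : (fun x : ℝ => (ind x : ℂ) * Complex.exp (t * x * Complex.I))
        = (Ioc (-r) r).indicator fun x : ℝ => (e : ℂ) * Complex.exp (t * x * Complex.I) := by
      ext x
      by_cases hx : x ∈ Ioc (-r) r
      · rw [hind, indicator_of_mem hx, indicator_of_mem hx]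
      · rw [hind, indicator_of_notMem hx, indicator_of_notMem hx]
        simp
    rw [this, integral_indicator measurableSet_Ioc, integral_const_mul,
      ← intervalIntegral.integral_of_le (by linarith), norm_mul, Complex.norm_real,
      Real.norm_eq_abs, abs_of_pos he]
    exact mul_le_mul_of_nonneg_left (norm_integral_exp_mul_I_le hr t) he.le
  have h3 : min 1 (r ^ 2) * min 1 (t ^ 2) ≤ min 1 ((r * t) ^ 2) := by
    refine le_min ?_ ?_
    · exact mul_le_one₀ (min_le_left _ _) (by positivity) (min_le_left _ _)
    · rw [mul_pow]
      exact mul_le_mul (min_le_right _ _) (min_le_right _ _) (by positivity) (by positivity)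
  calc ‖charFun (stepLaw E) t‖ ≤ (1 - 2 * r * e) + e * (2 * r * (1 - min 1 ((r * t) ^ 2) / 40)) :=
        hsplit ▸ (norm_add_le _ _).trans (add_le_add h1 h2)
    _ = -(r * e / 20 * min 1 ((r * t) ^ 2)) + 1 := by ring
    _ ≤ -(r * e / 20 * min 1 (r ^ 2) * min 1 (t ^ 2)) + 1 := by
        rw [mul_assoc]
        gcongr
    _ ≤ _ := Real.add_one_le_exp _

lemma charFun_isLittleO (h : IsStepDensity E σ) :
    (fun t : ℝ => charFun (stepLaw E) t - Complex.exp (-(σ ^ 2 * t ^ 2 / 2)))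
      =o[𝓝 0] fun t : ℝ => t ^ 2 := by
  have := h.isProbabilityMeasure
  have h1 : (fun t : ℝ => charFun (stepLaw E) t - (1 - σ ^ 2 * t ^ 2 / 2))
      =o[𝓝 0] fun t : ℝ => t ^ 2 := by
    have hT : ∀ t : ℝ, taylorWithinEval (charFun (stepLaw E)) 2 univ 0 t
        = 1 - (σ ^ 2 : ℂ) * t ^ 2 / 2 := fun t => by
      have hm : (stepLaw E).map id = stepLaw E := Measure.map_id
      have := taylorWithinEval_charFun_two_zero (P := stepLaw E) (X := id) aemeasurable_id
        (by rw [hm]; exact h.memLp_id) t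
      rw [hm] at this
      rw [this]
      have e1 : ∫ x, id x ∂stepLaw E = 0 := h.integral_id_stepLaw
      have e2 : ∫ x, (id ^ 2 : ℝ → ℝ) x ∂stepLaw E = σ ^ 2 := h.integral_sq_stepLaw
      rw [e1, e2]
      simp
    simp_rw [← hT]
    convert! taylor_isLittleO_univ (contDiff_charFun h.memLp_id) using 1
    simp
  have h2 : (fun t : ℝ => Complex.exp (-(σ ^ 2 * t ^ 2 / 2)) - (1 - σ ^ 2 * t ^ 2 / 2))
      =o[𝓝 0] fun t : ℝ => t ^ 2 := by
    have hd : (fun x : ℂ => Complex.exp x - Complex.exp 0 - (x - 0) • Complex.exp 0)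
        =o[𝓝 0] fun x => x - 0 := (Complex.hasDerivAt_exp 0).isLittleO
    have ht : Tendsto (fun t : ℝ => (-(σ ^ 2 * t ^ 2 / 2) : ℂ)) (𝓝 0) (𝓝 0) := by
      have : Continuous fun t : ℝ => (-(σ ^ 2 * t ^ 2 / 2) : ℂ) := by fun_prop
      simpa using this.tendsto 0
    have := hd.comp_tendsto ht
    refine (this.congr_left (f₂ := fun t : ℝ =>
      Complex.exp (-(σ ^ 2 * t ^ 2 / 2)) - (1 - σ ^ 2 * t ^ 2 / 2)) fun t => ?_).trans_isBigO ?_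
    · simp
      ring
    · refine Asymptotics.isBigO_of_le' (c := σ ^ 2 / 2) _ fun t => le_of_eq ?_
      simp
      ring
  refine (h1.sub h2).congr_left fun t => ?_
  ring

end IsStepDensity

lemma integral_charFun_comm (μ ν : Measure ℝ) [IsProbabilityMeasure μ] [IsProbabilityMeasure ν] :
    ∫ t, charFun μ t ∂ν = ∫ x, charFun ν x ∂μ := by
  simp only [charFun_apply_real]
  rw [integral_integral_swap]
  · refine integral_congr_ae (Eventually.of_forall fun x => integral_congr_ae
      (Eventually.of_forall fun t => ?_))
    ring_nf
  · refine Integrable.mono' (g := fun _ => 1) (integrable_const _)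
      (Continuous.aestronglyMeasurable (by fun_prop)) (Eventually.of_forall fun p => ?_)
    simp only [Function.uncurry]
    rw [← Complex.ofReal_mul, Complex.norm_exp_ofReal_mul_I]

namespace IsStepDensity

variable {E : ℝ → ℝ} {σ : ℝ}

lemma integral_normSq_charFun_gaussianReal_le (h : IsStepDensity E σ) {M : ℝ}
    (hM : ∀ x, E x ≤ M) {v : ℝ≥0} (hv : v ≠ 0) :
    ∫ t, ‖charFun (stepLaw E) t‖ ^ 2 ∂ProbabilityTheory.gaussianReal 0 v
      ≤ M * √(2 * Real.pi / v) := by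
  have := h.isProbabilityMeasure
  have hvp : 0 < (v : ℝ) := by positivity
  set ν := ProbabilityTheory.gaussianReal 0 v
  set μ := stepLaw E
  have hν : ∀ x : ℝ, charFun ν x = ((Real.exp (-(v / 2 * x ^ 2)) : ℝ) : ℂ) := fun x => by
    rw [ProbabilityTheory.charFun_gaussianReal]
    push_cast
    congr 1
    ring
  set ρ := (μ.prod μ).map fun p => p.1 - p.2
  have : IsProbabilityMeasure ρ := Measure.isProbabilityMeasure_map (by fun_prop)
  have hρ : ∀ t, charFun ρ t = ((‖charFun μ t‖ ^ 2 : ℝ) : ℂ) := fun t => by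
    rw [charFun_apply_real, integral_map (by fun_prop) (by fun_prop)]
    have e : ∀ p : ℝ × ℝ, Complex.exp (t * (p.1 - p.2 : ℝ) * Complex.I)
        = Complex.exp (t * p.1 * Complex.I) * Complex.exp ((-t : ℝ) * p.2 * Complex.I) := by
      intro p
      rw [← Complex.exp_add]
      push_cast
      ring_nf
    simp only [e]
    rw [integral_prod_mul (f := fun x : ℝ => Complex.exp (t * x * Complex.I))
      (g := fun x : ℝ => Complex.exp ((-t : ℝ) * x * Complex.I)), ← charFun_apply_real,
      ← charFun_apply_real, charFun_neg, Complex.mul_conj, Complex.normSq_eq_norm_sq]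
  have key : ((∫ t, ‖charFun μ t‖ ^ 2 ∂ν : ℝ) : ℂ)
      = ((∫ x, Real.exp (-(v / 2 * x ^ 2)) ∂ρ : ℝ) : ℂ) := by
    rw [← integral_complex_ofReal, ← integral_complex_ofReal]
    simp_rw [← hρ, ← hν]
    exact integral_charFun_comm ρ ν
  rw [Complex.ofReal_inj] at key
  have hle1 : ∀ x : ℝ, Real.exp (-(v / 2 * x ^ 2)) ≤ 1 := fun x =>
    Real.exp_le_one_iff.2 (by have := sq_nonneg x; nlinarith)
  rw [key, integral_map (by fun_prop) (by fun_prop), integral_prod]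
  · have inner : ∀ x : ℝ, ∫ y, Real.exp (-(v / 2 * (x - y) ^ 2)) ∂μ
        ≤ M * √(2 * Real.pi / v) := fun x => by
      have hg : Integrable fun y : ℝ => Real.exp (-(v / 2 * (x - y) ^ 2)) := by
        have := (integrable_exp_neg_mul_sq (b := v / 2) (by positivity)).comp_sub_left x
        simpa using this
      rw [h.integral_stepLaw]
      calc ∫ y, E y • Real.exp (-(v / 2 * (x - y) ^ 2))
          ≤ ∫ y, M * Real.exp (-(v / 2 * (x - y) ^ 2)) := by
            refine integral_mono_of_nonneg (Eventually.of_forall fun y =>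
              mul_nonneg (h.nonneg y) (Real.exp_pos _).le) (hg.const_mul M)
              (Eventually.of_forall fun y => ?_)
            exact mul_le_mul_of_nonneg_right (hM y) (Real.exp_pos _).le
        _ = M * √(2 * Real.pi / v) := by
            rw [integral_const_mul, integral_sub_left_eq_self
              (fun y => Real.exp (-(v / 2 * y ^ 2)))]
            have := integral_gaussian (v / 2)
            simp only [neg_mul] at this
            rw [this]
            congr 2
            field_simp
    calc _ ≤ ∫ x, M * √(2 * Real.pi / v) ∂μ := by
          refine integral_mono_of_nonneg (Eventually.of_forall fun x =>
            integral_nonneg fun y => (Real.exp_pos _).le) (integrable_const _)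
            (Eventually.of_forall inner)
      _ = _ := by simp
  · refine Integrable.mono' (g := fun _ => 1) (integrable_const _)
      (Continuous.aestronglyMeasurable (by fun_prop)) (Eventually.of_forall fun p => ?_)
    rw [Real.norm_eq_abs, abs_of_pos (Real.exp_pos _)]
    exact hle1 _

/-- The characteristic function of a law with bounded density is square integrable. -/
lemma integrable_normSq_charFun (h : IsStepDensity E σ) :
    Integrable fun t => ‖charFun (stepLaw E) t‖ ^ 2 := by
  have := h.isProbabilityMeasure
  obtain ⟨M, hM0, hM⟩ := h.exists_bound
  have hcont : Continuous fun t => ‖charFun (stepLaw E) t‖ ^ 2 := by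
    have : Continuous (charFun (stepLaw E)) := continuous_charFun
    fun_prop
  refine ⟨hcont.aestronglyMeasurable, ?_⟩
  set F : ℕ → ℝ → ℝ≥0∞ := fun n t =>
    ENNReal.ofReal (‖charFun (stepLaw E) t‖ ^ 2 * Real.exp (-(t ^ 2 / (2 * (n + 1 : ℕ)))))
  have hF : ∀ n, ∫⁻ t, F n t ≤ ENNReal.ofReal (2 * Real.pi * M) := fun n => by
    have hv : ((n + 1 : ℕ) : ℝ≥0) ≠ 0 := by positivity
    have hvp : (0 : ℝ) < (n + 1 : ℕ) := by positivity
    have key := h.integral_normSq_charFun_gaussianReal_le hM hv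
    rw [ProbabilityTheory.integral_gaussianReal_eq_integral_smul hv] at key
    have hi : Integrable fun t => ‖charFun (stepLaw E) t‖ ^ 2 *
        Real.exp (-(t ^ 2 / (2 * (n + 1 : ℕ)))) := by
      refine Integrable.mono' (g := fun t => Real.exp (-(1 / (2 * (n + 1 : ℕ))) * t ^ 2))
        (integrable_exp_neg_mul_sq (by positivity)) (by fun_prop)
        (Eventually.of_forall fun t => ?_)
      rw [norm_mul, Real.norm_of_nonneg (Real.exp_pos _).le, norm_pow, norm_norm]
      rw [show (-(1 / (2 * (n + 1 : ℕ))) * t ^ 2 : ℝ) = -(t ^ 2 / (2 * (n + 1 : ℕ))) by ring]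
      exact mul_le_of_le_one_left (Real.exp_pos _).le
        (pow_le_one₀ (norm_nonneg _) (norm_charFun_le_one _))
    rw [← ofReal_integral_eq_lintegral_ofReal hi (Eventually.of_forall fun t => by positivity)]
    refine ENNReal.ofReal_le_ofReal ?_
    have e : ∀ t : ℝ, ProbabilityTheory.gaussianPDFReal 0 ((n + 1 : ℕ) : ℝ≥0) t •
        ‖charFun (stepLaw E) t‖ ^ 2 = (√(2 * Real.pi * (n + 1 : ℕ)))⁻¹ *
          (‖charFun (stepLaw E) t‖ ^ 2 * Real.exp (-(t ^ 2 / (2 * (n + 1 : ℕ))))) := fun t => by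
      simp only [ProbabilityTheory.gaussianPDFReal, sub_zero, smul_eq_mul, NNReal.coe_natCast,
        neg_div]
      ring
    simp only [e] at key
    rw [integral_const_mul, inv_mul_le_iff₀ (by positivity)] at key
    refine key.trans (le_of_eq ?_)
    rw [mul_left_comm, ← Real.sqrt_mul (by positivity), NNReal.coe_natCast,
      show 2 * Real.pi * (n + 1 : ℕ) * (2 * Real.pi / (n + 1 : ℕ)) = (2 * Real.pi) ^ 2 by
        field_simp, Real.sqrt_sq (by positivity)]
    ring
  have hlim : ∀ t, Tendsto (fun n => F n t) atTop (𝓝 ‖‖charFun (stepLaw E) t‖ ^ 2‖ₑ) := fun t => by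
    rw [Real.enorm_eq_ofReal (by positivity)]
    refine ENNReal.tendsto_ofReal ?_
    have h1 : Tendsto (fun n : ℕ => (2 * (n + 1 : ℕ) : ℝ)) atTop atTop :=
      (tendsto_natCast_atTop_atTop.comp (tendsto_add_atTop_nat 1)).const_mul_atTop (by norm_num)
    have h2 := (Real.continuous_exp.tendsto _).comp ((h1.const_div_atTop (t ^ 2)).neg)
    simpa using h2.const_mul (‖charFun (stepLaw E) t‖ ^ 2)
  calc ∫⁻ t, ‖‖charFun (stepLaw E) t‖ ^ 2‖ₑ = ∫⁻ t, liminf (fun n => F n t) atTop :=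
        lintegral_congr fun t => (hlim t).liminf_eq.symm
    _ ≤ liminf (fun n => ∫⁻ t, F n t) atTop := lintegral_liminf_le fun n => by
        have : Continuous (charFun (stepLaw E)) := continuous_charFun
        exact (Measurable.ennreal_ofReal (by fun_prop))
    _ ≤ ENNReal.ofReal (2 * Real.pi * M) := liminf_le_of_le (by isBoundedDefault)
        fun b hb => by
          obtain ⟨n, hn⟩ := hb.exists
          exact hn.trans (hF n)
    _ < ∞ := ENNReal.ofReal_lt_top

end IsStepDensity

lemma min_one_sq_add_le {h n j : ℝ} (h0 : 0 < h) (hn : n ≤ 3 * h) (hn0 : 0 ≤ n) (hj : j ≤ h)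
    (hj0 : 0 ≤ j) (s t : ℝ) :
    1 / 26 * min 1 (s ^ 2 + n ^ 2 * t ^ 2)
      ≤ min 1 ((s + j * t) ^ 2) + min 1 ((s + (h + j) * t) ^ 2) := by
  set a := s + j * t with ha
  set b := s + (h + j) * t with hb
  have hX : s ^ 2 + n ^ 2 * t ^ 2 ≤ 26 * (a ^ 2 + b ^ 2) := by
    have e1 : h * t = b - a := by rw [ha, hb]; ring
    have e2 : n ^ 2 * t ^ 2 ≤ 9 * (b - a) ^ 2 := by
      rw [← e1, mul_pow, ← mul_assoc]
      gcongr
      nlinarith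
    have e3 : (j * t) ^ 2 ≤ (b - a) ^ 2 := by
      rw [← e1, mul_pow, mul_pow]
      gcongr
    have e4 : s = a - j * t := by rw [ha]; ring
    have e5 : s ^ 2 ≤ 2 * a ^ 2 + 2 * (j * t) ^ 2 := by
      rw [e4]
      nlinarith [sq_nonneg (a + j * t)]
    nlinarith [sq_nonneg (a + b), sq_nonneg a, sq_nonneg b]
  have hmin : min 1 (s ^ 2 + n ^ 2 * t ^ 2) ≤ 26 * min 1 (a ^ 2 + b ^ 2) := by
    rcases le_total 1 (a ^ 2 + b ^ 2) with h1 | h1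
    · rw [min_eq_left h1]
      exact (min_le_left _ _).trans (by norm_num)
    · rw [min_eq_right h1]
      exact (min_le_right _ _).trans hX
  have hadd : min 1 (a ^ 2 + b ^ 2) ≤ min 1 (a ^ 2) + min 1 (b ^ 2) := by
    have ha0 := sq_nonneg a
    have hb0 := sq_nonneg b
    rcases le_total 1 (a ^ 2) with h1 | h1 <;> rcases le_total 1 (b ^ 2) with h2 | h2 <;>
    rcases le_total 1 (a ^ 2 + b ^ 2) with h3 | h3 <;>
    simp only [min_eq_left, min_eq_right, h1, h2, h3] <;> linarith
  linarith

lemma sum_min_one_sq_ge {n : ℕ} (hn : 2 ≤ n) (s t : ℝ) :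
    n / 78 * min 1 (s ^ 2 + n ^ 2 * t ^ 2)
      ≤ ∑ j ∈ Finset.range n, min 1 ((s + (j + 1) * t) ^ 2) := by
  set k := n / 2
  have hk0 : (0 : ℝ) < k := by exact_mod_cast (by omega : 0 < n / 2)
  have hk3 : (n : ℝ) ≤ 3 * k := by exact_mod_cast (by omega : n ≤ 3 * (n / 2))
  have hle : k + k ≤ n := by omega
  calc n / 78 * min 1 (s ^ 2 + n ^ 2 * t ^ 2)
      ≤ k * (1 / 26 * min 1 (s ^ 2 + n ^ 2 * t ^ 2)) := by
        have : (0 : ℝ) ≤ min 1 (s ^ 2 + n ^ 2 * t ^ 2) := by positivity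
        nlinarith
    _ = ∑ j ∈ Finset.range k, 1 / 26 * min 1 (s ^ 2 + n ^ 2 * t ^ 2) := by simp
    _ ≤ ∑ j ∈ Finset.range k, (min 1 ((s + (j + 1) * t) ^ 2)
          + min 1 ((s + (((k + j : ℕ) : ℝ) + 1) * t) ^ 2)) := by
        refine Finset.sum_le_sum fun j hj => ?_
        have hj' : ((j : ℝ) + 1) ≤ k := by exact_mod_cast Finset.mem_range.1 hj
        have := min_one_sq_add_le (h := k) (n := n) (j := j + 1) hk0 hk3 (by positivity) hj'
          (by positivity) s t
        rwa [show (((k + j : ℕ) : ℝ) + 1) = k + (j + 1) by push_cast; ring]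
    _ = ∑ j ∈ Finset.range (k + k), min 1 ((s + (j + 1) * t) ^ 2) := by
        rw [Finset.sum_add_distrib, Finset.sum_range_add]
    _ ≤ _ := Finset.sum_le_sum_of_subset_of_nonneg
        (Finset.range_subset_range.2 hle) fun _ _ _ => by positivity

lemma norm_prod_sub_prod_le {c ε : ℝ} (hc : 0 ≤ c) (hε : 0 ≤ ε) {a b : ℕ → ℂ} {q : ℕ → ℝ}
    {n : ℕ} (hq0 : ∀ i < n, 0 ≤ q i) (hq1 : ∀ i < n, q i ≤ 1)
    (ha : ∀ i < n, ‖a i‖ ≤ Real.exp (-(c * q i))) (hb : ∀ i < n, ‖b i‖ ≤ Real.exp (-(c * q i)))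
    (hab : ∀ i < n, ‖a i - b i‖ ≤ ε * q i) :
    ‖∏ i ∈ Finset.range n, a i - ∏ i ∈ Finset.range n, b i‖
      ≤ ε * Real.exp c * (∑ i ∈ Finset.range n, q i)
        * Real.exp (-(c * ∑ i ∈ Finset.range n, q i)) := by
  induction n with
  | zero => simp
  | succ n ih =>
    have ih' := ih (fun i hi => hq0 i (by omega)) (fun i hi => hq1 i (by omega))
      (fun i hi => ha i (by omega)) (fun i hi => hb i (by omega)) (fun i hi => hab i (by omega))
    have hB : ‖∏ i ∈ Finset.range n, b i‖ ≤ Real.exp (-(c * ∑ i ∈ Finset.range n, q i)) := by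
      rw [norm_prod, Finset.mul_sum, ← Finset.sum_neg_distrib, Real.exp_sum]
      exact Finset.prod_le_prod (fun _ _ => norm_nonneg _)
        fun i hi => hb i (by have := Finset.mem_range.1 hi; omega)
    rw [Finset.prod_range_succ, Finset.prod_range_succ, Finset.sum_range_succ]
    set A := ∏ i ∈ Finset.range n, a i
    set B := ∏ i ∈ Finset.range n, b i
    set Q := ∑ i ∈ Finset.range n, q i
    have hQ : 0 ≤ Q := Finset.sum_nonneg fun i hi => hq0 i (by
      have := Finset.mem_range.1 hi
      omega)
    have hexp : Real.exp (-(c * (Q + q n))) = Real.exp (-(c * Q)) * Real.exp (-(c * q n)) := by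
      rw [← Real.exp_add]
      ring_nf
    have h1 : 1 ≤ Real.exp c * Real.exp (-(c * q n)) := by
      rw [← Real.exp_add]
      refine Real.one_le_exp ?_
      nlinarith [hq1 n (by omega)]
    calc ‖A * a n - B * b n‖ = ‖(A - B) * a n + B * (a n - b n)‖ := by ring_nf
      _ ≤ ‖A - B‖ * ‖a n‖ + ‖B‖ * ‖a n - b n‖ := by
        refine (norm_add_le _ _).trans ?_
        rw [norm_mul, norm_mul]
      _ ≤ (ε * Real.exp c * Q * Real.exp (-(c * Q))) * Real.exp (-(c * q n))
          + Real.exp (-(c * Q)) * (ε * q n) := by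
        gcongr
        · exact ha n (by omega)
        · exact hab n (by omega)
      _ ≤ (ε * Real.exp c * Q * Real.exp (-(c * Q))) * Real.exp (-(c * q n))
          + Real.exp (-(c * Q)) * (ε * q n) * (Real.exp c * Real.exp (-(c * q n))) := by
        refine add_le_add le_rfl (le_mul_of_one_le_right
          (mul_nonneg (Real.exp_pos _).le (mul_nonneg hε (hq0 n (by omega)))) h1)
      _ = _ := by
        rw [hexp]
        ring

/-- The characteristic function of `(X_1 + ⋯ + X_n, Z_n)`. -/
def jointChar (E : ℝ → ℝ) (n : ℕ) (p : ℝ × ℝ) : ℂ :=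
  ∏ j ∈ Finset.range n, charFun (stepLaw E) (p.1 + (j + 1) * p.2)

namespace IsStepDensity

variable {E : ℝ → ℝ} {σ : ℝ}

lemma continuous_jointChar (h : IsStepDensity E σ) (n : ℕ) : Continuous (jointChar E n) := by
  have := h.isProbabilityMeasure
  have : Continuous (charFun (stepLaw E)) := continuous_charFun
  unfold jointChar
  fun_prop

lemma exists_norm_jointChar_le (h : IsStepDensity E σ) :
    ∃ c, 0 < c ∧ ∀ n, 2 ≤ n → ∀ p : ℝ × ℝ,
      ‖jointChar E n p‖ ≤ Real.exp (-(c * n * min 1 (p.1 ^ 2 + n ^ 2 * p.2 ^ 2))) := by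
  obtain ⟨c, hc, hb⟩ := h.exists_norm_charFun_le
  refine ⟨c / 78, by positivity, fun n hn p => ?_⟩
  rw [jointChar, norm_prod]
  calc _ ≤ ∏ j ∈ Finset.range n, Real.exp (-(c * min 1 ((p.1 + (j + 1) * p.2) ^ 2))) :=
        Finset.prod_le_prod (fun _ _ => norm_nonneg _) fun _ _ => hb _
    _ = Real.exp (-(c * ∑ j ∈ Finset.range n, min 1 ((p.1 + (j + 1) * p.2) ^ 2))) := by
        rw [← Real.exp_sum, Finset.mul_sum, Finset.sum_neg_distrib]
    _ ≤ _ := by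
        refine Real.exp_le_exp.2 (neg_le_neg ?_)
        have := mul_le_mul_of_nonneg_left (sum_min_one_sq_ge hn p.1 p.2) hc.le
        calc _ = _ := by ring
          _ ≤ _ := this

end IsStepDensity

lemma measurePreserving_shear (a : ℝ) :
    MeasurePreserving (fun p : ℝ × ℝ => (p.1 + a * p.2, p.2)) volume volume := by
  have := MeasurePreserving.skew_product (μa := (volume : Measure ℝ)) (μb := (volume : Measure ℝ))
    (μc := (volume : Measure ℝ)) (μd := (volume : Measure ℝ)) (f := id)
    (MeasurePreserving.id _) (g := fun t s => s + a * t) (by fun_prop)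
    (Eventually.of_forall fun t => (measurePreserving_add_right volume (a * t)).map_eq)
  have h2 := (Measure.measurePreserving_swap (μ := (volume : Measure ℝ))
    (ν := (volume : Measure ℝ)))
  exact h2.comp (this.comp h2)

lemma integral_mul_shear {g : ℝ → ℝ} (hg : Integrable g) (a : ℝ) :
    Integrable (fun p : ℝ × ℝ => g (p.1 + a * p.2) * g (p.1 + (a + 1) * p.2)) ∧
      ∫ p : ℝ × ℝ, g (p.1 + a * p.2) * g (p.1 + (a + 1) * p.2) = (∫ t, g t) ^ 2 := by
  have h1 : MeasurePreserving (fun p : ℝ × ℝ => (p.1 + a * p.2, p.1 + (a + 1) * p.2))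
      volume volume := by
    have hs := Measure.measurePreserving_swap (μ := (volume : Measure ℝ))
      (ν := (volume : Measure ℝ))
    have := hs.comp ((measurePreserving_shear 1).comp (hs.comp (measurePreserving_shear a)))
    convert! this using 2 with p
    simp only [Function.comp_apply, Prod.swap_prod_mk]
    refine Prod.ext rfl ?_
    simp
    ring
  have h2 : Integrable fun p : ℝ × ℝ => g p.1 * g p.2 := hg.mul_prod hg
  have h3 : ∫ p : ℝ × ℝ, g p.1 * g p.2 = (∫ t, g t) ^ 2 := by
    rw [sq, ← integral_prod_mul]
    rfl
  refine ⟨h1.integrable_comp_of_integrable h2, ?_⟩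
  rw [← h3]
  conv_rhs => rw [← h1.map_eq]
  rw [integral_map h1.measurable.aemeasurable]
  rw [h1.map_eq]
  exact h2.aestronglyMeasurable

namespace IsStepDensity

variable {E : ℝ → ℝ} {σ : ℝ}

lemma jointChar_add (E : ℝ → ℝ) (m k : ℕ) (p : ℝ × ℝ) :
    jointChar E (m + k) p = jointChar E m p *
      ∏ j ∈ Finset.range k, charFun (stepLaw E) (p.1 + (m + j + 1) * p.2) := by
  simp only [jointChar, Finset.prod_range_add]
  push_cast
  rfl

lemma exists_integral_norm_prod_four_le (h : IsStepDensity E σ) :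
    ∃ K, 0 < K ∧ ∀ m : ℕ,
      Integrable (fun p : ℝ × ℝ =>
        ‖∏ j ∈ Finset.range 4, charFun (stepLaw E) (p.1 + (m + j + 1) * p.2)‖) ∧
      ∫ p : ℝ × ℝ, ‖∏ j ∈ Finset.range 4, charFun (stepLaw E) (p.1 + (m + j + 1) * p.2)‖ ≤ K := by
  have := h.isProbabilityMeasure
  have hφ : Continuous (charFun (stepLaw E)) := continuous_charFun
  have hg := h.integrable_normSq_charFun
  refine ⟨(∫ t, ‖charFun (stepLaw E) t‖ ^ 2) ^ 2 + 1, by positivity, fun m => ?_⟩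
  set φ := charFun (stepLaw E)
  obtain ⟨i1, e1⟩ := integral_mul_shear hg (m + 1)
  obtain ⟨i2, e2⟩ := integral_mul_shear hg (m + 3)
  have hle : ∀ p : ℝ × ℝ, ‖∏ j ∈ Finset.range 4, φ (p.1 + (m + j + 1) * p.2)‖
      ≤ (‖φ (p.1 + (m + 1) * p.2)‖ ^ 2 * ‖φ (p.1 + (m + 1 + 1) * p.2)‖ ^ 2
        + ‖φ (p.1 + (m + 3) * p.2)‖ ^ 2 * ‖φ (p.1 + (m + 3 + 1) * p.2)‖ ^ 2) / 2 := fun p => by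
    simp only [Finset.prod_range_succ, Finset.prod_range_zero, one_mul, norm_mul]
    have e1 : ((m : ℝ) + (0 : ℕ) + 1) = m + 1 := by push_cast; ring
    have e2 : ((m : ℝ) + (1 : ℕ) + 1) = m + 1 + 1 := by push_cast; ring
    have e3 : ((m : ℝ) + (2 : ℕ) + 1) = m + 3 := by push_cast; ring
    have e4 : ((m : ℝ) + (3 : ℕ) + 1) = m + 3 + 1 := by push_cast; ring
    rw [e1, e2, e3, e4]
    nlinarith [sq_nonneg (‖φ (p.1 + (m + 1) * p.2)‖ * ‖φ (p.1 + (m + 1 + 1) * p.2)‖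
      - ‖φ (p.1 + (m + 3) * p.2)‖ * ‖φ (p.1 + (m + 3 + 1) * p.2)‖)]
  have hi := (i1.add i2).div_const 2
  have hInt : Integrable (fun p : ℝ × ℝ =>
      ‖∏ j ∈ Finset.range 4, φ (p.1 + (m + j + 1) * p.2)‖) := by
    refine hi.mono' (Continuous.aestronglyMeasurable (by fun_prop))
      (Eventually.of_forall fun p => ?_)
    rw [norm_norm]
    exact hle p
  refine ⟨hInt, ?_⟩
  calc _ ≤ _ := integral_mono hInt hi hle
    _ = (∫ t, ‖φ t‖ ^ 2) ^ 2 := by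
      rw [integral_div]
      simp only [Pi.add_apply]
      rw [integral_add i1 i2, e1, e2]
      ring
    _ ≤ _ := by linarith

end IsStepDensity

/-- The integral over the plane of a Gaussian with diagonal quadratic form. -/
lemma integrable_gaussian_prod {a b : ℝ} (ha : 0 < a) (hb : 0 < b) :
    Integrable (fun p : ℝ × ℝ => Real.exp (-(a * p.1 ^ 2 + b * p.2 ^ 2))) ∧
      ∫ p : ℝ × ℝ, Real.exp (-(a * p.1 ^ 2 + b * p.2 ^ 2)) = Real.pi / √(a * b) := by
  have e : ∀ p : ℝ × ℝ, Real.exp (-(a * p.1 ^ 2 + b * p.2 ^ 2))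
      = Real.exp (-a * p.1 ^ 2) * Real.exp (-b * p.2 ^ 2) := fun p => by
    rw [← Real.exp_add]
    ring_nf
  simp only [e]
  refine ⟨(integrable_exp_neg_mul_sq ha).mul_prod (integrable_exp_neg_mul_sq hb), ?_⟩
  rw [Measure.volume_eq_prod, integral_prod_mul (f := fun x : ℝ => Real.exp (-a * x ^ 2))
    (g := fun x : ℝ => Real.exp (-b * x ^ 2)), integral_gaussian, integral_gaussian,
    ← Real.sqrt_mul (by positivity), div_mul_div_comm, Real.sqrt_div (by positivity),
    Real.sqrt_mul_self Real.pi_pos.le]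

lemma integrable_areaGaussian {c : ℝ} (hc : 0 < c) {n : ℕ} (hn : 0 < n) :
    Integrable (fun p : ℝ × ℝ => Real.exp (-(c * n * (p.1 ^ 2 + n ^ 2 * p.2 ^ 2)))) ∧
      ∫ p : ℝ × ℝ, Real.exp (-(c * n * (p.1 ^ 2 + n ^ 2 * p.2 ^ 2)))
        = Real.pi / (c * n ^ 2) := by
  have hn' : (0 : ℝ) < n := by exact_mod_cast hn
  have := integrable_gaussian_prod (a := c * n) (b := c * n ^ 3) (by positivity) (by positivity)
  rw [show c * n * (c * n ^ 3) = (c * (n : ℝ) ^ 2) ^ 2 by ring,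
    Real.sqrt_sq (by positivity)] at this
  convert! this using 5 <;> ring

lemma sum_sq_ge {n : ℕ} (hn : 2 ≤ n) (s t : ℝ) :
    n / 78 * (s ^ 2 + n ^ 2 * t ^ 2) ≤ ∑ j ∈ Finset.range n, (s + (j + 1) * t) ^ 2 := by
  set R := s ^ 2 + n ^ 2 * t ^ 2
  have hR : 0 ≤ R := by positivity
  set l := (1 + R)⁻¹ with hl
  have hl0 : 0 < l := by positivity
  have hlR : l ^ 2 * R ≤ 1 := by
    rw [hl, inv_pow, inv_mul_le_iff₀ (by positivity)]
    nlinarith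
  have key := sum_min_one_sq_ge hn (l * s) (l * t)
  rw [show (l * s) ^ 2 + n ^ 2 * (l * t) ^ 2 = l ^ 2 * R by ring, min_eq_right hlR] at key
  have h2 : ∑ j ∈ Finset.range n, min 1 ((l * s + (j + 1) * (l * t)) ^ 2)
      ≤ l ^ 2 * ∑ j ∈ Finset.range n, (s + (j + 1) * t) ^ 2 := by
    rw [Finset.mul_sum]
    refine Finset.sum_le_sum fun j _ => (min_le_right _ _).trans (le_of_eq (by ring))
  have h3 : l ^ 2 * (n / 78 * R) ≤ l ^ 2 * ∑ j ∈ Finset.range n, (s + (j + 1) * t) ^ 2 := by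
    linarith
  exact le_of_mul_le_mul_left h3 (by positivity)

lemma sq_add_mul_le {n j : ℕ} (hj : j < n) (s t : ℝ) :
    (s + (j + 1) * t) ^ 2 ≤ 2 * (s ^ 2 + n ^ 2 * t ^ 2) := by
  have h1 : ((j : ℝ) + 1) ≤ n := by exact_mod_cast hj
  have h2 : ((j + 1) * t) ^ 2 ≤ n ^ 2 * t ^ 2 := by
    rw [mul_pow]
    gcongr
  nlinarith [sq_nonneg (s - (j + 1) * t)]

lemma sum_sq_le (n : ℕ) (s t : ℝ) :
    ∑ j ∈ Finset.range n, (s + (j + 1) * t) ^ 2 ≤ 2 * n * (s ^ 2 + n ^ 2 * t ^ 2) := by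
  refine (Finset.sum_le_sum fun j hj => sq_add_mul_le (Finset.mem_range.1 hj) s t).trans
    (le_of_eq ?_)
  simp
  ring

/-- The Gaussian counterpart of `jointChar`. -/
def gaussChar (σ : ℝ) (n : ℕ) (p : ℝ × ℝ) : ℝ :=
  Real.exp (-(σ ^ 2 / 2 * ∑ j ∈ Finset.range n, (p.1 + (j + 1) * p.2) ^ 2))

lemma gaussChar_pos (σ : ℝ) (n : ℕ) (p : ℝ × ℝ) : 0 < gaussChar σ n p := Real.exp_pos _

lemma gaussChar_le (σ : ℝ) {n : ℕ} (hn : 2 ≤ n) (p : ℝ × ℝ) :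
    gaussChar σ n p ≤ Real.exp (-(σ ^ 2 / 156 * n * (p.1 ^ 2 + n ^ 2 * p.2 ^ 2))) := by
  refine Real.exp_le_exp.2 (neg_le_neg ?_)
  have := mul_le_mul_of_nonneg_left (sum_sq_ge hn p.1 p.2) (by positivity : 0 ≤ σ ^ 2 / 2)
  linarith

lemma le_gaussChar (σ : ℝ) (n : ℕ) (p : ℝ × ℝ) :
    Real.exp (-(σ ^ 2 * n * (p.1 ^ 2 + n ^ 2 * p.2 ^ 2))) ≤ gaussChar σ n p := by
  refine Real.exp_le_exp.2 (neg_le_neg ?_)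
  have := mul_le_mul_of_nonneg_left (sum_sq_le n p.1 p.2) (by positivity : 0 ≤ σ ^ 2 / 2)
  linarith

lemma continuous_gaussChar (σ : ℝ) (n : ℕ) : Continuous (gaussChar σ n) := by
  unfold gaussChar
  fun_prop

lemma integrable_gaussChar {σ : ℝ} (hσ : 0 < σ) {n : ℕ} (hn : 2 ≤ n) :
    Integrable (gaussChar σ n) := by
  refine (integrable_areaGaussian (c := σ ^ 2 / 156) (by positivity) (n := n) (by omega)).1.mono'
    (continuous_gaussChar σ n).aestronglyMeasurable (Eventually.of_forall fun p => ?_)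
  rw [Real.norm_of_nonneg (gaussChar_pos σ n p).le]
  exact gaussChar_le σ hn p

lemma le_integral_gaussChar {σ : ℝ} (hσ : 0 < σ) {n : ℕ} (hn : 2 ≤ n) :
    Real.pi / (σ ^ 2 * n ^ 2) ≤ ∫ p, gaussChar σ n p := by
  obtain ⟨h1, h2⟩ := integrable_areaGaussian (c := σ ^ 2) (by positivity) (n := n) (by omega)
  rw [← h2]
  exact integral_mono h1 (integrable_gaussChar hσ hn) (le_gaussChar σ n)

lemma mul_exp_neg_le {c x : ℝ} (hc : 0 < c) :
    x * Real.exp (-(c * x)) ≤ 2 / c * Real.exp (-(c / 2 * x)) := by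
  have h1 : c / 2 * x ≤ Real.exp (c / 2 * x) := by
    linarith [Real.add_one_le_exp (c / 2 * x)]
  have h2 : Real.exp (-(c * x)) = Real.exp (-(c / 2 * x)) * Real.exp (-(c / 2 * x)) := by
    rw [← Real.exp_add]
    ring_nf
  have h3 : Real.exp (c / 2 * x) * Real.exp (-(c / 2 * x)) = 1 := by
    rw [← Real.exp_add]
    simp
  have h4 : x * Real.exp (-(c / 2 * x)) ≤ 2 / c := by
    rw [le_div_iff₀ hc]
    have := mul_le_mul_of_nonneg_right h1 (Real.exp_pos (-(c / 2 * x))).le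
    rw [h3] at this
    linarith
  rw [h2, ← mul_assoc]
  exact mul_le_mul_of_nonneg_right h4 (Real.exp_pos _).le

namespace IsStepDensity

variable {E : ℝ → ℝ} {σ : ℝ}

lemma exists_jointChar_majorant (h : IsStepDensity E σ) :
    ∃ c, 0 < c ∧ ∀ m : ℕ, 2 ≤ m → ∀ p : ℝ × ℝ,
      ‖jointChar E (m + 4) p‖ ≤ Real.exp (-(c * m * (p.1 ^ 2 + m ^ 2 * p.2 ^ 2)))
        + Real.exp (-(c * m)) *
          ‖∏ j ∈ Finset.range 4, charFun (stepLaw E) (p.1 + (m + j + 1) * p.2)‖ := by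
  have := h.isProbabilityMeasure
  obtain ⟨c, hc, hb⟩ := h.exists_norm_jointChar_le
  refine ⟨c, hc, fun m hm p => ?_⟩
  rw [jointChar_add, norm_mul]
  have hb' := hb m hm p
  rcases le_total 1 (p.1 ^ 2 + m ^ 2 * p.2 ^ 2) with h1 | h1
  · rw [min_eq_left h1, mul_one] at hb'
    exact (mul_le_mul_of_nonneg_right hb' (norm_nonneg _)).trans
      (le_add_of_nonneg_left (Real.exp_pos _).le)
  · rw [min_eq_right h1] at hb'
    have h2 : ‖∏ j ∈ Finset.range 4, charFun (stepLaw E) (p.1 + (m + j + 1) * p.2)‖ ≤ 1 := by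
      rw [norm_prod]
      exact Finset.prod_le_one (fun _ _ => norm_nonneg _) fun _ _ => norm_charFun_le_one _
    calc _ ≤ Real.exp (-(c * m * (p.1 ^ 2 + m ^ 2 * p.2 ^ 2))) * 1 := by gcongr
      _ ≤ _ := by
        rw [mul_one]
        exact le_add_of_nonneg_right (by positivity)

lemma exists_integral_norm_jointChar_le (h : IsStepDensity E σ) :
    ∃ C, 0 < C ∧ ∀ m : ℕ, 2 ≤ m →
      Integrable (jointChar E (m + 4)) ∧ ∫ p, ‖jointChar E (m + 4) p‖ ≤ C / m ^ 2 := by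
  obtain ⟨c, hc, hmaj⟩ := h.exists_jointChar_majorant
  obtain ⟨K, hK, hχ⟩ := h.exists_integral_norm_prod_four_le
  refine ⟨Real.pi / c + 2 / c ^ 2 * K, by positivity, fun m hm => ?_⟩
  have hm0 : (0 : ℝ) < m := by exact_mod_cast (by omega : 0 < m)
  obtain ⟨g1, g2⟩ := integrable_areaGaussian hc (n := m) (by omega)
  have hi := g1.add ((hχ m).1.const_mul (Real.exp (-(c * m))))
  have hInt : Integrable (jointChar E (m + 4)) :=
    hi.mono' (h.continuous_jointChar _).aestronglyMeasurable (Eventually.of_forall (hmaj m hm))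
  refine ⟨hInt, ?_⟩
  calc _ ≤ _ := integral_mono hInt.norm hi (hmaj m hm)
    _ = Real.pi / (c * m ^ 2) + Real.exp (-(c * m)) * _ := by
      simp only [Pi.add_apply]
      rw [integral_add g1 ((hχ m).1.const_mul _), g2, integral_const_mul]
    _ ≤ Real.pi / (c * m ^ 2) + 2 / (c * m) ^ 2 * K := by
      gcongr
      · have := Real.quadratic_le_exp_of_nonneg (x := c * m) (by positivity)
        rw [Real.exp_neg, inv_le_comm₀ (Real.exp_pos _) (by positivity), inv_div]
        nlinarith [mul_pos hc hm0]
      · exact (hχ m).2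
    _ = _ := by
      field_simp

/-- Near the origin the joint characteristic function is close to its Gaussian counterpart. -/
lemma exists_norm_jointChar_sub_gaussChar_le (h : IsStepDensity E σ) :
    ∃ c, 0 < c ∧ ∀ ε, 0 < ε → ∃ δ, 0 < δ ∧ δ ≤ ε ∧ ∀ n : ℕ, 2 ≤ n → ∀ p : ℝ × ℝ,
      p.1 ^ 2 + n ^ 2 * p.2 ^ 2 ≤ δ ^ 2 →
        ‖jointChar E n p - gaussChar σ n p‖
          ≤ ε * Real.exp (-(c * n * (p.1 ^ 2 + n ^ 2 * p.2 ^ 2))) := by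
  obtain ⟨c, hc, hφ⟩ := h.exists_norm_charFun_le
  have hσ := h.sigma_pos
  set c₀ := min c (σ ^ 2 / 2) with hc₀
  have hc₀0 : 0 < c₀ := by positivity
  refine ⟨c₀ / 156, by positivity, fun ε hε => ?_⟩
  set ε₁ := ε / (Real.exp c₀ * (2 / c₀))
  have hε₁ : 0 < ε₁ := by positivity
  obtain ⟨δ, hδ, hb⟩ := Metric.eventually_nhds_iff.1 (h.charFun_isLittleO.def hε₁)
  refine ⟨min (min (δ / 2) (1 / 2)) ε, by positivity, min_le_right _ _, fun n hn p hp => ?_⟩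
  set η := min (min (δ / 2) (1 / 2)) ε
  have hη0 : 0 < η := by positivity
  have hηδ : η ≤ δ / 2 := (min_le_left _ _).trans (min_le_left _ _)
  have hη1 : η ≤ 1 / 2 := (min_le_left _ _).trans (min_le_right _ _)
  set q : ℕ → ℝ := fun j => (p.1 + (j + 1) * p.2) ^ 2
  have hq : ∀ j < n, q j ≤ 2 * η ^ 2 := fun j hj =>
    (sq_add_mul_le hj p.1 p.2).trans (by linarith)
  have hq1 : ∀ j < n, q j ≤ 1 := fun j hj => (hq j hj).trans (by nlinarith)
  have hG : (gaussChar σ n p : ℂ) = ∏ j ∈ Finset.range n,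
      Complex.exp (-(σ ^ 2 * (p.1 + (j + 1) * p.2 : ℝ) ^ 2 / 2)) := by
    rw [gaussChar, ← Complex.exp_sum, Complex.ofReal_exp, Finset.mul_sum,
      ← Finset.sum_neg_distrib]
    push_cast
    congr 1
    refine Finset.sum_congr rfl fun j _ => ?_
    ring
  rw [hG, jointChar]
  have key := norm_prod_sub_prod_le (c := c₀) (ε := ε₁) hc₀0.le hε₁.le (q := q) (n := n)
    (a := fun j => charFun (stepLaw E) (p.1 + (j + 1) * p.2))
    (b := fun j => Complex.exp (-(σ ^ 2 * (p.1 + (j + 1) * p.2 : ℝ) ^ 2 / 2)))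
    (fun _ _ => sq_nonneg _) hq1 ?_ ?_ ?_
  · refine key.trans ?_
    set Q := ∑ i ∈ Finset.range n, q i
    have hQ : n / 78 * (p.1 ^ 2 + n ^ 2 * p.2 ^ 2) ≤ Q := sum_sq_ge hn p.1 p.2
    calc _ = ε₁ * Real.exp c₀ * (Q * Real.exp (-(c₀ * Q))) := by ring
      _ ≤ ε₁ * Real.exp c₀ * (2 / c₀ * Real.exp (-(c₀ / 2 * Q))) := by
        exact mul_le_mul_of_nonneg_left (mul_exp_neg_le hc₀0) (by positivity)
      _ = ε * Real.exp (-(c₀ / 2 * Q)) := by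
        simp only [ε₁]
        field_simp
      _ ≤ _ := by
        refine mul_le_mul_of_nonneg_left (Real.exp_le_exp.2 (neg_le_neg ?_)) hε.le
        have := mul_le_mul_of_nonneg_left hQ (by positivity : 0 ≤ c₀ / 2)
        linarith
  · intro j hj
    refine (hφ _).trans (Real.exp_le_exp.2 (neg_le_neg ?_))
    rw [min_eq_right (hq1 j hj)]
    exact mul_le_mul_of_nonneg_right (min_le_left _ _) (sq_nonneg _)
  · intro j hj
    simp only [← Complex.ofReal_pow, ← Complex.ofReal_mul]
    rw [← Complex.ofReal_ofNat, ← Complex.ofReal_div, ← Complex.ofReal_neg,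
      Complex.norm_exp_ofReal]
    refine Real.exp_le_exp.2 (neg_le_neg ?_)
    have := mul_le_mul_of_nonneg_right (min_le_right c (σ ^ 2 / 2)) (sq_nonneg
      (p.1 + (j + 1) * p.2))
    calc c₀ * q j ≤ _ := this
      _ = _ := by ring
  · intro j hj
    have := hb (y := p.1 + (j + 1) * p.2) ?_
    · simpa [q] using this
    · rw [dist_zero_right, Real.norm_eq_abs]
      refine abs_lt_of_sq_lt_sq ?_ hδ.le
      have := hq j hj
      simp only [q] at this
      nlinarith

lemma exists_norm_phase_mul_jointChar_sub_le (h : IsStepDensity E σ) :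
    ∃ c, 0 < c ∧ ∀ ε R, 0 < ε → 0 < R → ∃ m₀ : ℕ, 2 ≤ m₀ ∧ ∀ m : ℕ, m₀ ≤ m →
      ∀ y z : ℝ, |y| ≤ R → |z| ≤ R → ∀ p : ℝ × ℝ,
        ‖Complex.exp (-((p.1 * y + p.2 * z : ℝ) * Complex.I)) * jointChar E (m + 4) p
            - gaussChar σ (m + 4) p‖
          ≤ ε * Real.exp (-(c * m * (p.1 ^ 2 + m ^ 2 * p.2 ^ 2)))
            + Real.exp (-(c * m)) *
              ‖∏ j ∈ Finset.range 4, charFun (stepLaw E) (p.1 + (m + j + 1) * p.2)‖ := by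
  obtain ⟨c₁, hc₁, hin⟩ := h.exists_norm_jointChar_sub_gaussChar_le
  obtain ⟨c₂, hc₂, hmaj⟩ := h.exists_jointChar_majorant
  have hσ := h.sigma_pos
  set c := min c₁ (min (c₂ / 2) (σ ^ 2 / 312)) with hc_def
  have hc : 0 < c := by positivity
  have hcc₁ : c ≤ c₁ := min_le_left _ _
  have hcc₂ : c ≤ c₂ / 2 := (min_le_right _ _).trans (min_le_left _ _)
  have hcσ : c ≤ σ ^ 2 / 312 := (min_le_right _ _).trans (min_le_right _ _)
  refine ⟨c, hc, fun ε R hε hR => ?_⟩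
  obtain ⟨δ, hδ, hδε, hin⟩ := hin (ε / (4 * R + 4)) (by positivity)
  have hlim : Tendsto (fun m : ℕ => Real.exp (-(c * m * (δ ^ 2 / 9)))) atTop (𝓝 0) := by
    refine Real.tendsto_exp_atBot.comp (tendsto_neg_atTop_atBot.comp ?_)
    exact (tendsto_natCast_atTop_atTop.const_mul_atTop hc).atTop_mul_const (by positivity)
  obtain ⟨m₁, hm₁⟩ := eventually_atTop.1 (hlim.eventually (gt_mem_nhds (half_pos hε)))
  refine ⟨max m₁ 2, le_max_right _ _, fun m hm y z hy hz p => ?_⟩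
  have hm2 : 2 ≤ m := (le_max_right _ _).trans hm
  have hm0 : (2 : ℝ) ≤ m := by exact_mod_cast hm2
  have hn : ((m + 4 : ℕ) : ℝ) = m + 4 := by push_cast; ring
  set θ : ℝ := p.1 * y + p.2 * z
  set u : ℂ := Complex.exp (-((θ : ℝ) * Complex.I))
  have hu : ‖u‖ = 1 := by
    rw [show u = Complex.exp ((-θ : ℝ) * Complex.I) by simp [u], Complex.norm_exp_ofReal_mul_I]
  set r := p.1 ^ 2 + m ^ 2 * p.2 ^ 2 with hr
  set r' := p.1 ^ 2 + ((m + 4 : ℕ) : ℝ) ^ 2 * p.2 ^ 2 with hr'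
  have hr0 : 0 ≤ r := by positivity
  have hrr' : r ≤ r' := by
    rw [hr, hr', hn]
    gcongr
    linarith
  have hr'r : r' ≤ 9 * r := by
    rw [hr, hr', hn]
    have : ((m : ℝ) + 4) ^ 2 ≤ 9 * m ^ 2 := by nlinarith
    nlinarith [sq_nonneg p.1, sq_nonneg p.2, mul_le_mul_of_nonneg_right this (sq_nonneg p.2)]
  have hmono : ∀ a : ℝ, c ≤ a → Real.exp (-(a * (m + 4 : ℕ) * r')) ≤ Real.exp (-(c * m * r)) := by
    intro a ha
    have ha0 : 0 < a := hc.trans_le ha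
    refine Real.exp_le_exp.2 (neg_le_neg ?_)
    have : (m : ℝ) ≤ (m + 4 : ℕ) := by rw [hn]; linarith
    gcongr
  set χ := ‖∏ j ∈ Finset.range 4, charFun (stepLaw E) (p.1 + (m + j + 1) * p.2)‖
  have hχ : 0 ≤ Real.exp (-(c * m)) * χ := by positivity
  rcases le_total r' (δ ^ 2) with hcase | hcase
  · have h1 := hin (m + 4) (by omega) p hcase
    have hG := gaussChar_le σ (n := m + 4) (by omega) p
    have hθ : ‖u - 1‖ ≤ 2 * R * (ε / (4 * R + 4)) := by
      have e1 : ‖u - 1‖ ≤ |θ| := by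
        have := Real.norm_exp_I_mul_ofReal_sub_one_le (x := -θ)
        rw [norm_neg, Real.norm_eq_abs] at this
        convert! this using 3
        simp only [u]
        push_cast
        ring_nf
      have hp1 : |p.1| ≤ δ := abs_le_of_sq_le_sq (by
        have : 0 ≤ ((m + 4 : ℕ) : ℝ) ^ 2 * p.2 ^ 2 := by positivity
        linarith) hδ.le
      have hp2 : |p.2| ≤ δ := abs_le_of_sq_le_sq (by
        have : 1 * p.2 ^ 2 ≤ ((m + 4 : ℕ) : ℝ) ^ 2 * p.2 ^ 2 := by
          gcongr
          rw [hn]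
          nlinarith
        linarith [sq_nonneg p.1]) hδ.le
      calc ‖u - 1‖ ≤ |p.1 * y| + |p.2 * z| := e1.trans (abs_add_le _ _)
        _ ≤ δ * R + δ * R := by
          rw [abs_mul, abs_mul]
          gcongr
        _ = 2 * R * δ := by ring
        _ ≤ _ := by gcongr
    calc ‖u * jointChar E (m + 4) p - gaussChar σ (m + 4) p‖
        = ‖u * (jointChar E (m + 4) p - gaussChar σ (m + 4) p)
            + (u - 1) * gaussChar σ (m + 4) p‖ := by ring_nf
      _ ≤ 1 * ‖jointChar E (m + 4) p - gaussChar σ (m + 4) p‖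
            + ‖u - 1‖ * gaussChar σ (m + 4) p := by
          refine (norm_add_le _ _).trans (le_of_eq ?_)
          rw [norm_mul, norm_mul, hu, Complex.norm_real,
            Real.norm_of_nonneg (gaussChar_pos σ (m + 4) p).le]
      _ ≤ 1 * (ε / (4 * R + 4) * Real.exp (-(c * m * r)))
            + 2 * R * (ε / (4 * R + 4)) * Real.exp (-(c * m * r)) := by
          refine add_le_add (mul_le_mul_of_nonneg_left (h1.trans (mul_le_mul_of_nonneg_left
            (hmono c₁ hcc₁) (by positivity))) zero_le_one) (mul_le_mul hθ (hG.trans (hmono _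
            (by linarith [sq_nonneg σ]))) (gaussChar_pos _ _ _).le (by positivity))
      _ = ((1 + 2 * R) / (4 * R + 4)) * (ε * Real.exp (-(c * m * r))) := by ring
      _ ≤ 1 * (ε * Real.exp (-(c * m * r))) := by
          gcongr
          rw [div_le_one (by positivity)]
          linarith
      _ ≤ _ := by linarith
  · have hsmall : ∀ a b : ℝ, 2 * c ≤ a → (m : ℝ) * r ≤ b →
        Real.exp (-(a * b)) ≤ ε / 2 * Real.exp (-(c * m * r)) := by
      intro a b ha hb
      have hmr : (m : ℝ) * (δ ^ 2 / 9) ≤ m * r := by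
        gcongr
        linarith
      have hb0 : 0 ≤ b := le_trans (by positivity) hb
      calc Real.exp (-(a * b)) ≤ Real.exp (-(c * m * (δ ^ 2 / 9)) + -(c * m * r)) := by
            refine Real.exp_le_exp.2 ?_
            nlinarith [mul_le_mul ha hb (by positivity) (by linarith)]
        _ ≤ _ := by
            rw [Real.exp_add]
            gcongr
            exact (hm₁ m ((le_max_left _ _).trans hm)).le
    have hG := gaussChar_le σ (n := m + 4) (by omega) p
    have hm' := hmaj m hm2 p
    calc ‖u * jointChar E (m + 4) p - gaussChar σ (m + 4) p‖
        ≤ ‖jointChar E (m + 4) p‖ + gaussChar σ (m + 4) p := by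
          refine (norm_sub_le _ _).trans (le_of_eq ?_)
          rw [norm_mul, hu, Complex.norm_real,
            Real.norm_of_nonneg (gaussChar_pos σ (m + 4) p).le, one_mul]
      _ ≤ (ε / 2 * Real.exp (-(c * m * r)) + Real.exp (-(c * m)) * χ)
            + ε / 2 * Real.exp (-(c * m * r)) := by
          refine add_le_add (hm'.trans (add_le_add ?_ ?_)) (hG.trans ?_)
          · rw [mul_assoc]
            exact hsmall _ _ (by linarith) le_rfl
          · gcongr
            linarith
          · rw [mul_assoc]
            refine hsmall _ _ (by linarith) ?_
            have : (m : ℝ) ≤ (m + 4 : ℕ) := by rw [hn]; linarith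
            gcongr
      _ = _ := by ring

/-- Local lower bound for the Fourier inversion integral of the joint characteristic function. -/
lemma exists_le_re_integral_jointChar (h : IsStepDensity E σ) :
    ∃ c, 0 < c ∧ ∀ R, 0 < R → ∃ m₀ : ℕ, ∀ m : ℕ, m₀ ≤ m → ∀ y z : ℝ, |y| ≤ R → |z| ≤ R →
      c / m ^ 2 ≤ (∫ p : ℝ × ℝ,
        Complex.exp (-((p.1 * y + p.2 * z : ℝ) * Complex.I)) * jointChar E (m + 4) p).re := by
  obtain ⟨c, hc, hdiff⟩ := h.exists_norm_phase_mul_jointChar_sub_le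
  obtain ⟨K, hK, hχ⟩ := h.exists_integral_norm_prod_four_le
  obtain ⟨C, hC, hInt⟩ := h.exists_integral_norm_jointChar_le
  have hσ := h.sigma_pos
  set a := Real.pi / (9 * σ ^ 2)
  have ha : 0 < a := by positivity
  refine ⟨a / 2, by positivity, fun R hR => ?_⟩
  obtain ⟨m₁, hm₁2, hm₁⟩ := hdiff (a / 4 / (Real.pi / c)) R (by positivity) hR
  have hlim : Tendsto (fun m : ℕ => (m : ℝ) ^ 2 * Real.exp (-(c * m))) atTop (𝓝 0) := by
    have h1 := (Real.tendsto_pow_mul_exp_neg_atTop_nhds_zero 2).comp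
      (tendsto_natCast_atTop_atTop.const_mul_atTop hc)
    have h2 := h1.const_mul (c ^ 2)⁻¹
    rw [mul_zero] at h2
    refine h2.congr fun m => ?_
    simp only [Function.comp_apply]
    field_simp
  obtain ⟨m₂, hm₂⟩ := eventually_atTop.1
    (hlim.eventually (gt_mem_nhds (show 0 < a / 4 / K by positivity)))
  refine ⟨max m₁ m₂, fun m hm y z hy hz => ?_⟩
  have hm2 : 2 ≤ m := hm₁2.trans ((le_max_left _ _).trans hm)
  have hm0 : (2 : ℝ) ≤ m := by exact_mod_cast hm2
  set F : ℝ × ℝ → ℂ := fun p =>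
    Complex.exp (-((p.1 * y + p.2 * z : ℝ) * Complex.I)) * jointChar E (m + 4) p
  have hF : Integrable F := by
    refine (hInt m hm2).1.bdd_mul (c := 1) (Continuous.aestronglyMeasurable (by fun_prop))
      (Eventually.of_forall fun p => ?_)
    rw [← neg_mul, ← Complex.ofReal_neg, Complex.norm_exp_ofReal_mul_I]
  have hG := integrable_gaussChar hσ (n := m + 4) (by omega)
  obtain ⟨g1, g2⟩ := integrable_areaGaussian hc (n := m) (by omega)
  have hbound : ‖∫ p, (F p - gaussChar σ (m + 4) p)‖ ≤ a / 2 / m ^ 2 := by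
    calc _ ≤ ∫ p : ℝ × ℝ, (a / 4 / (Real.pi / c) *
              Real.exp (-(c * m * (p.1 ^ 2 + m ^ 2 * p.2 ^ 2))) + Real.exp (-(c * m)) *
              ‖∏ j ∈ Finset.range 4, charFun (stepLaw E) (p.1 + (m + j + 1) * p.2)‖) :=
          norm_integral_le_of_norm_le ((g1.const_mul _).add ((hχ m).1.const_mul _))
            (Eventually.of_forall (hm₁ m ((le_max_left _ _).trans hm) y z hy hz))
      _ = a / 4 / (Real.pi / c) * (Real.pi / (c * m ^ 2)) + Real.exp (-(c * m)) * _ := by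
          rw [integral_add (g1.const_mul _) ((hχ m).1.const_mul _), integral_const_mul, g2,
            integral_const_mul]
      _ ≤ a / 4 / (Real.pi / c) * (Real.pi / (c * m ^ 2)) + (a / 4 / K / m ^ 2) * K := by
          gcongr
          · rw [le_div_iff₀ (by positivity), mul_comm]
            exact (hm₂ m ((le_max_right _ _).trans hm)).le
          · exact (hχ m).2
      _ = _ := by
          field_simp
          ring
  have hGlow : a / m ^ 2 ≤ ∫ p, gaussChar σ (m + 4) p := by
    refine le_trans ?_ (le_integral_gaussChar hσ (n := m + 4) (by omega))
    have : ((m + 4 : ℕ) : ℝ) ^ 2 ≤ 9 * m ^ 2 := by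
      push_cast
      nlinarith
    calc a / m ^ 2 = Real.pi / (σ ^ 2 * (9 * m ^ 2)) := by
          simp only [a]
          field_simp
      _ ≤ _ := by gcongr
  have hsub : ∫ p, (F p - gaussChar σ (m + 4) p)
      = (∫ p, F p) - ((∫ p, gaussChar σ (m + 4) p : ℝ) : ℂ) := by
    have hG' : Integrable fun p => (gaussChar σ (m + 4) p : ℂ) := hG.ofReal
    rw [integral_sub hF hG', integral_complex_ofReal]
  have hre := (Complex.abs_re_le_norm _).trans hbound
  rw [hsub, Complex.sub_re, Complex.ofReal_re] at hre
  have := (abs_le.1 hre).1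
  have e : a / 2 / (m : ℝ) ^ 2 = a / m ^ 2 - a / 2 / m ^ 2 := by ring
  linarith

end IsStepDensity

/-- The joint density of the walk and its area after `m + 2` steps, obtained by integrating out
the first `m` steps. -/
def jointDensity (E : ℝ → ℝ) [IsProbabilityMeasure (stepLaw E)] (m : ℕ) (p : ℝ × ℝ) : ℝ :=
  ∫ x, E (p.2 - p.1 - areaSum x m - partialSum x m) * E (2 * p.1 - p.2 + areaSum x m)
    ∂walkLaw (stepLaw E)

lemma measurePreserving_walk_two_steps (S A : ℝ) :
    MeasurePreserving (fun p : ℝ × ℝ => (S + p.1 + p.2, A + 2 * S + 2 * p.1 + p.2))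
      volume volume := by
  have hs := Measure.measurePreserving_swap (μ := (volume : Measure ℝ))
    (ν := (volume : Measure ℝ))
  have h1 : MeasurePreserving (fun p : ℝ × ℝ => (p.1, S + p.1 + p.2)) volume volume :=
    MeasurePreserving.skew_product (μa := (volume : Measure ℝ)) (μb := (volume : Measure ℝ))
      (μc := (volume : Measure ℝ)) (μd := (volume : Measure ℝ)) (f := id)
      (MeasurePreserving.id _) (g := fun t s => S + t + s) (by fun_prop)
      (Eventually.of_forall fun t => (measurePreserving_add_left volume (S + t)).map_eq)
  have h2 : MeasurePreserving (fun p : ℝ × ℝ => (p.1, A + 2 * p.1 - p.2)) volume volume :=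
    MeasurePreserving.skew_product (μa := (volume : Measure ℝ)) (μb := (volume : Measure ℝ))
      (μc := (volume : Measure ℝ)) (μd := (volume : Measure ℝ)) (f := id)
      (MeasurePreserving.id _) (g := fun t s => A + 2 * t - s) (by fun_prop)
      (Eventually.of_forall fun t => (Measure.measurePreserving_sub_left volume (A + 2 * t)).map_eq)
  have := h2.comp (hs.comp (h1.comp hs))
  convert! this using 2 with p
  simp only [Function.comp_apply, Prod.swap]
  refine Prod.ext ?_ ?_ <;> simp <;> ring

namespace IsStepDensity

variable {E : ℝ → ℝ} {σ : ℝ}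

lemma measurable_jointDensity_integrand (h : IsStepDensity E σ) (m : ℕ) :
    Measurable fun q : (ℝ × ℝ) × (ℕ → ℝ) =>
      E (q.1.2 - q.1.1 - areaSum q.2 m - partialSum q.2 m)
        * E (2 * q.1.1 - q.1.2 + areaSum q.2 m) := by
  have := h.cont.measurable
  fun_prop

lemma lintegral_stepLaw_prod (h : IsStepDensity E σ) {F : ℝ × ℝ → ℝ≥0∞} (hF : Measurable F) :
    ∫⁻ p, F p ∂(stepLaw E).prod (stepLaw E)
      = ∫⁻ p : ℝ × ℝ, ENNReal.ofReal (E p.1) * ENNReal.ofReal (E p.2) * F p := by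
  have hE' : Measurable E := h.cont.measurable
  have hE : Measurable fun x => ENNReal.ofReal (E x) := hE'.ennreal_ofReal
  rw [show stepLaw E = volume.withDensity fun x => ENNReal.ofReal (E x) from rfl,
    prod_withDensity hE hE, lintegral_withDensity_eq_lintegral_mul _ (by fun_prop) hF]
  rfl

variable [IsProbabilityMeasure (stepLaw E)]

lemma integrable_jointDensity_integrand (h : IsStepDensity E σ) (m : ℕ) (p : ℝ × ℝ) :
    Integrable (fun x => E (p.2 - p.1 - areaSum x m - partialSum x m)
      * E (2 * p.1 - p.2 + areaSum x m)) (walkLaw (stepLaw E)) := by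
  obtain ⟨M, hM0, hM⟩ := h.exists_bound
  refine Integrable.mono' (g := fun _ => M * M) (integrable_const _)
    ((h.measurable_jointDensity_integrand m).comp (measurable_prodMk_left (x := p)) :
      Measurable _).aestronglyMeasurable (Eventually.of_forall fun x => ?_)
  rw [norm_mul, Real.norm_of_nonneg (h.nonneg _), Real.norm_of_nonneg (h.nonneg _)]
  exact mul_le_mul (hM _) (hM _) (h.nonneg _) hM0.le

lemma jointDensity_nonneg (h : IsStepDensity E σ) (m : ℕ) (p : ℝ × ℝ) :
    0 ≤ jointDensity E m p :=
  integral_nonneg fun _ => mul_nonneg (h.nonneg _) (h.nonneg _)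

lemma continuous_jointDensity (h : IsStepDensity E σ) (m : ℕ) :
    Continuous (jointDensity E m) := by
  obtain ⟨M, hM0, hM⟩ := h.exists_bound
  have := h.cont
  refine continuous_of_dominated (bound := fun _ => M * M)
    (fun p => (h.integrable_jointDensity_integrand m p).aestronglyMeasurable)
    (fun p => Eventually.of_forall fun x => ?_) (integrable_const _)
    (Eventually.of_forall fun x => by fun_prop)
  rw [norm_mul, Real.norm_of_nonneg (h.nonneg _), Real.norm_of_nonneg (h.nonneg _)]
  exact mul_le_mul (hM _) (hM _) (h.nonneg _) hM0.le

lemma ofReal_jointDensity (h : IsStepDensity E σ) (m : ℕ) (p : ℝ × ℝ) :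
    ENNReal.ofReal (jointDensity E m p)
      = ∫⁻ x, ENNReal.ofReal (E (p.2 - p.1 - areaSum x m - partialSum x m))
          * ENNReal.ofReal (E (2 * p.1 - p.2 + areaSum x m)) ∂walkLaw (stepLaw E) := by
  rw [jointDensity, ofReal_integral_eq_lintegral_ofReal (h.integrable_jointDensity_integrand m p)
    (Eventually.of_forall fun _ => mul_nonneg (h.nonneg _) (h.nonneg _))]
  exact lintegral_congr fun x => ENNReal.ofReal_mul (h.nonneg _)

lemma lintegral_walk_area (h : IsStepDensity E σ) (m : ℕ) {F : ℝ × ℝ → ℝ≥0∞}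
    (hF : Measurable F) :
    ∫⁻ x, F (partialSum x (m + 2), areaSum x (m + 2)) ∂walkLaw (stepLaw E)
      = ∫⁻ p, ENNReal.ofReal (jointDensity E m p) * F p := by
  have hE : Measurable E := h.cont.measurable
  rw [lintegral_walkLaw_glue (stepLaw E) m
    (F := fun x => F (partialSum x (m + 2), areaSum x (m + 2))) (by fun_prop)]
  have step : ∀ a : ℕ → ℝ,
      ∫⁻ b, F (partialSum (glue m a b) (m + 2), areaSum (glue m a b) (m + 2))
        ∂walkLaw (stepLaw E)
      = ∫⁻ p : ℝ × ℝ, ENNReal.ofReal (E (p.2 - p.1 - areaSum a m - partialSum a m))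
          * ENNReal.ofReal (E (2 * p.1 - p.2 + areaSum a m)) * F p := fun a => by
    set S := partialSum a m
    set A := areaSum a m
    have e : ∀ b : ℕ → ℝ, F (partialSum (glue m a b) (m + 2), areaSum (glue m a b) (m + 2))
        = (fun q : ℝ × ℝ => F (S + q.1 + q.2, A + 2 * S + 2 * q.1 + q.2)) (b 0, b 1) := fun b => by
      rw [partialSum_glue_add, areaSum_glue_add]
      simp only [partialSum, areaSum, Finset.sum_range_succ, Finset.sum_range_zero, S, A]
      congr 2 <;> push_cast <;> ring
    simp only [e]
    rw [(measurePreserving_walkLaw_pair (stepLaw E) zero_ne_one).lintegral_comp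
      (f := fun q : ℝ × ℝ => F (S + q.1 + q.2, A + 2 * S + 2 * q.1 + q.2)) (by fun_prop),
      h.lintegral_stepLaw_prod (by fun_prop),
      ← (measurePreserving_walk_two_steps S A).lintegral_comp
        (f := fun p => ENNReal.ofReal (E (p.2 - p.1 - A - S))
          * ENNReal.ofReal (E (2 * p.1 - p.2 + A)) * F p) (by fun_prop)]
    refine lintegral_congr fun p => ?_
    rw [show A + 2 * S + 2 * p.1 + p.2 - (S + p.1 + p.2) - A - S = p.1 by ring,
      show 2 * (S + p.1 + p.2) - (A + 2 * S + 2 * p.1 + p.2) + A = p.2 by ring]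
  simp only [step]
  rw [lintegral_lintegral_swap (by fun_prop)]
  refine lintegral_congr fun p => ?_
  rw [lintegral_mul_const _ (by fun_prop), h.ofReal_jointDensity]

lemma map_walk_area (h : IsStepDensity E σ) (m : ℕ) :
    (walkLaw (stepLaw E)).map (fun x => (partialSum x (m + 2), areaSum x (m + 2)))
      = volume.withDensity fun p => ENNReal.ofReal (jointDensity E m p) := by
  refine Measure.ext fun s hs => ?_
  rw [← lintegral_indicator_one hs, ← lintegral_indicator_one hs,
    lintegral_map (measurable_one.indicator hs) (by fun_prop),
    lintegral_withDensity_eq_lintegral_mul _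
      (h.continuous_jointDensity m).measurable.ennreal_ofReal (measurable_one.indicator hs)]
  exact h.lintegral_walk_area m (measurable_one.indicator hs)

lemma integrable_jointDensity (h : IsStepDensity E σ) (m : ℕ) : Integrable (jointDensity E m) := by
  refine ⟨(h.continuous_jointDensity m).aestronglyMeasurable, ?_⟩
  have := h.lintegral_walk_area m (F := fun _ => 1) measurable_const
  simp only [lintegral_const, measure_univ, mul_one] at this
  rw [HasFiniteIntegral, lintegral_congr fun p => Real.enorm_eq_ofReal
    (h.jointDensity_nonneg m p), ← this]
  exact ENNReal.one_lt_top

lemma integral_jointDensity_smul (h : IsStepDensity E σ) (m : ℕ) {g : ℝ × ℝ → ℂ}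
    (hg : Continuous g) :
    ∫ p, jointDensity E m p • g p
      = ∫ x, g (partialSum x (m + 2), areaSum x (m + 2)) ∂walkLaw (stepLaw E) := by
  rw [← integral_map (φ := fun x => (partialSum x (m + 2), areaSum x (m + 2)))
    (Measurable.aemeasurable (by fun_prop)) hg.aestronglyMeasurable, h.map_walk_area,
    integral_withDensity_eq_integral_toReal_smul
      (h.continuous_jointDensity m).measurable.ennreal_ofReal
      (Eventually.of_forall fun _ => ENNReal.ofReal_lt_top)]
  simp [ENNReal.toReal_ofReal (h.jointDensity_nonneg m _)]

lemma integral_exp_walk_area (n : ℕ) (p : ℝ × ℝ) :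
    ∫ x, Complex.exp ((p.1 * partialSum x n + p.2 * areaSum x n : ℝ) * Complex.I)
      ∂walkLaw (stepLaw E) = jointChar E n p := by
  have e : ∀ x : ℕ → ℝ, Complex.exp ((p.1 * partialSum x n + p.2 * areaSum x n : ℝ) * Complex.I)
      = (fun y : Fin n → ℝ => ∏ i : Fin n,
        Complex.exp ((p.1 + (n - (i : ℕ)) * p.2 : ℝ) * y i * Complex.I))
        (fun i => x i) := fun x => by
    simp only
    rw [← Complex.exp_sum, areaSum_eq_sum, partialSum, Finset.mul_sum, Finset.mul_sum,
      ← Finset.sum_add_distrib, ← Fin.sum_univ_eq_sum_range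
        (fun i => p.1 * x i + p.2 * ((n - i) * x i))]
    push_cast
    rw [Finset.sum_mul]
    congr 1
    refine Finset.sum_congr rfl fun i _ => ?_
    ring
  simp only [e]
  have hmp := measurePreserving_walkLaw_fin (stepLaw E) n
  rw [← integral_map (φ := fun (x : ℕ → ℝ) (i : Fin n) => x i) hmp.measurable.aemeasurable
    (f := fun y : Fin n → ℝ => ∏ i : Fin n,
        Complex.exp ((p.1 + (n - (i : ℕ)) * p.2 : ℝ) * y i * Complex.I))
    (Continuous.aestronglyMeasurable (by fun_prop)), hmp.map_eq,
    integral_fintype_prod_eq_prod (f := fun (i : Fin n) (y : ℝ) =>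
      Complex.exp ((p.1 + (n - (i : ℕ)) * p.2 : ℝ) * y * Complex.I))]
  simp only [← charFun_apply_real]
  rw [Fin.prod_univ_eq_prod_range (fun i : ℕ => charFun (stepLaw E) (p.1 + (n - i) * p.2)),
    jointChar, ← Finset.prod_range_reflect]
  refine Finset.prod_congr rfl fun j hj => ?_
  have hj := Finset.mem_range.1 hj
  congr 3
  rw [show n - 1 - j = n - (j + 1) by omega, Nat.cast_sub (by omega)]
  push_cast
  ring

open scoped FourierTransform RealInnerProductSpace in
lemma fourier_jointDensity (h : IsStepDensity E σ) (m : ℕ) (ξ : ℂ) :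
    𝓕 (fun w : ℂ => (jointDensity E m (w.re, w.im) : ℂ)) ξ
      = jointChar E (m + 2) ((-(2 * Real.pi)) • (ξ.re, ξ.im)) := by
  rw [Real.fourier_eq', ← integral_exp_walk_area, ← h.integral_jointDensity_smul m
    (g := fun q : ℝ × ℝ => Complex.exp ((((-(2 * Real.pi)) • (ξ.re, ξ.im) : ℝ × ℝ).1 * q.1
      + ((-(2 * Real.pi)) • (ξ.re, ξ.im) : ℝ × ℝ).2 * q.2 : ℝ) * Complex.I)) (by fun_prop),
    ← Complex.volume_preserving_equiv_real_prod.integral_comp']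
  refine integral_congr_ae (Eventually.of_forall fun v => ?_)
  simp only [Complex.measurableEquivRealProd_apply, Complex.inner, smul_eq_mul, Complex.real_smul,
    Prod.smul_mk]
  rw [mul_comm]
  congr 3
  simp [Complex.mul_re]
  ring

open scoped FourierTransform RealInnerProductSpace in
lemma jointDensity_eq_integral (h : IsStepDensity E σ) (m : ℕ)
    (hInt : Integrable (jointChar E (m + 2))) (y z : ℝ) :
    (jointDensity E m (y, z) : ℂ) = ((2 * Real.pi) ^ 2)⁻¹ • ∫ p : ℝ × ℝ,
      Complex.exp (-((p.1 * y + p.2 * z : ℝ) * Complex.I)) * jointChar E (m + 2) p := by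
  have hmp := Complex.volume_preserving_equiv_real_prod
  have hpi := Real.pi_pos
  have hcont : Continuous fun w : ℂ => (jointDensity E m (w.re, w.im) : ℂ) := by
    have := h.continuous_jointDensity m
    fun_prop
  have hg : Integrable fun w : ℂ => (jointDensity E m (w.re, w.im) : ℂ) :=
    (hmp.integrable_comp_of_integrable (h.integrable_jointDensity m)).ofReal (𝕜 := ℂ)
  have hF : 𝓕 (fun w : ℂ => (jointDensity E m (w.re, w.im) : ℂ))
      = fun ξ : ℂ => jointChar E (m + 2) ((-(2 * Real.pi)) • (ξ.re, ξ.im)) :=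
    funext (h.fourier_jointDensity m)
  have hFint : Integrable (𝓕 fun w : ℂ => (jointDensity E m (w.re, w.im) : ℂ)) := by
    rw [hF]
    exact hmp.integrable_comp_of_integrable
      (g := fun p : ℝ × ℝ => jointChar E (m + 2) ((-(2 * Real.pi)) • p))
      (hInt.comp_smul (by simp [hpi.ne']))
  have hinv := congrFun (hcont.fourierInv_fourier_eq hg hFint) ⟨y, z⟩
  simp only at hinv
  rw [← hinv, hF, Real.fourierInv_eq']
  have e : ((2 * Real.pi) ^ 2)⁻¹ = |((-(2 * Real.pi)) ^ Module.finrank ℝ (ℝ × ℝ))⁻¹| := by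
    rw [Module.finrank_prod, Module.finrank_self, neg_sq, abs_of_pos (by positivity)]
  rw [e, ← Measure.integral_comp_smul volume (fun p : ℝ × ℝ =>
    Complex.exp (-((p.1 * y + p.2 * z : ℝ) * Complex.I)) * jointChar E (m + 2) p),
    ← hmp.integral_comp']
  refine integral_congr_ae (Eventually.of_forall fun v => ?_)
  simp only [Complex.measurableEquivRealProd_apply, Complex.inner, smul_eq_mul, Prod.smul_mk]
  congr 2
  simp [Complex.mul_re]
  ring

/-- The joint density of the walk and its area is of order at most `n⁻²`. -/
lemma exists_jointDensity_le (h : IsStepDensity E σ) :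
    ∃ C, 0 < C ∧ ∀ m : ℕ, 1 ≤ m → ∀ p, jointDensity E m p ≤ C / m ^ 2 := by
  obtain ⟨C, hC, hχ⟩ := h.exists_integral_norm_jointChar_le
  obtain ⟨M, hM0, hM⟩ := h.exists_bound
  have hpi := Real.pi_pos
  refine ⟨4 * C + 16 * (M * M), by positivity, fun m hm p => ?_⟩
  have hm0 : (0 : ℝ) < m := by exact_mod_cast (by omega : 0 < m)
  rcases lt_or_ge m 4 with hm4 | hm4
  · have h1 : jointDensity E m p ≤ M * M := by
      have := integral_mono (h.integrable_jointDensity_integrand m p)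
        (integrable_const (M * M) (μ := walkLaw (stepLaw E)))
        fun x => mul_le_mul (hM _) (hM _) (h.nonneg _) hM0.le
      simpa [jointDensity] using this
    refine h1.trans ?_
    rw [le_div_iff₀ (by positivity)]
    have : (m : ℝ) ≤ 4 := by exact_mod_cast hm4.le
    have : (m : ℝ) ^ 2 ≤ 16 := by nlinarith
    nlinarith [mul_pos hM0 hM0]
  · obtain ⟨k, rfl⟩ : ∃ k, m = k + 2 := ⟨m - 2, by omega⟩
    obtain ⟨hInt, hle⟩ := hχ k (by omega)
    have hk0 : (0 : ℝ) < k := by exact_mod_cast (by omega : 0 < k)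
    have e := h.jointDensity_eq_integral (k + 2) hInt p.1 p.2
    have h1 : jointDensity E (k + 2) p ≤ C / k ^ 2 := by
      have hn : ‖(jointDensity E (k + 2) (p.1, p.2) : ℂ)‖ = jointDensity E (k + 2) p := by
        rw [Complex.norm_real, Real.norm_of_nonneg (h.jointDensity_nonneg _ _)]
      rw [← hn, e, norm_smul, Real.norm_of_nonneg (by positivity)]
      refine (mul_le_of_le_one_left (norm_nonneg _) (inv_le_one_of_one_le₀ ?_)).trans
        ((norm_integral_le_integral_norm _).trans (le_trans (le_of_eq ?_) hle))
      · nlinarith [Real.pi_gt_three]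
      · refine integral_congr_ae (Eventually.of_forall fun q => ?_)
        simp only [norm_mul]
        rw [← neg_mul, ← Complex.ofReal_neg, Complex.norm_exp_ofReal_mul_I, one_mul]
    refine h1.trans ?_
    rw [div_le_div_iff₀ (by positivity) (by positivity)]
    have hk2 : (2 : ℝ) ≤ k := by exact_mod_cast (by omega : 2 ≤ k)
    push_cast
    nlinarith [mul_pos hM0 hM0, mul_pos hk0 hk0, mul_pos hC hk0,
      mul_le_mul_of_nonneg_left (show ((k : ℝ) + 2) ^ 2 ≤ 4 * k ^ 2 by nlinarith) hC.le]

/-- Local lower bound for the joint density of the walk and its area. -/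
lemma exists_le_jointDensity (h : IsStepDensity E σ) :
    ∃ c, 0 < c ∧ ∀ R, 0 < R → ∃ m₀ : ℕ, ∀ m : ℕ, m₀ ≤ m → ∀ y z : ℝ, |y| ≤ R → |z| ≤ R →
      c / m ^ 2 ≤ jointDensity E m (y, z) := by
  obtain ⟨C, hC, hχ⟩ := h.exists_integral_norm_jointChar_le
  obtain ⟨c, hc, hlow⟩ := h.exists_le_re_integral_jointChar
  have hpi := Real.pi_pos
  refine ⟨((2 * Real.pi) ^ 2)⁻¹ * c, by positivity, fun R hR => ?_⟩
  obtain ⟨m₀, hm₀⟩ := hlow R hR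
  refine ⟨m₀ + 4, fun m hm y z hy hz => ?_⟩
  obtain ⟨k, rfl⟩ : ∃ k, m = k + 2 := ⟨m - 2, by omega⟩
  have hk0 : (0 : ℝ) < k := by exact_mod_cast (by omega : 0 < k)
  have e := congrArg Complex.re
    (h.jointDensity_eq_integral (k + 2) (hχ k (by omega)).1 y z)
  rw [Complex.ofReal_re, Complex.smul_re, smul_eq_mul] at e
  rw [e, mul_div_assoc]
  refine mul_le_mul_of_nonneg_left (le_trans ?_ (hm₀ k (by omega) y z hy hz)) (by positivity)
  refine div_le_div_of_nonneg_left hc.le (by positivity) ?_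
  push_cast
  nlinarith

end IsStepDensity

/-- The trajectories whose area process stays nonnegative up to time `n`. -/
def positiveArea (n : ℕ) : Set (ℕ → ℝ) := {x | ∀ k ≤ n, 0 ≤ areaSum x k}

lemma measurableSet_positiveArea (n : ℕ) : MeasurableSet (positiveArea n) := by
  simp only [positiveArea, ofPred_forall]
  exact MeasurableSet.iInter fun k => MeasurableSet.iInter fun _ =>
    measurableSet_le measurable_const (by fun_prop)

lemma positiveArea_antitone : Antitone positiveArea :=
  fun _ _ hmn _ hx k hk => hx k (hk.trans hmn)

namespace IsStepDensity

variable {E : ℝ → ℝ} {σ : ℝ} [IsProbabilityMeasure (stepLaw E)]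

lemma exists_measure_abs_areaSum_le (h : IsStepDensity E σ) :
    ∃ η, 0 < η ∧ ∀ n : ℕ, 3 ≤ n →
      (walkLaw (stepLaw E)).real {x | |areaSum x n| < η * (n * √n)} ≤ 1 / 2 := by
  obtain ⟨C, hC, hd⟩ := h.exists_jointDensity_le
  have hσ := h.sigma_pos
  refine ⟨1 / (288 * C * σ), by positivity, fun n hn => ?_⟩
  obtain ⟨m, rfl⟩ : ∃ m, n = m + 2 := ⟨n - 2, by omega⟩
  set n := m + 2 with hndef
  have hm0 : (1 : ℝ) ≤ m := by exact_mod_cast (by omega : 1 ≤ m)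
  have hn0 : (0 : ℝ) < n := by exact_mod_cast (by omega : 0 < n)
  have hsq : √(n : ℝ) ^ 2 = n := Real.sq_sqrt hn0.le
  have hs0 : 0 < √(n : ℝ) := Real.sqrt_pos.2 hn0
  set a : ℝ := 1 / (288 * C * σ) * (n * √n) with ha
  set b : ℝ := 2 * σ * √n with hb
  have ha0 : 0 < a := by positivity
  have hb0 : 0 < b := by positivity
  have hbox : (walkLaw (stepLaw E)).real {x | |areaSum x n| ≤ a ∧ |partialSum x n| ≤ b}
      ≤ 1 / 4 := by
    have e : (walkLaw (stepLaw E)) {x | |areaSum x n| ≤ a ∧ |partialSum x n| ≤ b}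
        = ∫⁻ p in Icc (-b) b ×ˢ Icc (-a) a, ENNReal.ofReal (jointDensity E m p) := by
      rw [← withDensity_apply _ (measurableSet_Icc.prod measurableSet_Icc), ← h.map_walk_area,
        Measure.map_apply (by fun_prop) (measurableSet_Icc.prod measurableSet_Icc)]
      congr 1
      ext x
      simp only [mem_preimage, mem_prod, mem_Icc, mem_ofPred_eq, abs_le, n]
      tauto
    have hle : (walkLaw (stepLaw E)) {x | |areaSum x n| ≤ a ∧ |partialSum x n| ≤ b}
        ≤ ENNReal.ofReal (C / m ^ 2 * (2 * b * (2 * a))) := by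
      rw [e]
      refine (lintegral_mono (g := fun _ => ENNReal.ofReal (C / m ^ 2))
        fun p => ENNReal.ofReal_le_ofReal (hd m (by omega) p)).trans ?_
      rw [setLIntegral_const, Measure.volume_eq_prod, Measure.prod_prod, Real.volume_Icc,
        Real.volume_Icc, ← ENNReal.ofReal_mul (by linarith), ← ENNReal.ofReal_mul (by positivity)]
      refine le_of_eq ?_
      congr 1
      ring
    refine (ENNReal.toReal_le_of_le_ofReal (by positivity) hle).trans ?_
    have : C / m ^ 2 * (2 * b * (2 * a)) = n ^ 2 / (36 * m ^ 2) := by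
      rw [ha, hb]
      field_simp
      rw [hsq]
      ring
    rw [this, div_le_div_iff₀ (by positivity) (by norm_num)]
    have : (n : ℝ) ≤ 3 * m := by rw [hndef]; push_cast; linarith
    nlinarith
  have hS : (walkLaw (stepLaw E)).real {x | b ≤ |partialSum x n|} ≤ 1 / 4 := by
    refine (measure_abs_partialSum_ge_le h.memLp_id h.integral_id_stepLaw n
      hb0).trans ?_
    rw [h.integral_sq_stepLaw, hb, mul_pow, hsq]
    apply le_of_eq
    field_simp
    norm_num
  calc (walkLaw (stepLaw E)).real {x | |areaSum x n| < a}
      ≤ (walkLaw (stepLaw E)).real ({x | |areaSum x n| ≤ a ∧ |partialSum x n| ≤ b}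
          ∪ {x | b ≤ |partialSum x n|}) := by
        refine measureReal_mono fun x (hx : |areaSum x n| < a) => ?_
        rcases le_total |partialSum x n| b with h' | h'
        · exact Or.inl ⟨hx.le, h'⟩
        · exact Or.inr h'
    _ ≤ _ := measureReal_union_le _ _
    _ ≤ 1 / 2 := by linarith

/-- The area is below `-η n ^ (3 / 2)` with probability bounded away from zero. -/
lemma exists_le_measure_areaSum_lt (h : IsStepDensity E σ) :
    ∃ η δ, 0 < η ∧ 0 < δ ∧ ∀ n : ℕ, 3 ≤ n →
      δ ≤ (walkLaw (stepLaw E)).real {x | areaSum x n < -(η * (n * √n))} := by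
  obtain ⟨η, hη, hanti⟩ := h.exists_measure_abs_areaSum_le
  have hσ := h.sigma_pos
  refine ⟨η / 8, η ^ 2 / (64 * σ ^ 2), by positivity, by positivity, fun n hn => ?_⟩
  set P := walkLaw (stepLaw E)
  have hn0 : (0 : ℝ) < n := by exact_mod_cast (by omega : 0 < n)
  have hs0 : 0 < √(n : ℝ) := Real.sqrt_pos.2 hn0
  have hsq : √(n : ℝ) ^ 2 = n := Real.sq_sqrt hn0.le
  set w : ℝ := n * √n with hw
  have hw0 : 0 < w := by positivity
  have hw2 : w ^ 2 = n ^ 3 := by rw [hw, mul_pow, hsq]; ring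
  have hL2 : MemLp (fun x => areaSum x n) 2 P := memLp_areaSum h.memLp_id n
  have hInt : Integrable (fun x => areaSum x n) P := hL2.integrable (by norm_num)
  have hint2 : Integrable (fun x => areaSum x n ^ 2) P := hL2.integrable_sq
  have hsecond : ∫ x, areaSum x n ^ 2 ∂P ≤ n ^ 3 * σ ^ 2 := by
    simpa [h.integral_sq_stepLaw] using
      integral_sq_areaSum_le h.memLp_id h.integral_id_stepLaw n
  have hmean : ∫ x, areaSum x n ∂P = 0 :=
    integral_areaSum h.memLp_id h.integral_id_stepLaw n
  set B : Set (ℕ → ℝ) := {x | areaSum x n < -(η / 8 * w)} with hB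
  have hBm : MeasurableSet B := measurableSet_lt (by fun_prop) measurable_const
  set s : ℝ := η / (8 * σ ^ 2 * w) with hs
  have hs0 : 0 < s := by positivity
  have habs : η * w / 2 ≤ ∫ x, |areaSum x n| ∂P := by
    have h1 := mul_meas_ge_le_integral_of_nonneg
      (Eventually.of_forall fun x => abs_nonneg (areaSum x n)) hInt.abs (η * w)
    have h2 : P.real {x | η * w ≤ |areaSum x n|} = 1 - P.real {x | |areaSum x n| < η * w} := by
      rw [← probReal_compl_eq_one_sub (measurableSet_lt (by fun_prop) measurable_const)]
      congr 1
      ext x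
      simp
    rw [h2] at h1
    have h3 := hanti n hn
    have : 0 < η * w := by positivity
    nlinarith
  have hpt : ∀ x : ℕ → ℝ, |areaSum x n|
      ≤ areaSum x n + η * w / 4 + s * areaSum x n ^ 2 + s⁻¹ * B.indicator 1 x := fun x => by
    have hsA : 0 ≤ s * areaSum x n ^ 2 := by positivity
    by_cases hx : x ∈ B
    · have hx' : areaSum x n < -(η / 8 * w) := hx
      rw [indicator_of_mem hx, Pi.one_apply, mul_one]
      have hneg : areaSum x n < 0 := hx'.trans (neg_neg_of_pos (by positivity))
      rw [abs_of_neg hneg]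
      have h1 : s * s⁻¹ = 1 := mul_inv_cancel₀ hs0.ne'
      have h2 : 0 < s⁻¹ := inv_pos.2 hs0
      have h3 : s * areaSum x n ^ 2 + s⁻¹ + 2 * areaSum x n
          = s⁻¹ * (s * areaSum x n + 1) ^ 2 := by field_simp; ring
      have h4 : 0 ≤ s⁻¹ * (s * areaSum x n + 1) ^ 2 := by positivity
      have h5 : 0 < η * w := by positivity
      linarith
    · rw [indicator_of_notMem hx, mul_zero, add_zero]
      have hx' : -(η / 8 * w) ≤ areaSum x n := not_lt.1 hx
      rcases abs_cases (areaSum x n) with ⟨e, _⟩ | ⟨e, _⟩ <;> rw [e] <;> nlinarith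
  have hBi : Integrable (B.indicator (1 : (ℕ → ℝ) → ℝ)) P :=
    (integrable_const (1 : ℝ)).indicator hBm
  have hle := integral_mono hInt.abs (g := fun x =>
    areaSum x n + η * w / 4 + s * areaSum x n ^ 2 + s⁻¹ * B.indicator 1 x)
    (((hInt.add (integrable_const (η * w / 4))).add (hint2.const_mul s)).add
      (hBi.const_mul s⁻¹)) hpt
  have hval : ∫ x, (areaSum x n + η * w / 4 + s * areaSum x n ^ 2 + s⁻¹ * B.indicator 1 x) ∂P
      = η * w / 4 + s * ∫ x, areaSum x n ^ 2 ∂P + s⁻¹ * P.real B := by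
    have e1 : Integrable (fun x => areaSum x n + η * w / 4) P := hInt.add (integrable_const _)
    have e2 : Integrable (fun x => areaSum x n + η * w / 4 + s * areaSum x n ^ 2) P :=
      e1.add (hint2.const_mul s)
    rw [integral_add e2 (hBi.const_mul _),
      integral_add e1 (hint2.const_mul s), integral_add hInt (integrable_const _), hmean,
      integral_const_mul, integral_const_mul, integral_indicator_one hBm]
    simp
  have hle' := hle.trans hval.le
  have h1 : s * ∫ x, areaSum x n ^ 2 ∂P ≤ η * w / 8 := by
    refine (mul_le_mul_of_nonneg_left hsecond hs0.le).trans (le_of_eq ?_)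
    rw [hs, ← hw2]
    field_simp
  have h2 : η * w / 8 ≤ s⁻¹ * P.real B := by linarith
  have h3 : s * (η * w / 8) ≤ P.real B := by
    rwa [← inv_mul_le_iff₀ (inv_pos.2 hs0), inv_inv] at h2
  refine le_trans (le_of_eq ?_) h3
  rw [hs]
  field_simp
  norm_num

/-- Comparison of the persistence probabilities at times `n` and `q * n`. -/
lemma exists_measure_positiveArea_mul_le (h : IsStepDensity E σ) :
    ∃ K δ, 0 < K ∧ 0 < δ ∧ δ ≤ 1 ∧ ∀ q n : ℕ, 4 ≤ q → 1 ≤ n →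
      (walkLaw (stepLaw E)).real (positiveArea (q * n))
        ≤ K / q + (1 - δ) * (walkLaw (stepLaw E)).real (positiveArea n) := by
  obtain ⟨η, δ, hη, hδ, hlow⟩ := h.exists_le_measure_areaSum_lt
  have hσ := h.sigma_pos
  set P := walkLaw (stepLaw E)
  refine ⟨16 * σ ^ 2 / η ^ 2, δ, by positivity, hδ, (hlow 3 le_rfl).trans measureReal_le_one,
    fun q n hq hn => ?_⟩
  obtain ⟨d, rfl⟩ : ∃ d, q = d + 1 := ⟨q - 1, by omega⟩
  set m := d * n with hm
  have hm3 : 3 ≤ m := by nlinarith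
  have hqn : (d + 1) * n = n + m := by rw [hm]; ring
  have hn0 : (1 : ℝ) ≤ n := by exact_mod_cast hn
  have hd0 : (3 : ℝ) ≤ d := by exact_mod_cast (by omega : 3 ≤ d)
  have hmr : (m : ℝ) = d * n := by rw [hm]; push_cast; ring
  have hm0 : (0 : ℝ) < m := by rw [hmr]; positivity
  have hs0 : 0 < √(m : ℝ) := Real.sqrt_pos.2 hm0
  have hsq : √(m : ℝ) ^ 2 = m := Real.sq_sqrt hm0.le
  set t : ℝ := η * (m * √m) with ht
  have ht0 : 0 < t := by positivity
  have ht2 : t ^ 2 = η ^ 2 * (d * n) ^ 3 := by rw [ht, mul_pow, mul_pow, hsq, hmr]; ring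
  have hA : P.real {a | t / 2 ≤ |areaSum a n|} ≤ 4 * σ ^ 2 / η ^ 2 / d := by
    refine (measure_abs_areaSum_ge_le h.memLp_id h.integral_id_stepLaw n (half_pos ht0)).trans ?_
    rw [h.integral_sq_stepLaw, div_pow, ht2, div_div, div_le_div_iff₀ (by positivity)
      (by positivity)]
    have : (d : ℝ) ≤ d ^ 3 := by nlinarith [sq_nonneg (d : ℝ)]
    have h1 : 0 ≤ (n : ℝ) ^ 3 * σ ^ 2 * η ^ 2 := by positivity
    nlinarith [mul_le_mul_of_nonneg_left this h1]
  have hS : P.real {a | t / 2 / m ≤ |partialSum a n|} ≤ 4 * σ ^ 2 / η ^ 2 / d := by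
    refine (measure_abs_partialSum_ge_le h.memLp_id h.integral_id_stepLaw n
      (div_pos (half_pos ht0) hm0)).trans (le_of_eq ?_)
    rw [h.integral_sq_stepLaw, div_pow, div_pow, ht2, hmr]
    field_simp
    norm_num
  have hneg : P.real {b | -t ≤ areaSum b m} ≤ 1 - δ := by
    have e : {b : ℕ → ℝ | -t ≤ areaSum b m} = {b | areaSum b m < -t}ᶜ := by
      ext b
      simp
    rw [e, probReal_compl_eq_one_sub (measurableSet_lt (by fun_prop) measurable_const)]
    linarith [hlow m hm3]
  set bad : Set (ℕ → ℝ) := {a | t / 2 ≤ |areaSum a n|} ∪ {a | t / 2 / m ≤ |partialSum a n|}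
  have hbad : P.real bad ≤ 8 * σ ^ 2 / η ^ 2 / d := by
    refine (measureReal_union_le _ _).trans ((add_le_add hA hS).trans (le_of_eq ?_))
    ring
  have hsub : (fun p : (ℕ → ℝ) × (ℕ → ℝ) => glue n p.1 p.2) ⁻¹' positiveArea (n + m)
      ⊆ bad ×ˢ univ ∪ positiveArea n ×ˢ {b | -t ≤ areaSum b m} := by
    rintro ⟨a, b⟩ hab
    by_cases ha : a ∈ bad
    · exact Or.inl ⟨ha, mem_univ _⟩
    · refine Or.inr ⟨fun k hk => ?_, ?_⟩
      · have := hab k (by omega)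
        rwa [areaSum_glue_of_le _ _ hk] at this
      · have h1 := hab (n + m) le_rfl
        simp only [areaSum_glue_add] at h1
        simp only [bad, mem_union, mem_ofPred_eq, not_or, not_le] at ha
        have h2 := (abs_lt.1 ha.1).2
        have h3 : m * partialSum a n < t / 2 := by
          have := (abs_lt.1 ha.2).2
          rwa [lt_div_iff₀' hm0] at this
        change -t ≤ areaSum b m
        linarith
  rw [hqn, ← (measurePreserving_glue (stepLaw E) n).measureReal_preimage
    (measurableSet_positiveArea _).nullMeasurableSet]
  refine (measureReal_mono hsub).trans ((measureReal_union_le _ _).trans ?_)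
  rw [measureReal_prod_prod, measureReal_prod_prod, probReal_univ, mul_one]
  refine add_le_add (hbad.trans ?_) ?_
  · push_cast
    rw [div_le_div_iff₀ (by positivity) (by positivity)]
    have : 0 < σ ^ 2 / η ^ 2 := by positivity
    have e1 : 8 * σ ^ 2 / η ^ 2 = 8 * (σ ^ 2 / η ^ 2) := by ring
    have e2 : 16 * σ ^ 2 / η ^ 2 = 16 * (σ ^ 2 / η ^ 2) := by ring
    rw [e1, e2]
    nlinarith
  · rw [mul_comm]
    exact mul_le_mul_of_nonneg_right hneg measureReal_nonneg

lemma exists_measure_positiveArea_pow_le (h : IsStepDensity E σ) :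
    ∃ K δ, 0 < K ∧ 0 < δ ∧ δ ≤ 1 ∧ ∀ q L : ℕ, 4 ≤ q →
      (walkLaw (stepLaw E)).real (positiveArea (q ^ L)) ≤ K / q + (1 - δ) ^ L := by
  obtain ⟨K, δ, hK, hδ, hδ1, hrec⟩ := h.exists_measure_positiveArea_mul_le
  refine ⟨K / δ, δ, by positivity, hδ, hδ1, fun q L hq => ?_⟩
  have hq0 : (0 : ℝ) < q := by exact_mod_cast (by omega : 0 < q)
  induction L with
  | zero =>
    refine measureReal_le_one.trans ?_
    rw [pow_zero]
    have : 0 < K / δ / q := by positivity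
    linarith
  | succ L ih =>
    rw [pow_succ']
    refine (hrec q (q ^ L) hq (Nat.one_le_pow _ _ (by omega))).trans
      ((add_le_add_right (mul_le_mul_of_nonneg_left ih (by linarith)) _).trans (le_of_eq ?_))
    rw [pow_succ']
    field_simp
    ring

/-- The persistence probability of the area decays faster than `1 / log n`. -/
lemma exists_measure_positiveArea_le (h : IsStepDensity E σ) :
    ∃ C, 0 < C ∧ ∀ n : ℕ, 2 ≤ n →
      (walkLaw (stepLaw E)).real (positiveArea n) ≤ C / Real.log n ^ 2 := by
  obtain ⟨K, δ, hK, hδ, hδ1, hpow⟩ := h.exists_measure_positiveArea_pow_le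
  set r : ℝ := max (1 / 2) (1 - δ)
  have hr0 : 0 < r := lt_max_of_lt_left (by norm_num)
  have hr1 : r < 1 := max_lt (by norm_num) (by linarith)
  obtain ⟨B, hB⟩ := (tendsto_pow_const_mul_const_pow_of_abs_lt_one 4
    (by rwa [abs_of_pos hr0] : |r| < 1)).bddAbove_range
  have hB' : ∀ L : ℕ, ((L : ℝ) + 1) ^ 4 * r ^ L ≤ B / r := fun L => by
    have := hB ⟨L + 1, rfl⟩
    rw [le_div_iff₀ hr0]
    calc ((L : ℝ) + 1) ^ 4 * r ^ L * r = ((L + 1 : ℕ) : ℝ) ^ 4 * r ^ (L + 1) := by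
          push_cast; ring
      _ ≤ B := this
  have hB0 : 0 ≤ B / r := le_trans (by positivity) (hB' 0)
  refine ⟨(K + 1) * (B / r) + 16, by positivity, fun n hn => ?_⟩
  have hn0 : (2 : ℝ) ≤ n := by exact_mod_cast hn
  have hlog0 : 0 < Real.log n := Real.log_pos (by linarith)
  set L := Nat.sqrt (Nat.log 2 n) with hL
  have hlogL : Real.log n ^ 2 ≤ ((L : ℝ) + 1) ^ 4 := by
    have h1 : n < 2 ^ (Nat.log 2 n + 1) := Nat.lt_pow_succ_log_self (by norm_num) n
    have h2 : Nat.log 2 n + 1 ≤ (L + 1) ^ 2 := by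
      have := Nat.lt_succ_sqrt' (Nat.log 2 n)
      exact this
    have h3 : (n : ℝ) ≤ 2 ^ ((L + 1) ^ 2) := by
      exact_mod_cast h1.le.trans (Nat.pow_le_pow_right (by norm_num) h2)
    have h4 : Real.log n ≤ ((L : ℝ) + 1) ^ 2 := by
      refine (Real.log_le_log (by linarith) h3).trans ?_
      rw [Real.log_pow]
      push_cast
      exact mul_le_of_le_one_right (by positivity) (by linarith [Real.log_two_lt_d9])
    calc Real.log n ^ 2 ≤ (((L : ℝ) + 1) ^ 2) ^ 2 := pow_le_pow_left₀ hlog0.le h4 2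
      _ = _ := by ring
  rw [le_div_iff₀ (by positivity)]
  refine (mul_le_mul_of_nonneg_left hlogL measureReal_nonneg).trans ?_
  rcases lt_or_ge L 2 with hL2 | hL2
  · have h1 : ((L : ℝ) + 1) ^ 4 ≤ 16 := by
      have : (L : ℝ) + 1 ≤ 2 := by exact_mod_cast hL2
      calc ((L : ℝ) + 1) ^ 4 ≤ 2 ^ 4 := pow_le_pow_left₀ (by positivity) this 4
        _ = 16 := by norm_num
    have h2 := mul_le_mul (measureReal_le_one (μ := walkLaw (stepLaw E)) (s := positiveArea n)) h1
      (by positivity) zero_le_one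
    have : 0 ≤ (K + 1) * (B / r) := by positivity
    linarith
  · have hpn : (2 ^ L) ^ L ≤ n := by
      rw [← pow_mul]
      refine (Nat.pow_le_pow_right (by norm_num) ?_).trans (Nat.pow_log_le_self 2 (by omega))
      exact Nat.sqrt_le _
    have h4 : 4 ≤ 2 ^ L := by
      calc 4 = 2 ^ 2 := by norm_num
        _ ≤ 2 ^ L := Nat.pow_le_pow_right (by norm_num) hL2
    have h1 : (walkLaw (stepLaw E)).real (positiveArea n) ≤ (K + 1) * r ^ L := by
      refine (measureReal_mono (positiveArea_antitone hpn)).trans ((hpow _ L h4).trans ?_)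
      have e1 : K / ((2 ^ L : ℕ) : ℝ) ≤ K * r ^ L := by
        push_cast
        rw [div_eq_mul_inv, ← inv_pow]
        refine mul_le_mul_of_nonneg_left (pow_le_pow_left₀ (by positivity) ?_ L) hK.le
        exact le_trans (by norm_num) (le_max_left _ _)
      have e2 : (1 - δ) ^ L ≤ r ^ L :=
        pow_le_pow_left₀ (by linarith) (le_max_right _ _) L
      linarith
    calc _ ≤ (K + 1) * r ^ L * ((L : ℝ) + 1) ^ 4 :=
          mul_le_mul_of_nonneg_right h1 (by positivity)
      _ = (K + 1) * (((L : ℝ) + 1) ^ 4 * r ^ L) := by ring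
      _ ≤ (K + 1) * (B / r) := mul_le_mul_of_nonneg_left (hB' L) (by positivity)
      _ ≤ _ := by linarith

end IsStepDensity

/-- The bridge path whose first `n` heights are the areas of `a` and whose last `m` heights, read
backwards, are the areas of `b`. -/
def bridgePath (n m : ℕ) (a b : ℕ → ℝ) (k : Fin (n + m)) : ℝ :=
  if (k : ℕ) < n then areaSum a (k + 1) else areaSum b (n + m - k)

lemma bridgeExt_bridgePath_left {n m k : ℕ} (a b : ℕ → ℝ) (hk : k ≤ n) :
    bridgeExt (n + m) (bridgePath n m a b) k = areaSum a k := by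
  rcases Nat.eq_zero_or_pos k with rfl | h0
  · simp [bridgeExt, areaSum_zero]
  · rw [bridgeExt, dif_pos (by omega), bridgePath]
    simp only [Int.toNat_natCast]
    rw [if_pos (by omega), Nat.sub_add_cancel h0]

lemma bridgeExt_bridgePath_left_pred {n m k : ℕ} (a b : ℕ → ℝ) (hk : k ≤ n + 1) :
    bridgeExt (n + m) (bridgePath n m a b) ((k : ℤ) - 1) = areaSum a (k - 1) := by
  rcases Nat.eq_zero_or_pos k with rfl | h0
  · rw [bridgeExt, dif_neg (by omega), areaSum_zero]
  · rw [show (k : ℤ) - 1 = ((k - 1 : ℕ) : ℤ) by omega,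
      bridgeExt_bridgePath_left a b (by omega)]

lemma bridgeExt_bridgePath_right {n m j : ℕ} (a b : ℕ → ℝ) (hj : j ≤ m) :
    bridgeExt (n + m) (bridgePath n m a b) (((n + m + 1 - j : ℕ)) : ℤ) = areaSum b j := by
  rcases Nat.eq_zero_or_pos j with rfl | h0
  · rw [bridgeExt, dif_neg (by omega), areaSum_zero]
  · rw [bridgeExt, dif_pos (by omega), bridgePath]
    simp only [Int.toNat_natCast]
    rw [if_neg (by omega)]
    congr 1
    omega

lemma bridgeExt_bridgePath_right_pred {n m j : ℕ} (a b : ℕ → ℝ) (hj : j ≤ m + 1) :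
    bridgeExt (n + m) (bridgePath n m a b) (((n + m + 1 - j : ℕ) : ℤ) + 1)
      = areaSum b (j - 1) := by
  rcases Nat.eq_zero_or_pos j with rfl | h0
  · rw [bridgeExt, dif_neg (by omega), areaSum_zero]
  · rw [show ((n + m + 1 - j : ℕ) : ℤ) + 1 = ((n + m + 1 - (j - 1) : ℕ) : ℤ) by omega,
      bridgeExt_bridgePath_right a b (by omega)]

lemma areaSum_sub_pred (x : ℕ → ℝ) (k : ℕ) :
    areaSum x k - areaSum x (k - 1) = partialSum x k := by
  cases k with
  | zero => simp [areaSum_zero, partialSum_zero]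
  | succ k => rw [areaSum_succ, Nat.add_sub_cancel]; ring

lemma prod_Icc_int_eq_prod_range (f : ℤ → ℝ) (N : ℕ) :
    ∏ k ∈ Finset.Icc (0 : ℤ) ((N : ℤ) + 1), f k = ∏ k ∈ Finset.range (N + 2), f k := by
  refine (Finset.prod_nbij (fun k : ℕ => (k : ℤ)) (fun k hk => ?_) (fun _ _ _ _ => by simp)
    (fun k hk => ?_) fun _ _ => rfl).symm
  · have := Finset.mem_range.1 hk
    exact Finset.mem_Icc.2 ⟨by omega, by omega⟩
  · have := Finset.mem_Icc.1 (Finset.mem_coe.1 hk)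
    exact ⟨k.toNat, Finset.mem_coe.2 (Finset.mem_range.2 (by omega)), by simp; omega⟩

lemma bridgeWeight_bridgePath (E : ℝ → ℝ) (n m : ℕ) (a b : ℕ → ℝ) :
    bridgeWeight E (n + m) (bridgePath n m a b)
      = (∏ i : Fin n, E (a i)) * (∏ j : Fin m, E (b j))
        * (E (areaSum b m - areaSum a n - partialSum a n)
          * E (areaSum a n - areaSum b m - partialSum b m)) := by
  rw [bridgeWeight, prod_Icc_int_eq_prod_range, show n + m + 2 = n + (2 + m) by ring,
    Finset.prod_range_add, Finset.prod_range_add, ← Finset.prod_range_reflect _ m,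
    Fin.prod_univ_eq_prod_range (fun i => E (a i)), Fin.prod_univ_eq_prod_range (fun i => E (b i)),
    Finset.prod_range_succ, Finset.prod_range_one]
  have h1 : ∀ k ∈ Finset.range n, E (bridgeExt (n + m) (bridgePath n m a b) ((k : ℤ) + 1)
      + bridgeExt (n + m) (bridgePath n m a b) ((k : ℤ) - 1)
      - 2 * bridgeExt (n + m) (bridgePath n m a b) k) = E (a k) := fun k hk => by
    have hk := Finset.mem_range.1 hk
    rw [bridgeExt_bridgePath_left_pred a b (by omega), bridgeExt_bridgePath_left a b hk.le,
      ← Nat.cast_succ, bridgeExt_bridgePath_left a b hk]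
    congr 1
    have e1 := areaSum_sub_pred a k
    have e2 := areaSum_succ a k
    have e3 := partialSum_succ a k
    rw [Nat.succ_eq_add_one]
    linarith
  have h2 : ∀ j ∈ Finset.range m,
      E (bridgeExt (n + m) (bridgePath n m a b) (((n + (2 + (m - 1 - j)) : ℕ) : ℤ) + 1)
      + bridgeExt (n + m) (bridgePath n m a b) (((n + (2 + (m - 1 - j)) : ℕ) : ℤ) - 1)
      - 2 * bridgeExt (n + m) (bridgePath n m a b) ((n + (2 + (m - 1 - j)) : ℕ) : ℤ))
      = E (b j) := fun j hj => by
    have hj := Finset.mem_range.1 hj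
    rw [show ((n + (2 + (m - 1 - j)) : ℕ) : ℤ) - 1 = ((n + m + 1 - (j + 1) : ℕ) : ℤ) by omega,
      show n + (2 + (m - 1 - j)) = n + m + 1 - j by omega,
      bridgeExt_bridgePath_right_pred a b (by omega), bridgeExt_bridgePath_right a b hj.le,
      bridgeExt_bridgePath_right a b hj]
    congr 1
    have e1 := areaSum_sub_pred b j
    have e2 := areaSum_succ b j
    have e3 := partialSum_succ b j
    linarith
  have h3 : bridgeExt (n + m) (bridgePath n m a b) (((n + 0 : ℕ) : ℤ) + 1) = areaSum b m := by
    rw [show ((n + 0 : ℕ) : ℤ) + 1 = ((n + m + 1 - m : ℕ) : ℤ) by omega,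
      bridgeExt_bridgePath_right a b le_rfl]
  have h4 : bridgeExt (n + m) (bridgePath n m a b) (((n + 1 : ℕ) : ℤ) + 1)
      = areaSum b (m - 1) := by
    rw [show n + 1 = n + m + 1 - m by omega, bridgeExt_bridgePath_right_pred a b (by omega)]
  have h5 : bridgeExt (n + m) (bridgePath n m a b) (((n + 1 : ℕ) : ℤ) - 1) = areaSum a n := by
    rw [bridgeExt_bridgePath_left_pred a b le_rfl, Nat.add_sub_cancel]
  have h6 : bridgeExt (n + m) (bridgePath n m a b) ((n + 1 : ℕ) : ℤ) = areaSum b m := by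
    rw [show n + 1 = n + m + 1 - m by omega, bridgeExt_bridgePath_right a b le_rfl]
  rw [Finset.prod_congr rfl h1, Finset.prod_congr rfl h2, h3, h4, h5, h6, add_zero,
    bridgeExt_bridgePath_left_pred a b (by omega), bridgeExt_bridgePath_left a b le_rfl]
  have e1 := areaSum_sub_pred a n
  have e2 := areaSum_sub_pred b m
  rw [show areaSum b m + areaSum a (n - 1) - 2 * areaSum a n
      = areaSum b m - areaSum a n - partialSum a n by linarith,
    show areaSum b (m - 1) + areaSum a n - 2 * areaSum b m
      = areaSum a n - areaSum b m - partialSum b m by linarith]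
  ring

lemma measurable_bridgeWeight {E : ℝ → ℝ} (hE : Measurable E) (N : ℕ) :
    Measurable (bridgeWeight E N) := by
  unfold bridgeWeight
  have : ∀ i : ℤ, Measurable fun z : Fin N → ℝ => bridgeExt N z i := fun i => by
    unfold bridgeExt
    split_ifs <;> fun_prop
  fun_prop

lemma sum_sub_mul_eq_areaSum (a : ℕ → ℝ) {n : ℕ} (i : Fin n) :
    ∑ j : Fin n, (((i : ℕ) + 1 - (j : ℕ) : ℕ) : ℝ) * a j = areaSum a (i + 1) := by
  rw [Fin.sum_univ_eq_sum_range (fun j => (((i : ℕ) + 1 - j : ℕ) : ℝ) * a j), areaSum_eq_sum,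
    ← Finset.sum_subset (Finset.range_mono i.2)]
  · refine Finset.sum_congr rfl fun j hj => ?_
    rw [Nat.cast_sub (Finset.mem_range.1 hj).le]
  · intro j _ hj
    rw [Nat.sub_eq_zero_of_le (by simpa using hj), Nat.cast_zero, zero_mul]

lemma measurePreserving_area (n : ℕ) :
    MeasurePreserving (fun (y : Fin n → ℝ) (i : Fin n) =>
      ∑ j : Fin n, (((i : ℕ) + 1 - (j : ℕ) : ℕ) : ℝ) * y j) volume volume := by
  set T : Matrix (Fin n) (Fin n) ℝ :=
    Matrix.of fun i j => (((i : ℕ) + 1 - (j : ℕ) : ℕ) : ℝ)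
  have hT : T.det = 1 := by
    rw [Matrix.det_of_isLowerTriangular]
    · simp [T]
    · intro i j hij
      have hij : i < j := hij
      simp [T, Nat.sub_eq_zero_of_le (Nat.succ_le_of_lt (Fin.lt_def.1 hij))]
  have := Real.map_matrix_volume_pi_eq_smul_volume_pi (M := T) (by simp [hT])
  rw [hT] at this
  refine ⟨by fun_prop, ?_⟩
  rw [inv_one, abs_one, ENNReal.ofReal_one, one_smul] at this
  exact this

lemma measurePreserving_append_rev (n m : ℕ) :
    MeasurePreserving (fun (p : (Fin n → ℝ) × (Fin m → ℝ)) (k : Fin (n + m)) =>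
      Fin.append p.1 (fun j => p.2 j.rev) k) volume volume := by
  set e : Fin n ⊕ Fin m ≃ Fin (n + m) :=
    (Equiv.sumCongr (Equiv.refl _) Fin.revPerm).trans finSumFinEquiv
  have h1 := (volume_measurePreserving_piCongrLeft (fun _ : Fin (n + m) => ℝ) e).comp
    (volume_measurePreserving_sumPiEquivProdPi_symm (fun _ : Fin n ⊕ Fin m => ℝ))
  convert! h1 using 1
  funext p k
  obtain ⟨s, rfl⟩ := e.surjective k
  have : (MeasurableEquiv.piCongrLeft (fun _ : Fin (n + m) => ℝ) e)
      ((MeasurableEquiv.sumPiEquivProdPi fun _ : Fin n ⊕ Fin m => ℝ).symm p) (e s)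
      = (MeasurableEquiv.sumPiEquivProdPi fun _ : Fin n ⊕ Fin m => ℝ).symm p s :=
    Equiv.piCongrLeft_apply_apply _ e _ s
  rw [Function.comp_apply, this]
  cases s with
  | inl i => simp [e, MeasurableEquiv.sumPiEquivProdPi]
  | inr j => simp [e, MeasurableEquiv.sumPiEquivProdPi]

namespace IsStepDensity

variable {E : ℝ → ℝ} {σ : ℝ} [IsProbabilityMeasure (stepLaw E)]

lemma pi_stepLaw (h : IsStepDensity E σ) (n : ℕ) :
    Measure.pi (fun _ : Fin n => stepLaw E)
      = volume.withDensity fun y => ENNReal.ofReal (∏ i, E (y i)) := by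
  refine Measure.pi_eq fun s hs => ?_
  have hnn : ∀ y : Fin n → ℝ, 0 ≤ ∏ i, E (y i) := fun y => Finset.prod_nonneg fun i _ => h.nonneg _
  rw [withDensity_apply _ (MeasurableSet.univ_pi hs), volume_pi, Measure.restrict_pi_pi,
    ← ofReal_integral_eq_lintegral_ofReal
      (Integrable.fintype_prod (f := fun _ => E) fun i => h.int.integrableOn)
      (Eventually.of_forall hnn),
    integral_fintype_prod_eq_prod (f := fun _ : Fin n => E),
    ENNReal.ofReal_prod_of_nonneg fun i _ => setIntegral_nonneg (hs i) fun x _ => h.nonneg x]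
  refine Finset.prod_congr rfl fun i _ => ?_
  rw [stepLaw, withDensity_apply _ (hs i), ofReal_integral_eq_lintegral_ofReal
    h.int.integrableOn (Eventually.of_forall h.nonneg)]

/-- The bridge integral in terms of two independent walks started at both ends. -/
lemma lintegral_bridgeWeight (h : IsStepDensity E σ) (n m : ℕ) {G : (Fin (n + m) → ℝ) → ℝ≥0∞}
    (hG : Measurable G) :
    ∫⁻ z, ENNReal.ofReal (bridgeWeight E (n + m) z) * G z
      = ∫⁻ a, ∫⁻ b, ENNReal.ofReal (E (areaSum b m - areaSum a n - partialSum a n)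
          * E (areaSum a n - areaSum b m - partialSum b m)) * G (bridgePath n m a b)
          ∂walkLaw (stepLaw E) ∂walkLaw (stepLaw E) := by
  have hE : Measurable E := h.cont.measurable
  have hW := measurable_bridgeWeight hE (n + m)
  set ext : ∀ k : ℕ, (Fin k → ℝ) → ℕ → ℝ := fun k y i => if hi : i < k then y ⟨i, hi⟩ else 0
  have hext : ∀ k (y : Fin k → ℝ) (i : Fin k), ext k y i = y i := fun k y i => by simp [ext]
  have hextm : ∀ k, Measurable (ext k) := fun k => by
    refine measurable_pi_lambda _ fun i => ?_
    simp only [ext]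
    split_ifs <;> fun_prop
  have hpath : ∀ a b : ℕ → ℝ, bridgePath n m a b = Fin.append
      (fun i : Fin n => ∑ j : Fin n, (((i : ℕ) + 1 - (j : ℕ) : ℕ) : ℝ) * a j)
      (fun i : Fin m => ∑ j : Fin m, (((i.rev : ℕ) + 1 - (j : ℕ) : ℕ) : ℝ) * b j) := fun a b => by
    funext k
    refine Fin.addCases (fun i => ?_) (fun j => ?_) k
    · rw [Fin.append_left, sum_sub_mul_eq_areaSum, bridgePath, if_pos (by simp)]
      simp
    · rw [Fin.append_right, sum_sub_mul_eq_areaSum, bridgePath, if_neg (by simp)]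
      congr 1
      simp only [Fin.val_natAdd, Fin.val_rev]
      omega
  have hpathm : Measurable fun p : (ℕ → ℝ) × (ℕ → ℝ) => bridgePath n m p.1 p.2 := by
    refine measurable_pi_lambda _ fun k => ?_
    simp only [bridgePath]
    split_ifs <;> fun_prop
  set mid : (ℕ → ℝ) × (ℕ → ℝ) → ℝ := fun p =>
    E (areaSum p.2 m - areaSum p.1 n - partialSum p.1 n)
      * E (areaSum p.1 n - areaSum p.2 m - partialSum p.2 m)
  have hmid : Measurable mid := by fun_prop
  set F : (ℕ → ℝ) × (ℕ → ℝ) → ℝ≥0∞ := fun p =>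
    ENNReal.ofReal (mid p) * G (bridgePath n m p.1 p.2)
  have hF : Measurable F := by fun_prop
  have hF' : Measurable fun p : (Fin n → ℝ) × (Fin m → ℝ) => F (ext n p.1, ext m p.2) := by
    have := hextm n
    have := hextm m
    fun_prop
  have hres : ∀ a b : ℕ → ℝ, F (ext n fun i => a i, ext m fun i => b i) = F (a, b) := fun a b => by
    have ea : ∀ i < n, ext n (fun i => a i) i = a i := fun i hi => by simp [ext, hi]
    have eb : ∀ i < m, ext m (fun i => b i) i = b i := fun i hi => by simp [ext, hi]
    have hp : bridgePath n m (ext n fun i => a i) (ext m fun i => b i) = bridgePath n m a b := by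
      simp only [hpath, hext]
    simp only [F, mid, hp, areaSum_congr ea, areaSum_congr eb, partialSum_congr ea,
      partialSum_congr eb]
  have hmp := (measurePreserving_append_rev n m).comp
    ((measurePreserving_area n).prod (measurePreserving_area m))
  rw [← hmp.lintegral_comp (by fun_prop)]
  have hfin := (measurePreserving_walkLaw_fin (stepLaw E) n).prod
    (measurePreserving_walkLaw_fin (stepLaw E) m)
  calc _ = ∫⁻ p : (Fin n → ℝ) × (Fin m → ℝ), ENNReal.ofReal (∏ i, E (p.1 i))
        * ENNReal.ofReal (∏ i, E (p.2 i)) * F (ext n p.1, ext m p.2) := by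
        refine lintegral_congr fun p => ?_
        have e := bridgeWeight_bridgePath E n m (ext n p.1) (ext m p.2)
        have e' := hpath (ext n p.1) (ext m p.2)
        simp only [hext] at e e'
        simp only [F, Function.comp_apply]
        rw [← ENNReal.ofReal_mul (Finset.prod_nonneg fun i _ => h.nonneg _), ← mul_assoc,
          ← ENNReal.ofReal_mul (mul_nonneg (Finset.prod_nonneg fun i _ => h.nonneg _)
            (Finset.prod_nonneg fun i _ => h.nonneg _)), ← e, e']
        rfl
    _ = ∫⁻ p, F (ext n p.1, ext m p.2) ∂(Measure.pi fun _ : Fin n => stepLaw E).prod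
          (Measure.pi fun _ : Fin m => stepLaw E) := by
        rw [h.pi_stepLaw, h.pi_stepLaw, prod_withDensity (by fun_prop) (by fun_prop),
          lintegral_withDensity_eq_lintegral_mul _ (by fun_prop) hF']
        rfl
    _ = ∫⁻ p, F p ∂(walkLaw (stepLaw E)).prod (walkLaw (stepLaw E)) := by
        rw [← hfin.lintegral_comp hF']
        exact lintegral_congr fun p => hres p.1 p.2
    _ = _ := lintegral_prod _ hF.aemeasurable

end IsStepDensity

/-- Cyclic rotation by `j` of the first `n` indices. -/
def rotateIndex (n j i : ℕ) : ℕ := if i < n then (j + i) % n else i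

lemma rotateIndex_injective (n j : ℕ) : Function.Injective (rotateIndex n j) := by
  intro i i' hii
  unfold rotateIndex at hii
  split_ifs at hii with h1 h2 h2
  · have h3 : (j + i) ≡ (j + i') [MOD n] := hii
    exact Nat.ModEq.eq_of_lt_of_lt (Nat.ModEq.add_left_cancel' j h3) h1 h2
  · exact absurd (hii ▸ Nat.mod_lt _ (by omega)) h2
  · exact absurd (hii ▸ Nat.mod_lt _ (by omega)) h1
  · exact hii

/-- The trajectories staying nonnegative up to time `n` and ending in `[0, ρ]`. -/
def positiveExcursion (n : ℕ) (ρ : ℝ) : Set (ℕ → ℝ) :=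
  {x | (∀ k ≤ n, 0 ≤ partialSum x k) ∧ partialSum x n ≤ ρ}

lemma measurableSet_positiveExcursion (n : ℕ) (ρ : ℝ) :
    MeasurableSet (positiveExcursion n ρ) := by
  have hpos : MeasurableSet {x : ℕ → ℝ | ∀ k ≤ n, 0 ≤ partialSum x k} := by
    simp only [ofPred_forall]
    exact MeasurableSet.iInter fun k => MeasurableSet.iInter fun _ =>
      measurableSet_le measurable_const (by fun_prop)
  exact hpos.inter
    (measurableSet_le (f := fun x : ℕ → ℝ => partialSum x n) (by fun_prop) measurable_const)

lemma areaSum_nonneg_of_partialSum {x : ℕ → ℝ} {n : ℕ} (hx : ∀ k ≤ n, 0 ≤ partialSum x k) {k : ℕ}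
    (hk : k ≤ n) : 0 ≤ areaSum x k :=
  Finset.sum_nonneg fun i hi => hx _ (by have := Finset.mem_range.1 hi; omega)

lemma partialSum_rotateIndex {n : ℕ} (x : ℕ → ℝ) {j k : ℕ} (hj : j < n) (hk : k ≤ n) :
    partialSum (x ∘ rotateIndex n j) k
      = if j + k ≤ n then partialSum x (j + k) - partialSum x j
        else partialSum x n + partialSum x (j + k - n) - partialSum x j := by
  induction k with
  | zero => simp [partialSum_zero, hj.le]
  | succ k ih =>
    rw [partialSum_succ, ih (by omega), Function.comp_apply, rotateIndex,
      if_pos (show k < n by omega)]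
    rcases lt_trichotomy (j + k) n with h | h | h
    · rw [if_pos h.le, if_pos (by omega), Nat.mod_eq_of_lt h, ← add_assoc, partialSum_succ]
      ring
    · rw [if_pos h.le, if_neg (by omega), h, Nat.mod_self, ← add_assoc, h, Nat.add_sub_cancel_left,
        partialSum_succ, partialSum_zero]
      ring
    · rw [if_neg (by omega), if_neg (by omega), Nat.mod_eq_sub_mod h.le,
        Nat.mod_eq_of_lt (by omega), ← add_assoc, Nat.sub_add_comm h.le, partialSum_succ]
      ring

/-- Cycle lemma: a trajectory ending above its start has a rotation staying nonnegative. -/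
lemma exists_rotateIndex_mem_positiveExcursion {n : ℕ} (hn : 0 < n) {ρ : ℝ} {x : ℕ → ℝ}
    (h0 : 0 ≤ partialSum x n) (hρ : partialSum x n ≤ ρ) :
    ∃ j < n, x ∘ rotateIndex n j ∈ positiveExcursion n ρ := by
  obtain ⟨j, hj, hmin⟩ := (Finset.range n).exists_min_image (partialSum x)
    ⟨0, Finset.mem_range.2 hn⟩
  have hj := Finset.mem_range.1 hj
  have hmin' : ∀ l < n, partialSum x j ≤ partialSum x l :=
    fun l hl => hmin l (Finset.mem_range.2 hl)
  have hj0 : partialSum x j ≤ 0 := by simpa [partialSum_zero] using hmin' 0 hn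
  refine ⟨j, hj, fun k hk => ?_, ?_⟩
  · rw [partialSum_rotateIndex x hj hk]
    split_ifs with h
    · rcases h.lt_or_eq with h | h
      · linarith [hmin' _ h]
      · rw [h]
        linarith
    · linarith [hmin' (j + k - n) (by omega)]
  · rw [partialSum_rotateIndex x hj le_rfl]
    split_ifs with h
    · have : j = 0 := by omega
      subst this
      simpa [partialSum_zero] using hρ
    · rw [Nat.add_sub_cancel]
      linarith

lemma measure_positiveExcursion_ge (μ : Measure ℝ) [IsProbabilityMeasure μ] {n : ℕ} (hn : 0 < n)
    (ρ : ℝ) :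
    (walkLaw μ).real {x | partialSum x n ∈ Icc 0 ρ}
      ≤ n * (walkLaw μ).real (positiveExcursion n ρ) := by
  have hsub : {x : ℕ → ℝ | partialSum x n ∈ Icc 0 ρ}
      ⊆ ⋃ j ∈ Finset.range n, (fun x : ℕ → ℝ => x ∘ rotateIndex n j) ⁻¹' positiveExcursion n ρ :=
    fun x hx => by
      obtain ⟨j, hj, hmem⟩ := exists_rotateIndex_mem_positiveExcursion hn hx.1 hx.2
      exact mem_biUnion (Finset.mem_coe.2 (Finset.mem_range.2 hj)) hmem
  refine (measureReal_mono hsub (measure_ne_top _ _)).trans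
    ((measureReal_biUnion_finset_le _ _).trans (le_of_eq ?_))
  rw [Finset.sum_congr rfl fun j _ => (measurePreserving_walkLaw_comp μ
    (rotateIndex_injective n j)).measureReal_preimage
      (measurableSet_positiveExcursion n ρ).nullMeasurableSet]
  simp

namespace IsStepDensity

variable {E : ℝ → ℝ} {σ : ℝ}

lemma measureReal_stepLaw_Icc_ge (h : IsStepDensity E σ) [IsProbabilityMeasure (stepLaw E)]
    {r e s : ℝ} (he : 0 ≤ e) (hE : ∀ x, |x| ≤ r → e ≤ E x) (hs : s ≤ r) :
    e * s ≤ (stepLaw E).real (Icc 0 s) := by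
  have hle : ENNReal.ofReal (e * s) ≤ stepLaw E (Icc 0 s) := by
    rw [stepLaw, withDensity_apply _ measurableSet_Icc]
    calc ENNReal.ofReal (e * s) = ∫⁻ _ in Icc 0 s, ENNReal.ofReal e := by
          rw [setLIntegral_const, Real.volume_Icc, sub_zero, ENNReal.ofReal_mul he]
      _ ≤ _ := setLIntegral_mono h.cont.measurable.ennreal_ofReal fun x hx =>
          ENNReal.ofReal_le_ofReal (hE x (by rw [abs_of_nonneg hx.1]; exact hx.2.trans hs))
  exact (ENNReal.ofReal_le_iff_le_toReal (measure_ne_top _ _)).1 hle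

variable [IsProbabilityMeasure (stepLaw E)]

lemma exists_measure_partialSum_Icc_pos (h : IsStepDensity E σ) {ρ : ℝ} (hρ : 0 < ρ) (n₀ : ℕ) :
    ∃ κ, 0 < κ ∧ ∀ n ≤ n₀, κ ≤ (walkLaw (stepLaw E)).real {x | partialSum x n ∈ Icc 0 ρ} := by
  obtain ⟨r, e, hr, he, hE⟩ := h.exists_lower_bound
  set s := min r (ρ / (n₀ + 1))
  have hs0 : 0 < s := lt_min hr (by positivity)
  have hpos : 0 < (stepLaw E).real (Icc 0 s) :=
    lt_of_lt_of_le (mul_pos he hs0) (h.measureReal_stepLaw_Icc_ge he.le hE (min_le_left _ _))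
  refine ⟨(stepLaw E).real (Icc 0 s) ^ n₀, by positivity, fun n hn => ?_⟩
  have e1 : (stepLaw E).real (Icc 0 s) ^ n₀
      = (walkLaw (stepLaw E)).real ((fun (x : ℕ → ℝ) (i : Fin n₀) => x i) ⁻¹'
          Set.pi univ fun _ => Icc 0 s) := by
    rw [(measurePreserving_walkLaw_fin (stepLaw E) n₀).measureReal_preimage
      (MeasurableSet.univ_pi fun _ => measurableSet_Icc).nullMeasurableSet, measureReal_def,
      measureReal_def, Measure.pi_pi, ENNReal.toReal_prod]
    simp
  rw [e1]
  refine measureReal_mono fun x hx => ?_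
  have hx' : ∀ i < n, x i ∈ Icc 0 s := fun i hi => hx ⟨i, by omega⟩ (mem_univ _)
  refine ⟨Finset.sum_nonneg fun i hi => (hx' i (Finset.mem_range.1 hi)).1, ?_⟩
  calc partialSum x n ≤ ∑ _i ∈ Finset.range n, s :=
        Finset.sum_le_sum fun i hi => (hx' i (Finset.mem_range.1 hi)).2
    _ = n * s := by simp
    _ ≤ (n₀ + 1) * (ρ / (n₀ + 1)) := by
        refine mul_le_mul ?_ (min_le_right _ _) hs0.le (by positivity)
        have : (n : ℝ) ≤ n₀ := by exact_mod_cast hn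
        linarith
    _ = ρ := by field_simp

lemma exists_le_measure_partialSum_Icc (h : IsStepDensity E σ) {ρ : ℝ} (hρ : 0 < ρ) :
    ∃ c, 0 < c ∧ ∀ n : ℕ, 1 ≤ n →
      c / n ^ 2 ≤ (walkLaw (stepLaw E)).real {x | partialSum x n ∈ Icc 0 ρ} := by
  obtain ⟨c, hc, hd⟩ := h.exists_le_jointDensity
  obtain ⟨m₀, hm₀⟩ := hd (max ρ 1) (lt_max_of_lt_left hρ)
  obtain ⟨κ, hκ, hsmall⟩ := h.exists_measure_partialSum_Icc_pos hρ (m₀ + 3)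
  refine ⟨min (c * ρ) κ, lt_min (by positivity) hκ, fun n hn => ?_⟩
  have hn0 : (1 : ℝ) ≤ n := by exact_mod_cast hn
  rcases le_or_gt n (m₀ + 3) with hle | hlt
  · refine le_trans ?_ (hsmall n hle)
    rw [div_le_iff₀ (by positivity)]
    have : (1 : ℝ) ≤ n ^ 2 := one_le_pow₀ hn0
    nlinarith [min_le_right (c * ρ) κ]
  · obtain ⟨m, rfl⟩ : ∃ m, n = m + 2 := ⟨n - 2, by omega⟩
    have hm0 : (0 : ℝ) < m := by exact_mod_cast (by omega : 0 < m)
    have e : (walkLaw (stepLaw E)) {x | partialSum x (m + 2) ∈ Icc 0 ρ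
          ∧ areaSum x (m + 2) ∈ Icc (0 : ℝ) 1}
        = ∫⁻ p in Icc 0 ρ ×ˢ Icc 0 1, ENNReal.ofReal (jointDensity E m p) := by
      rw [← withDensity_apply _ (measurableSet_Icc.prod measurableSet_Icc), ← h.map_walk_area,
        Measure.map_apply (by fun_prop) (measurableSet_Icc.prod measurableSet_Icc)]
      rfl
    have hle : ENNReal.ofReal (c / m ^ 2 * ρ)
        ≤ (walkLaw (stepLaw E)) {x | partialSum x (m + 2) ∈ Icc 0 ρ
          ∧ areaSum x (m + 2) ∈ Icc (0 : ℝ) 1} := by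
      rw [e]
      calc ENNReal.ofReal (c / m ^ 2 * ρ)
          = ∫⁻ _ in Icc 0 ρ ×ˢ Icc (0 : ℝ) 1, ENNReal.ofReal (c / m ^ 2) := by
            rw [setLIntegral_const, Measure.volume_eq_prod, Measure.prod_prod, Real.volume_Icc,
              Real.volume_Icc, sub_zero, sub_zero, ENNReal.ofReal_one, mul_one,
              ENNReal.ofReal_mul (by positivity)]
        _ ≤ _ := by
            refine setLIntegral_mono (h.continuous_jointDensity m).measurable.ennreal_ofReal
              fun p hp => ENNReal.ofReal_le_ofReal (hm₀ m (by omega) p.1 p.2 ?_ ?_)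
            · rw [abs_of_nonneg hp.1.1]
              exact hp.1.2.trans (le_max_left _ _)
            · rw [abs_of_nonneg hp.2.1]
              exact hp.2.2.trans (le_max_right _ _)
    have h1 := (ENNReal.ofReal_le_iff_le_toReal (measure_ne_top _ _)).1 hle
    have h2 : (walkLaw (stepLaw E)).real {x | partialSum x (m + 2) ∈ Icc 0 ρ
          ∧ areaSum x (m + 2) ∈ Icc (0 : ℝ) 1}
        ≤ (walkLaw (stepLaw E)).real {x | partialSum x (m + 2) ∈ Icc 0 ρ} :=
      measureReal_mono fun x hx => hx.1
    refine le_trans ?_ (h1.trans h2)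
    rw [div_mul_eq_mul_div, div_le_div_iff₀ (by positivity) (by positivity)]
    have h3 : (m : ℝ) ^ 2 ≤ ((m + 2 : ℕ) : ℝ) ^ 2 := by push_cast; nlinarith
    exact mul_le_mul (min_le_left _ _) h3 (by positivity) (by positivity)

/-- With polynomially small probability the walk stays nonnegative, returns close to the origin
and its area lies in a prescribed interval of length `ρ`. -/
lemma exists_le_measure_positiveExcursion_area (h : IsStepDensity E σ) {ρ : ℝ} (hρ : 0 < ρ) :
    ∃ c, 0 < c ∧ ∀ n : ℕ, 1 ≤ n → ∃ u : ℝ,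
      c / n ^ 6 ≤ (walkLaw (stepLaw E)).real
        (positiveExcursion n ρ ∩ {x | areaSum x n ∈ Icc u (u + ρ)}) := by
  obtain ⟨c, hc, hret⟩ := h.exists_le_measure_partialSum_Icc hρ
  have hσ := h.sigma_pos
  set P := walkLaw (stepLaw E)
  set t : ℝ := σ * √(2 / c) with ht
  have ht0 : 0 < t := by positivity
  have ht2 : t ^ 2 = 2 * σ ^ 2 / c := by
    rw [ht, mul_pow, Real.sq_sqrt (by positivity)]
    ring
  set k₀ := ⌈t / ρ⌉₊
  have hk₀ : 0 < k₀ := Nat.ceil_pos.2 (by positivity)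
  have hk₀' : t ≤ k₀ * ρ := (div_le_iff₀ hρ).1 (Nat.le_ceil _)
  have hk₀r : (0 : ℝ) < k₀ := by exact_mod_cast hk₀
  refine ⟨c / (2 * k₀), by positivity, fun n hn => ?_⟩
  have hn0 : (1 : ℝ) ≤ n := by exact_mod_cast hn
  have hgood : c / n ^ 3 ≤ P.real (positiveExcursion n ρ) := by
    have h1 := (hret n hn).trans (measure_positiveExcursion_ge (stepLaw E) hn ρ)
    rw [div_le_iff₀ (by positivity)] at h1 ⊢
    calc c ≤ _ := h1
      _ = _ := by ring
  have hfar : P.real {x | t * n ^ 3 ≤ |areaSum x n|} ≤ c / (2 * n ^ 3) := by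
    refine (measure_abs_areaSum_ge_le h.memLp_id h.integral_id_stepLaw n
      (by positivity)).trans (le_of_eq ?_)
    rw [h.integral_sq_stepLaw, mul_pow, ht2]
    field_simp
  set B : ℕ → Set (ℕ → ℝ) := fun i =>
    positiveExcursion n ρ ∩ {x | areaSum x n ∈ Icc (i * ρ) (i * ρ + ρ)}
  have hcover : positiveExcursion n ρ
      ⊆ {x | t * n ^ 3 ≤ |areaSum x n|} ∪ ⋃ i ∈ Finset.range (k₀ * n ^ 3), B i := fun x hx => by
    by_cases hA : t * n ^ 3 ≤ |areaSum x n|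
    · exact Or.inl hA
    · have hA0 : 0 ≤ areaSum x n := areaSum_nonneg_of_partialSum hx.1 le_rfl
      rw [abs_of_nonneg hA0, not_le] at hA
      have hq0 : 0 ≤ areaSum x n / ρ := by positivity
      refine Or.inr (mem_biUnion (x := ⌊areaSum x n / ρ⌋₊) (Finset.mem_coe.2
        (Finset.mem_range.2 ((Nat.floor_lt hq0).2 ?_))) ⟨hx, ?_, ?_⟩)
      · rw [div_lt_iff₀ hρ]
        push_cast
        calc areaSum x n < t * n ^ 3 := hA
          _ ≤ k₀ * ρ * n ^ 3 := mul_le_mul_of_nonneg_right hk₀' (by positivity)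
          _ = _ := by ring
      · exact (le_div_iff₀ hρ).1 (Nat.floor_le hq0)
      · have := (div_lt_iff₀ hρ).1 (Nat.lt_floor_add_one (areaSum x n / ρ))
        linarith
  have hsum : c / (2 * n ^ 3) ≤ ∑ i ∈ Finset.range (k₀ * n ^ 3), P.real (B i) := by
    have h1 := (measureReal_mono hcover (μ := P)).trans ((measureReal_union_le _ _).trans
      (add_le_add_right (measureReal_biUnion_finset_le _ _) _))
    have e : c / (n : ℝ) ^ 3 = c / (2 * n ^ 3) + c / (2 * n ^ 3) := by field_simp; norm_num
    linarith
  by_contra! hcon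
  have hlt : ∑ i ∈ Finset.range (k₀ * n ^ 3), P.real (B i)
      < ∑ _i ∈ Finset.range (k₀ * n ^ 3), c / (2 * k₀) / n ^ 6 :=
    Finset.sum_lt_sum_of_nonempty (Finset.nonempty_range_iff.2 (by positivity))
      fun i _ => hcon (i * ρ)
  have e : ∑ _i ∈ Finset.range (k₀ * n ^ 3), c / (2 * k₀) / (n : ℝ) ^ 6 = c / (2 * n ^ 3) := by
    rw [Finset.sum_const, Finset.card_range, nsmul_eq_mul]
    push_cast
    field_simp
  linarith

end IsStepDensity

lemma bridgePath_nonneg_iff {n m : ℕ} {a b : ℕ → ℝ} :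
    (∀ i, 0 ≤ bridgePath n m a b i) ↔ a ∈ positiveArea n ∧ b ∈ positiveArea m := by
  constructor
  · refine fun hp => ⟨fun k hk => ?_, fun k hk => ?_⟩
    · rcases Nat.eq_zero_or_pos k with rfl | h0
      · rw [areaSum_zero]
      · have := hp ⟨k - 1, by omega⟩
        rwa [bridgePath, if_pos (by simp only; omega), Nat.sub_add_cancel h0] at this
    · rcases Nat.eq_zero_or_pos k with rfl | h0
      · rw [areaSum_zero]
      · have := hp ⟨n + m - k, by omega⟩
        rwa [bridgePath, if_neg (by simp only; omega), Nat.sub_sub_self (by omega)] at this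
  · rintro ⟨ha, hb⟩ i
    rw [bridgePath]
    split_ifs with hi
    · exact ha _ hi
    · exact hb _ (by omega)

lemma measurableSet_nonneg_pi (N : ℕ) : MeasurableSet {z : Fin N → ℝ | ∀ i, 0 ≤ z i} := by
  simp only [ofPred_forall]
  exact MeasurableSet.iInter fun i => measurableSet_le measurable_const (by fun_prop)

namespace IsStepDensity

variable {E : ℝ → ℝ} {σ : ℝ}

lemma bridgeWeight_nonneg (h : IsStepDensity E σ) (N : ℕ) (z : Fin N → ℝ) :
    0 ≤ bridgeWeight E N z :=
  Finset.prod_nonneg fun _ _ => h.nonneg _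

variable [IsProbabilityMeasure (stepLaw E)]

lemma lintegral_ofReal_bridgeWeight (h : IsStepDensity E σ) (N : ℕ) :
    ∫⁻ z, ENNReal.ofReal (bridgeWeight E N z) = ENNReal.ofReal (jointDensity E N (0, 0)) := by
  have e := h.lintegral_bridgeWeight N 0 (G := fun _ => 1) measurable_const
  simp only [mul_one, areaSum_zero, partialSum_zero, lintegral_const, measure_univ,
    Nat.add_zero] at e
  rw [e, h.ofReal_jointDensity]
  refine lintegral_congr fun x => ?_
  rw [ENNReal.ofReal_mul (h.nonneg _)]
  simp

lemma integrable_bridgeWeight (h : IsStepDensity E σ) (N : ℕ) : Integrable (bridgeWeight E N) := by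
  refine ⟨(measurable_bridgeWeight h.cont.measurable N).aestronglyMeasurable, ?_⟩
  rw [hasFiniteIntegral_iff_ofReal (Eventually.of_forall (h.bridgeWeight_nonneg N)),
    h.lintegral_ofReal_bridgeWeight]
  exact ENNReal.ofReal_lt_top

lemma integral_bridgeWeight (h : IsStepDensity E σ) (N : ℕ) :
    ∫ z, bridgeWeight E N z = jointDensity E N (0, 0) := by
  rw [integral_eq_lintegral_of_nonneg_ae (Eventually.of_forall (h.bridgeWeight_nonneg N))
    (h.integrable_bridgeWeight N).aestronglyMeasurable, h.lintegral_ofReal_bridgeWeight,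
    ENNReal.toReal_ofReal (h.jointDensity_nonneg _ _)]

/-- The partition function of the positive bridge, in terms of two walks started at both ends. -/
lemma ofReal_setIntegral_bridgeWeight (h : IsStepDensity E σ) (n m : ℕ) :
    ENNReal.ofReal (∫ z in {z : Fin (n + m) → ℝ | ∀ i, 0 ≤ z i}, bridgeWeight E (n + m) z)
      = ∫⁻ a, ∫⁻ b, ENNReal.ofReal (E (areaSum b m - areaSum a n - partialSum a n)
          * E (areaSum a n - areaSum b m - partialSum b m))
          * ((positiveArea n).indicator 1 a * (positiveArea m).indicator 1 b)
          ∂walkLaw (stepLaw E) ∂walkLaw (stepLaw E) := by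
  have hs := measurableSet_nonneg_pi (n + m)
  rw [ofReal_integral_eq_lintegral_ofReal (h.integrable_bridgeWeight _).integrableOn
    (Eventually.of_forall (h.bridgeWeight_nonneg _)), ← lintegral_indicator hs]
  have e := h.lintegral_bridgeWeight n m
    (G := {z : Fin (n + m) → ℝ | ∀ i, 0 ≤ z i}.indicator 1) (measurable_one.indicator hs)
  calc _ = _ := lintegral_congr fun z => by
        simp only [indicator, Pi.one_apply, mul_ite, mul_one, mul_zero]
    _ = _ := e
    _ = _ := lintegral_congr fun a => lintegral_congr fun b => by
        congr 1
        by_cases ha : a ∈ positiveArea n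
        · by_cases hb : b ∈ positiveArea m
          · rw [indicator_of_mem (show bridgePath n m a b ∈ {z : Fin (n + m) → ℝ | ∀ i, 0 ≤ z i}
              from bridgePath_nonneg_iff.2 ⟨ha, hb⟩), indicator_of_mem ha, indicator_of_mem hb]
            simp
          · rw [indicator_of_notMem (show bridgePath n m a b ∉ {z : Fin (n + m) → ℝ | ∀ i, 0 ≤ z i}
              from fun hp => hb (bridgePath_nonneg_iff.1 hp).2),
              indicator_of_notMem hb, mul_zero]
        · rw [indicator_of_notMem (show bridgePath n m a b ∉ {z : Fin (n + m) → ℝ | ∀ i, 0 ≤ z i}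
            from fun hp => ha (bridgePath_nonneg_iff.1 hp).1),
            indicator_of_notMem ha, zero_mul]

lemma exists_setIntegral_bridgeWeight_le (h : IsStepDensity E σ) :
    ∃ C, 0 < C ∧ ∀ n m : ℕ, 1 ≤ m →
      ∫ z in {z : Fin (n + m) → ℝ | ∀ i, 0 ≤ z i}, bridgeWeight E (n + m) z
        ≤ C / m ^ 2 * (walkLaw (stepLaw E)).real (positiveArea n) := by
  obtain ⟨C, hC, hd⟩ := h.exists_jointDensity_le
  have hE : Measurable E := h.cont.measurable
  refine ⟨C, hC, fun n m hm => ?_⟩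
  have hm0 : (0 : ℝ) < m := by exact_mod_cast hm
  rw [← ENNReal.ofReal_le_ofReal_iff (by positivity)]
  have e := h.ofReal_setIntegral_bridgeWeight (n + m) 0
  simp only [Nat.add_zero, areaSum_zero, partialSum_zero] at e
  rw [e, ENNReal.ofReal_mul (by positivity), ofReal_measureReal]
  have hmono : ∀ x b : ℕ → ℝ, ENNReal.ofReal (E (0 - areaSum x (n + m) - partialSum x (n + m))
      * E (areaSum x (n + m) - 0 - 0))
      * ((positiveArea (n + m)).indicator 1 x * (positiveArea 0).indicator 1 b)
      ≤ ENNReal.ofReal (E (0 - areaSum x (n + m) - partialSum x (n + m)))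
        * ENNReal.ofReal (E (areaSum x (n + m))) * (positiveArea n).indicator 1 x := fun x b => by
    rw [ENNReal.ofReal_mul (h.nonneg _), sub_zero, sub_zero]
    gcongr
    calc (positiveArea (n + m)).indicator 1 x * (positiveArea 0).indicator 1 b
        ≤ (positiveArea (n + m)).indicator (1 : (ℕ → ℝ) → ℝ≥0∞) x * 1 := by
          gcongr
          exact indicator_le_self' (fun _ _ => zero_le) b
      _ ≤ _ := by
          rw [mul_one]
          exact indicator_le_indicator_of_subset (positiveArea_antitone (by omega))
            (fun _ => zero_le) x
  refine (lintegral_mono fun x => lintegral_mono fun b => hmono x b).trans ?_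
  simp only [lintegral_const, measure_univ, mul_one]
  have hmeas := measurableSet_positiveArea n
  rw [lintegral_walkLaw_glue (stepLaw E) n (F := fun x : ℕ → ℝ =>
      ENNReal.ofReal (E (0 - areaSum x (n + m) - partialSum x (n + m)))
        * ENNReal.ofReal (E (areaSum x (n + m))) * (positiveArea n).indicator 1 x)
    (Measurable.mul (by fun_prop) (measurable_one.indicator hmeas))]
  rw [← lintegral_indicator_one hmeas, ← lintegral_const_mul _ (measurable_one.indicator hmeas)]
  refine lintegral_mono fun a => ?_
  have hind : ∀ b, (positiveArea n).indicator (1 : (ℕ → ℝ) → ℝ≥0∞) (glue n a b)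
      = (positiveArea n).indicator 1 a := fun b => by
    have : glue n a b ∈ positiveArea n ↔ a ∈ positiveArea n := forall₂_congr fun k hk => by
      rw [areaSum_glue_of_le a b hk]
    by_cases ha : a ∈ positiveArea n
    · rw [indicator_of_mem (this.2 ha), indicator_of_mem ha, Pi.one_apply, Pi.one_apply]
    · rw [indicator_of_notMem (mt this.1 ha), indicator_of_notMem ha]
  simp only [hind]
  rw [lintegral_mul_const _ (by have := measurable_glue n; fun_prop)]
  refine mul_le_mul_left (le_trans (le_of_eq ?_) (ENNReal.ofReal_le_ofReal
    (hd m hm (-partialSum a n, -areaSum a n - (m + 2) * partialSum a n)))) _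
  rw [h.ofReal_jointDensity]
  refine lintegral_congr fun b => ?_
  rw [areaSum_glue_add, partialSum_glue_add]
  congr 3 <;> ring

lemma le_setIntegral_bridgeWeight (h : IsStepDensity E σ) {r e : ℝ} (he : 0 ≤ e)
    (hE : ∀ x, |x| ≤ r → e ≤ E x) {n m : ℕ} {U V : Set (ℕ → ℝ)} (hU : MeasurableSet U)
    (hV : MeasurableSet V) (hUp : U ⊆ positiveArea n) (hVp : V ⊆ positiveArea m)
    (hUV : ∀ a ∈ U, ∀ b ∈ V, |areaSum b m - areaSum a n - partialSum a n| ≤ r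
      ∧ |areaSum a n - areaSum b m - partialSum b m| ≤ r) :
    e ^ 2 * ((walkLaw (stepLaw E)).real U * (walkLaw (stepLaw E)).real V)
      ≤ ∫ z in {z : Fin (n + m) → ℝ | ∀ i, 0 ≤ z i}, bridgeWeight E (n + m) z := by
  have hnn : 0 ≤ ∫ z in {z : Fin (n + m) → ℝ | ∀ i, 0 ≤ z i}, bridgeWeight E (n + m) z :=
    integral_nonneg (h.bridgeWeight_nonneg _)
  rw [← ENNReal.ofReal_le_ofReal_iff hnn, h.ofReal_setIntegral_bridgeWeight,
    ENNReal.ofReal_mul (by positivity), ENNReal.ofReal_mul measureReal_nonneg, ofReal_measureReal,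
    ofReal_measureReal, ← lintegral_indicator_one hU, ← lintegral_indicator_one hV,
    ← lintegral_mul_const _ (measurable_one.indicator hU),
    ← lintegral_const_mul _ ((measurable_one.indicator hU).mul_const _)]
  refine lintegral_mono fun a => ?_
  rw [← lintegral_const_mul _ (measurable_one.indicator hV),
    ← lintegral_const_mul _ ((measurable_one.indicator hV).const_mul _)]
  refine lintegral_mono fun b => ?_
  by_cases ha : a ∈ U
  · by_cases hb : b ∈ V
    · obtain ⟨h1, h2⟩ := hUV a ha b hb
      rw [indicator_of_mem ha, indicator_of_mem hb, indicator_of_mem (hUp ha),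
        indicator_of_mem (hVp hb)]
      simp only [Pi.one_apply, mul_one]
      refine ENNReal.ofReal_le_ofReal ?_
      rw [sq]
      exact mul_le_mul (hE _ h1) (hE _ h2) he (h.nonneg _)
    · simp [indicator_of_notMem hb]
  · simp [indicator_of_notMem ha]

end IsStepDensity

lemma positiveExcursion_subset_positiveArea (n : ℕ) (ρ : ℝ) :
    positiveExcursion n ρ ⊆ positiveArea n :=
  fun _ hx _ hk => areaSum_nonneg_of_partialSum hx.1 hk

/-- A set depending on the first `n` steps only is independent of the following step. -/
lemma measureReal_walkLaw_inter_eval (μ : Measure ℝ) [IsProbabilityMeasure μ] {n : ℕ}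
    {U : Set (ℕ → ℝ)} (hU : MeasurableSet U) (hdep : ∀ a b, glue n a b ∈ U ↔ a ∈ U) {t : Set ℝ}
    (ht : MeasurableSet t) :
    (walkLaw μ).real (U ∩ {x | x n ∈ t}) = (walkLaw μ).real U * μ.real t := by
  have hpre : (fun p : (ℕ → ℝ) × (ℕ → ℝ) => glue n p.1 p.2) ⁻¹' (U ∩ {x | x n ∈ t})
      = U ×ˢ ((fun x : ℕ → ℝ => x 0) ⁻¹' t) := by
    ext p
    have : glue n p.1 p.2 n = p.2 0 := glue_add n 0 p.1 p.2
    change (_ ∈ U ∧ glue n p.1 p.2 n ∈ t) ↔ _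
    rw [hdep, this]
    rfl
  have hm : MeasurableSet (U ∩ {x : ℕ → ℝ | x n ∈ t}) := hU.inter (measurable_pi_apply n ht)
  rw [← (measurePreserving_glue μ n).measureReal_preimage hm.nullMeasurableSet, hpre,
    measureReal_prod_prod, (measurePreserving_walkLaw_eval μ 0).measureReal_preimage
      ht.nullMeasurableSet]

namespace IsStepDensity

variable {E : ℝ → ℝ} {σ : ℝ} [IsProbabilityMeasure (stepLaw E)]

lemma exists_le_setIntegral_bridgeWeight (h : IsStepDensity E σ) :
    ∃ c, 0 < c ∧ ∀ N : ℕ, 2 ≤ N →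
      c / N ^ 12 ≤ ∫ z in {z : Fin N → ℝ | ∀ i, 0 ≤ z i}, bridgeWeight E N z := by
  obtain ⟨r, e, hr, he, hE⟩ := h.exists_lower_bound
  set ρ := r / 5 with hρr
  have hρ : 0 < ρ := by positivity
  obtain ⟨c, hc, hex⟩ := h.exists_le_measure_positiveExcursion_area hρ
  set κ := min 1 (e * ρ)
  have hκ : 0 < κ := lt_min one_pos (by positivity)
  refine ⟨e ^ 2 * (c * (c * κ)), by positivity, fun N hN => ?_⟩
  obtain ⟨n, hn, hnN⟩ : ∃ n : ℕ, 1 ≤ n ∧ (N = n + n ∨ N = n + (n + 1)) :=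
    ⟨N / 2, by omega, by omega⟩
  obtain ⟨u, hu⟩ := hex n hn
  set P := walkLaw (stepLaw E)
  set U := positiveExcursion n ρ ∩ {x | areaSum x n ∈ Icc u (u + ρ)}
  have hUm : MeasurableSet U := (measurableSet_positiveExcursion n ρ).inter
    ((show Measurable fun x : ℕ → ℝ => areaSum x n by fun_prop) measurableSet_Icc)
  have hUp : U ⊆ positiveArea n :=
    inter_subset_left.trans (positiveExcursion_subset_positiveArea n ρ)
  have hUb : ∀ a ∈ U, 0 ≤ partialSum a n ∧ partialSum a n ≤ ρ ∧ u ≤ areaSum a n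
      ∧ areaSum a n ≤ u + ρ := fun a ha => ⟨ha.1.1 n le_rfl, ha.1.2, ha.2.1, ha.2.2⟩
  have hn0 : (0 : ℝ) < n := by exact_mod_cast hn
  have hfin : ∀ {x y : ℝ}, c / n ^ 6 ≤ x → κ * (c / n ^ 6) ≤ y →
      e ^ 2 * (c * (c * κ)) / N ^ 12 ≤ e ^ 2 * (x * y) := fun {x y} hx hy => by
    have hnN' : (n : ℝ) ≤ N := by
      have : n ≤ N := by omega
      exact_mod_cast this
    calc e ^ 2 * (c * (c * κ)) / N ^ 12 ≤ e ^ 2 * (c * (c * κ)) / n ^ 12 := by gcongr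
      _ = e ^ 2 * (c / n ^ 6 * (κ * (c / n ^ 6))) := by field_simp
      _ ≤ _ := by
        gcongr
        exact (by positivity : 0 ≤ c / (n : ℝ) ^ 6).trans hx
  rcases hnN with rfl | rfl
  · have hy : κ * (c / n ^ 6) ≤ P.real U :=
      (mul_le_of_le_one_left (by positivity) (min_le_left _ _)).trans hu
    refine (hfin hu hy).trans (h.le_setIntegral_bridgeWeight he.le hE hUm hUm hUp hUp ?_)
    intro a ha b hb
    obtain ⟨a1, a2, a3, a4⟩ := hUb a ha
    obtain ⟨b1, b2, b3, b4⟩ := hUb b hb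
    constructor <;> rw [abs_le] <;> constructor <;> linarith
  · have hdep : ∀ a b, glue n a b ∈ U ↔ a ∈ U := fun a b => by
      refine and_congr (and_congr (forall₂_congr fun k hk => ?_) ?_) ?_
      · rw [partialSum_glue_of_le a b hk]
      · rw [partialSum_glue_of_le a b le_rfl]
      · change _ ∈ Icc _ _ ↔ _ ∈ Icc _ _
        rw [areaSum_glue_of_le a b le_rfl]
    set V := U ∩ {x | x n ∈ Icc 0 ρ}
    have hVm : MeasurableSet V := hUm.inter (measurable_pi_apply n measurableSet_Icc)
    have hVb : ∀ x ∈ V, x ∈ U ∧ 0 ≤ x n ∧ x n ≤ ρ := fun x hx => ⟨hx.1, hx.2.1, hx.2.2⟩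
    have hVp : V ⊆ positiveArea (n + 1) := fun x hx k hk => by
      obtain ⟨hxU, hx0, -⟩ := hVb x hx
      refine areaSum_nonneg_of_partialSum (n := n + 1) (fun j hj => ?_) hk
      rcases Nat.le_succ_iff.1 hj with hj | rfl
      · exact hxU.1.1 j hj
      · rw [partialSum_succ]
        exact add_nonneg (hxU.1.1 n le_rfl) hx0
    have hy : κ * (c / n ^ 6) ≤ P.real V := by
      rw [measureReal_walkLaw_inter_eval _ hUm hdep measurableSet_Icc, mul_comm]
      exact mul_le_mul hu ((min_le_right _ _).trans
        (h.measureReal_stepLaw_Icc_ge he.le hE (by linarith))) hκ.le measureReal_nonneg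
    refine (hfin hu hy).trans (h.le_setIntegral_bridgeWeight he.le hE hUm hVm hUp hVp ?_)
    intro a ha b hb
    obtain ⟨hbU, b5, b6⟩ := hVb b hb
    obtain ⟨a1, a2, a3, a4⟩ := hUb a ha
    obtain ⟨b1, b2, b3, b4⟩ := hUb b hbU
    rw [areaSum_succ, partialSum_succ]
    constructor <;> rw [abs_le] <;> constructor <;> linarith

lemma exists_le_bridgeRatio (h : IsStepDensity E σ) :
    ∃ c, 0 < c ∧ ∀ N : ℕ, 2 ≤ N → c / N ^ 12 ≤ bridgeRatio E N := by
  obtain ⟨c, hc, hnum⟩ := h.exists_le_setIntegral_bridgeWeight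
  obtain ⟨C, hC, hden⟩ := h.exists_jointDensity_le
  refine ⟨c / C, by positivity, fun N hN => ?_⟩
  have hN1 : (1 : ℝ) ≤ N := by
    have : 1 ≤ N := by omega
    exact_mod_cast this
  have hnumN := hnum N hN
  have hle := setIntegral_le_integral (s := {z : Fin N → ℝ | ∀ i, 0 ≤ z i})
    (h.integrable_bridgeWeight N) (Eventually.of_forall (h.bridgeWeight_nonneg N))
  have hpos : 0 < c / (N : ℝ) ^ 12 := by positivity
  have hup : ∫ z, bridgeWeight E N z ≤ C := by
    rw [h.integral_bridgeWeight]
    exact (hden N (by omega) _).trans (div_le_self hC.le (one_le_pow₀ hN1))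
  rw [bridgeRatio, div_right_comm]
  exact div_le_div₀ (hpos.le.trans hnumN) hnumN (hpos.trans_le (hnumN.trans hle)) hup

lemma bridgeRatio_le_one (h : IsStepDensity E σ) (N : ℕ) : bridgeRatio E N ≤ 1 :=
  div_le_one_of_le₀ (setIntegral_le_integral (h.integrable_bridgeWeight N)
    (Eventually.of_forall (h.bridgeWeight_nonneg N))) (integral_nonneg (h.bridgeWeight_nonneg N))

lemma exists_bridgeRatio_le (h : IsStepDensity E σ) :
    ∃ C, 0 < C ∧ ∀ N : ℕ, 2 ≤ N → bridgeRatio E N ≤ C / Real.log N ^ 2 := by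
  obtain ⟨C₁, hC₁, hnum⟩ := h.exists_setIntegral_bridgeWeight_le
  obtain ⟨C₂, hC₂, hpos⟩ := h.exists_measure_positiveArea_le
  obtain ⟨c, hc, hlow⟩ := h.exists_le_jointDensity
  obtain ⟨N₀, hden⟩ := hlow 1 one_pos
  set K := max N₀ 6
  refine ⟨max (16 * C₁ * C₂ / c) (Real.log K ^ 2), lt_max_of_lt_left (by positivity),
    fun N hN => ?_⟩
  have hlogN : 0 < Real.log N := Real.log_pos (by exact_mod_cast hN)
  rcases lt_or_ge N K with hNK | hNK
  · refine (h.bridgeRatio_le_one N).trans ((one_le_div (by positivity)).2 (le_max_of_le_right ?_))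
    have : Real.log N ≤ Real.log K :=
      Real.log_le_log (by positivity) (by exact_mod_cast hNK.le)
    gcongr
  · have hN6 : 6 ≤ N := (le_max_right _ _).trans hNK
    obtain ⟨n, m, rfl, hm, hn, hnm⟩ : ∃ n m : ℕ, N = n + m ∧ n ≤ m ∧ 3 ≤ n ∧ m ≤ n + 1 :=
      ⟨N / 2, N - N / 2, by omega, by omega, by omega, by omega⟩
    have hn0 : (0 : ℝ) < n := by positivity
    have hm0 : (0 : ℝ) < m := by
      have : 0 < m := by omega
      exact_mod_cast this
    have hlogn : 0 < Real.log n := Real.log_pos (by exact_mod_cast (by omega : 1 < n))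
    have hlog : Real.log (n + m : ℕ) ≤ 2 * Real.log n := by
      rw [← Real.log_rpow hn0]
      refine Real.log_le_log (by positivity) ?_
      rw [Real.rpow_two]
      have : n + m ≤ n ^ 2 := by nlinarith
      exact_mod_cast this
    have hmm : ((n + m : ℕ) : ℝ) ≤ 2 * m := by
      have : n + m ≤ 2 * m := by omega
      exact_mod_cast this
    have hD : c / (2 * m) ^ 2 ≤ ∫ z, bridgeWeight E (n + m) z := by
      rw [h.integral_bridgeWeight]
      refine le_trans ?_ (hden (n + m) ((le_max_left _ _).trans hNK) 0 0 (by simp) (by simp))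
      gcongr
    have hNum := hnum n m (by omega)
    have hP := hpos n (by omega)
    calc bridgeRatio E (n + m) ≤ C₁ / m ^ 2 * (C₂ / Real.log n ^ 2) / (c / (2 * m) ^ 2) := by
          refine div_le_div₀ (by positivity) (hNum.trans ?_) (by positivity) hD
          gcongr
      _ = 16 * C₁ * C₂ / c / (2 * Real.log n) ^ 2 := by field_simp; norm_num
      _ ≤ 16 * C₁ * C₂ / c / Real.log (n + m : ℕ) ^ 2 := by gcongr
      _ ≤ _ := by
          gcongr
          exact le_max_left _ _

end IsStepDensity

/-- **Proposition 1.5**, second part: entropic repulsion bounds for the bridge: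
`c/N^{c_-} ≤ P(Ω_N^+ | Z_{N+1} = 0, Z_{N+2} = 0) ≤ C/(log N)^{c_+}` with `c_+ > 1`. -/
theorem entropic_repulsion_bridge
    (E : ℝ → ℝ) (σ : ℝ)
    (hE_nonneg : ∀ x, 0 ≤ E x) (hE_cont : Continuous E)
    (hE_bdd : ∃ M, ∀ x, E x ≤ M) (hE_pos : 0 < E 0)
    (hE_int : Integrable E) (hE_mass : ∫ x, E x = 1)
    (hE_mom1 : Integrable fun x => x * E x) (hE_mean : ∫ x, x * E x = 0)
    (hE_mom2 : Integrable fun x => x ^ 2 * E x) (hE_var : ∫ x, x ^ 2 * E x = σ ^ 2)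
    (hσ : 0 < σ)
 :
    ∃ c C cm cp : ℝ, 0 < c ∧ 0 < C ∧ 0 < cm ∧ 1 < cp ∧
      ∀ N : ℕ, 2 ≤ N →
        c / (N : ℝ) ^ cm ≤ bridgeRatio E N ∧
        bridgeRatio E N ≤ C / (Real.log N) ^ cp := by
  have h : IsStepDensity E σ := ⟨hE_nonneg, hE_cont, hE_bdd, hE_pos, hE_int, hE_mass, hE_mom1,
    hE_mean, hE_mom2, hE_var, hσ⟩
  have := h.isProbabilityMeasure
  obtain ⟨c, hc, hlow⟩ := h.exists_le_bridgeRatio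
  obtain ⟨C, hC, hup⟩ := h.exists_bridgeRatio_le
  refine ⟨c, C, (12 : ℕ), (2 : ℕ), hc, hC, by norm_num, by norm_num, fun N hN => ?_⟩
  rw [Real.rpow_natCast, Real.rpow_natCast]
  exact ⟨hlow N hN, hup N hN⟩
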